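/- There is no Coxeter decomposition of the second type of the hyperbolic simplex H_11^5 with fundamental simplex H_7^5. -/

import Mathlib

noncomputable section

namespace CD

open MeasureTheory Set
open scoped ENNReal

/-! ## Coxeter diagrams, encoded as Coxeter matrices.
A Coxeter diagram on `k` nodes is encoded by its Coxeter matrix
`M : Matrix (Fin k) (Fin k) ℕ`: `M i i = 1`, and for `i ≠ j` the entry `M i j = m`
means that the corresponding facets meet at the dihedral angle `π / m`
(`2` = no edge of the diagram, and `0` encodes the label `∞`, i.e. angle `0`,
consistently with `π / 0 = 0` in Lean). -/

/-- A Coxeter diagram: a number of nodes together with a Coxeter matrix. -/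
def CM : Type := Σ k : ℕ, Matrix (Fin k) (Fin k) ℕ

/-- The Coxeter matrix on `k` nodes with the given list of labelled edges
(`(i, j, m)` is an edge between nodes `i` and `j` with label `m`). -/
def cmOfEdges (k : ℕ) (E : List (ℕ × ℕ × ℕ)) : Matrix (Fin k) (Fin k) ℕ :=
  Matrix.of fun i j =>
    if i = j then 1 else
      match E.find? (fun e => (e.1 == (i : ℕ) && e.2.1 == (j : ℕ)) ||
                              (e.1 == (j : ℕ) && e.2.1 == (i : ℕ))) with
      | some e => e.2.2
      | none => 2

/-- The Coxeter matrix of type `A_k`. -/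
def cmA (k : ℕ) : Matrix (Fin k) (Fin k) ℕ :=
  Matrix.of fun i j =>
    if i = j then 1
    else if (i : ℕ) + 1 = (j : ℕ) ∨ (j : ℕ) + 1 = (i : ℕ) then 3 else 2

/-- The Coxeter matrix of type `D_k`, with the conventions `D_2 = A_1 + A_1` and
`D_3 = A_3`. -/
def cmD (k : ℕ) : Matrix (Fin k) (Fin k) ℕ :=
  Matrix.of fun i j =>
    if i = j then 1
    else if k = 2 then 2
    else if ((i : ℕ) + 1 = (j : ℕ) ∧ (j : ℕ) ≤ k - 2) ∨
            ((j : ℕ) + 1 = (i : ℕ) ∧ (i : ℕ) ≤ k - 2) ∨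
            ((i : ℕ) = k - 3 ∧ (j : ℕ) = k - 1) ∨
            ((j : ℕ) = k - 3 ∧ (i : ℕ) = k - 1)
      then 3 else 2

/-- Direct sum (disjoint union) of two Coxeter matrices. -/
def cmSum {a b : ℕ} (M : Matrix (Fin a) (Fin a) ℕ) (N : Matrix (Fin b) (Fin b) ℕ) :
    Matrix (Fin (a + b)) (Fin (a + b)) ℕ :=
  Matrix.of fun i j =>
    if hi : (i : ℕ) < a then
      if hj : (j : ℕ) < a then M ⟨i, hi⟩ ⟨j, hj⟩ else 2
    else
      if _hj : (j : ℕ) < a then 2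
      else N ⟨(i : ℕ) - a, by have := i.isLt; omega⟩ ⟨(j : ℕ) - a, by have := j.isLt; omega⟩

def cmAdd (x y : CM) : CM := ⟨x.1 + y.1, cmSum x.2 y.2⟩

def cmNil : CM := ⟨0, Matrix.of fun _ _ => 1⟩

/-- Disjoint union of a list of Coxeter diagrams. -/
def cmList (l : List CM) : CM := l.foldr cmAdd cmNil

def cA (k : ℕ) : CM := ⟨k, cmA k⟩
def cD (k : ℕ) : CM := ⟨k, cmD k⟩
def cE6 : CM := ⟨6, cmOfEdges 6 [(0,1,3),(1,2,3),(2,3,3),(3,4,3),(2,5,3)]⟩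
def cE7 : CM := ⟨7, cmOfEdges 7 [(0,1,3),(1,2,3),(2,3,3),(3,4,3),(4,5,3),(2,6,3)]⟩
def cE8 : CM := ⟨8, cmOfEdges 8 [(0,1,3),(1,2,3),(2,3,3),(3,4,3),(4,5,3),(5,6,3),(2,7,3)]⟩
def cF4 : CM := ⟨4, cmOfEdges 4 [(0,1,3),(1,2,4),(2,3,3)]⟩
def cH3 : CM := ⟨3, cmOfEdges 3 [(0,1,5),(1,2,3)]⟩
def cH4 : CM := ⟨4, cmOfEdges 4 [(0,1,5),(1,2,3),(2,3,3)]⟩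
/-- `G₂^{(5)} = I₂(5)`. -/
def cG25 : CM := ⟨2, cmOfEdges 2 [(0,1,5)]⟩

/-- The affine (Euclidean) Coxeter matrix `Ã₃` (a 4-cycle). -/
def cmA3t : Matrix (Fin 4) (Fin 4) ℕ := cmOfEdges 4 [(0,1,3),(1,2,3),(2,3,3),(0,3,3)]
/-- The affine Coxeter matrix `D̃₄`. -/
def cmD4t : Matrix (Fin 5) (Fin 5) ℕ := cmOfEdges 5 [(0,1,3),(0,2,3),(0,3,3),(0,4,3)]
/-- The affine Coxeter matrix `C̃₄`. -/
def cmC4t : Matrix (Fin 5) (Fin 5) ℕ := cmOfEdges 5 [(0,1,4),(1,2,3),(2,3,3),(3,4,4)]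
/-- The affine Coxeter matrix `F̃₄`. -/
def cmF4t : Matrix (Fin 5) (Fin 5) ℕ := cmOfEdges 5 [(0,1,3),(1,2,3),(2,3,4),(3,4,3)]
/-- The affine Coxeter matrix `C̃₂` (the Euclidean (2,4,4)-triangle). -/
def cmC2t : Matrix (Fin 3) (Fin 3) ℕ := cmOfEdges 3 [(0,1,4),(1,2,4)]
/-- The affine Coxeter matrix `G̃₂` (the Euclidean (2,3,6)-triangle). -/
def cmG2t : Matrix (Fin 3) (Fin 3) ℕ := cmOfEdges 3 [(0,1,6),(1,2,3)]

/-- Connectedness of a Coxeter diagram. -/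
def cmConnected (c : CM) : Prop :=
  ∀ i j : Fin c.1, Relation.ReflTransGen (fun a b => 3 ≤ c.2 a b ∨ c.2 a b = 0) i j

/-! ## Hyperbolic space `H^n`: the hyperboloid model. -/

/-- The Minkowski bilinear form of signature `(n,1)` on `ℝ^{n+1}`. -/
def mink (n : ℕ) (x y : EuclideanSpace ℝ (Fin (n + 1))) : ℝ :=
  -(x 0 * y 0) + ∑ i : Fin n, x i.succ * y i.succ

/-- The hyperboloid model of hyperbolic `n`-space:
`{x ∈ ℝ^{n+1} : ⟨x,x⟩ = -1, x₀ > 0}`. -/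
def hypSet (n : ℕ) : Set (EuclideanSpace ℝ (Fin (n + 1))) :=
  {x | mink n x x = -1 ∧ 0 < x 0}

/-- The closed half-space of `H^n` with (spacelike unit) outward normal `v`. -/
def hHalf (n : ℕ) (v : EuclideanSpace ℝ (Fin (n + 1))) : Set ↥(hypSet n) :=
  {x | mink n v x.val ≤ 0}

/-- The hyperplane of `H^n` with (spacelike unit) normal `v`. -/
def hWall (n : ℕ) (v : EuclideanSpace ℝ (Fin (n + 1))) : Set ↥(hypSet n) :=
  {x | mink n v x.val = 0}

/-- Projection of the hyperboloid to the Beltrami–Klein ball. -/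
def klein (n : ℕ) (x : ↥(hypSet n)) : Fin n → ℝ := fun i => x.val i.succ / x.val 0

/-- The hyperbolic (Riemannian) volume of a subset of `H^n`, computed in the
Beltrami–Klein model, where the volume element is `(1-|y|²)^{-(n+1)/2} dy`. -/
def hVol (n : ℕ) (S : Set ↥(hypSet n)) : ℝ≥0∞ :=
  ∫⁻ y in klein n '' S,
    ENNReal.ofReal ((1 - ∑ i, y i ^ 2) ^ (-((n : ℝ) + 1) / 2)) ∂(volume)

/-- An isometry of `H^n`: a bijection preserving the Minkowski product
(equivalently, the hyperbolic distance `arcosh(-⟨x,y⟩)`). -/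
def hIsIsom (n : ℕ) (g : ↥(hypSet n) → ↥(hypSet n)) : Prop :=
  Function.Bijective g ∧ ∀ x y, mink n (g x).val (g y).val = mink n x.val y.val

/-- Two subsets of `H^n` are congruent if an isometry carries one onto the other. -/
def hCongr (n : ℕ) (A B : Set ↥(hypSet n)) : Prop :=
  ∃ g, hIsIsom n g ∧ g '' A = B

/-- The ambient reflection of `ℝ^{n+1}` in the hyperplane with spacelike unit normal `v`. -/
def hReflect (n : ℕ) (v x : EuclideanSpace ℝ (Fin (n + 1))) :
    EuclideanSpace ℝ (Fin (n + 1)) :=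
  x - (2 * mink n v x) • v

/-- `S` is a facet ((n-1)-dimensional face) of the polyhedron `P ⊆ H^n`:
`S = P ∩ Π` for a supporting hyperplane `Π` of `P`, and `S` lies in no other
hyperplane (so it is genuinely `(n-1)`-dimensional). -/
def hIsFacet (n : ℕ) (P S : Set ↥(hypSet n)) : Prop :=
  S.Nonempty ∧ ∃ v, mink n v v = 1 ∧ P ⊆ hHalf n v ∧ S = P ∩ hWall n v ∧
    ∀ u, mink n u u = 1 → S ⊆ hWall n u → hWall n u = hWall n v

/-- A convex polyhedron in `H^n`: an intersection of finitely many closed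
half-spaces with nonempty interior and finite volume. -/
def hIsPoly (n : ℕ) (P : Set ↥(hypSet n)) : Prop :=
  ∃ (k : ℕ) (v : Fin k → EuclideanSpace ℝ (Fin (n + 1))),
    (∀ i, mink n (v i) (v i) = 1) ∧ P = ⋂ i, hHalf n (v i) ∧
    (interior P).Nonempty ∧ hVol n P < ⊤

/-- A Coxeter polyhedron in `H^n`: a convex polyhedron all of whose dihedral
angles are of the form `π/k`, `k ≥ 2` (the dihedral angle along a ridge with
outward unit normals `u, v` is `π/k` iff `⟨u,v⟩ = -cos (π/k)`). -/
def hIsCoxPoly (n : ℕ) (P : Set ↥(hypSet n)) : Prop :=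
  ∃ (k : ℕ) (v : Fin k → EuclideanSpace ℝ (Fin (n + 1))),
    (∀ i, mink n (v i) (v i) = 1) ∧ P = ⋂ i, hHalf n (v i) ∧
    (interior P).Nonempty ∧ hVol n P < ⊤ ∧
    ∀ i j, hWall n (v i) ≠ hWall n (v j) →
      (∃ x ∈ P, x ∈ hWall n (v i) ∩ hWall n (v j)) →
      ∃ m : ℕ, 2 ≤ m ∧ mink n (v i) (v j) = -Real.cos (Real.pi / (m : ℝ))

/-- A simplex in `H^n` (possibly with ideal vertices): a convex polyhedron with
exactly `n+1` facets. -/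
def hIsSimplex (n : ℕ) (P : Set ↥(hypSet n)) : Prop :=
  hIsPoly n P ∧ {S | hIsFacet n P S}.ncard = n + 1

/-- A Coxeter decomposition of `P ⊆ H^n`: a decomposition of `P` into finitely
many tiles with pairwise disjoint interiors, each tile a Coxeter polyhedron,
such that any two tiles having a common facet are symmetric with respect to
(the hyperplane of) this facet. -/
def hIsCoxDecomp (n : ℕ) (P : Set ↥(hypSet n)) (𝒯 : Set (Set ↥(hypSet n))) : Prop :=
  𝒯.Finite ∧ 𝒯.Nonempty ∧ (∀ T ∈ 𝒯, hIsCoxPoly n T) ∧ ⋃₀ 𝒯 = P ∧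
  (∀ T₁ ∈ 𝒯, ∀ T₂ ∈ 𝒯, T₁ ≠ T₂ → interior T₁ ∩ interior T₂ = ∅) ∧
  (∀ T₁ ∈ 𝒯, ∀ T₂ ∈ 𝒯, T₁ ≠ T₂ → ∀ S, hIsFacet n T₁ S → hIsFacet n T₂ S →
    ∃ v, mink n v v = 1 ∧ S ⊆ hWall n v ∧
      T₂ = {y | ∃ x ∈ T₁, (y : EuclideanSpace ℝ (Fin (n + 1))) = hReflect n v x.val})

/-- A hyperplane (with unit normal `v`) is a mirror of the decomposition `𝒯` of `P`
if it contains a facet of some tile but no facet of `P`. -/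
def hIsMirror (n : ℕ) (P : Set ↥(hypSet n)) (𝒯 : Set (Set ↥(hypSet n)))
    (v : EuclideanSpace ℝ (Fin (n + 1))) : Prop :=
  mink n v v = 1 ∧ (∃ T ∈ 𝒯, ∃ S, hIsFacet n T S ∧ S ⊆ hWall n v) ∧
  ¬∃ S, hIsFacet n P S ∧ S ⊆ hWall n v

/-- The decomposition `𝒯` of `P` is of the second type: every dihedral angle of `P`
is fundamental, i.e. no mirror contains the intersection of two facets of `P`. -/
def hSecondType (n : ℕ) (P : Set ↥(hypSet n)) (𝒯 : Set (Set ↥(hypSet n))) : Prop :=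
  ∀ α β, hIsFacet n P α → hIsFacet n P β → α ≠ β → (α ∩ β).Nonempty →
    ¬∃ v, hIsMirror n P 𝒯 v ∧ α ∩ β ⊆ hWall n v

/-- Decompositions obtainable by the inductive algorithm (decompositions of the
first type), with fundamental simplex `F`: start from (isometric copies of) `F`,
and repeatedly glue two previously obtained decomposed simplices along a common
facet so that the union is again a simplex and the union of the two
decompositions is a Coxeter decomposition of it. -/
inductive hFirstType (n : ℕ) (F : Set ↥(hypSet n)) :
    Set ↥(hypSet n) → Set (Set ↥(hypSet n)) → Prop
  | base (P : Set ↥(hypSet n)) : hCongr n F P → hIsSimplex n P → hFirstType n F P {P}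
  | congr (P : Set ↥(hypSet n)) (𝒯 : Set (Set ↥(hypSet n)))
      (g : ↥(hypSet n) → ↥(hypSet n)) :
      hIsIsom n g → hFirstType n F P 𝒯 → hFirstType n F (g '' P) ((fun T => g '' T) '' 𝒯)
  | glue (P₁ P₂ : Set ↥(hypSet n)) (𝒯₁ 𝒯₂ : Set (Set ↥(hypSet n))) (S : Set ↥(hypSet n)) :
      hFirstType n F P₁ 𝒯₁ → hFirstType n F P₂ 𝒯₂ →
      hIsFacet n P₁ S → hIsFacet n P₂ S →
      interior P₁ ∩ interior P₂ = ∅ →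
      hIsSimplex n (P₁ ∪ P₂) →
      hIsCoxDecomp n (P₁ ∪ P₂) (𝒯₁ ∪ 𝒯₂) →
      hFirstType n F (P₁ ∪ P₂) (𝒯₁ ∪ 𝒯₂)

/-- A vertex of the simplex `P ⊆ H^n`: a point of `P` lying on at least `n` facets. -/
def hIsVertex (n : ℕ) (P : Set ↥(hypSet n)) (x : ↥(hypSet n)) : Prop :=
  x ∈ P ∧ n ≤ {S | hIsFacet n P S ∧ x ∈ S}.ncard

/-- The cone over `S ⊆ H^n` in `ℝ^{n+1}`. -/
def hCone (n : ℕ) (S : Set ↥(hypSet n)) : Set (EuclideanSpace ℝ (Fin (n + 1))) :=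
  {y | ∃ x ∈ S, ∃ t : ℝ, 0 < t ∧ y = t • (x : EuclideanSpace ℝ (Fin (n + 1)))}

/-- The ideal vertices of `P ⊆ H^n`: lightlike directions (normalized by `w₀ = 1`)
in the closure of the cone over `P`. -/
def hIdealVerts (n : ℕ) (P : Set ↥(hypSet n)) : Set (EuclideanSpace ℝ (Fin (n + 1))) :=
  {w | mink n w w = 0 ∧ w 0 = 1 ∧ w ∈ closure (hCone n P)}

/-- The ideal vertex `w` of `P` has horospherical link of the Euclidean type given
by the (affine) Coxeter matrix `M`: the facets of `P` incident to `w` can be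
indexed so that their unit normals have Gram matrix `-cos (π / M i j)`. -/
def hIdealLink (n : ℕ) (P : Set ↥(hypSet n)) (w : EuclideanSpace ℝ (Fin (n + 1)))
    {k : ℕ} (M : Matrix (Fin k) (Fin k) ℕ) : Prop :=
  ∃ e : Fin k → EuclideanSpace ℝ (Fin (n + 1)),
    (∀ i, mink n (e i) (e i) = 1) ∧
    (∀ i, mink n (e i) w = 0) ∧
    (∀ i j, i ≠ j → mink n (e i) (e j) = -Real.cos (Real.pi / (M i j : ℝ))) ∧
    (∀ i j, i ≠ j → hWall n (e i) ≠ hWall n (e j)) ∧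
    {S | hIsFacet n P S ∧ w ∈ closure (hCone n S)} =
      Set.range fun i => P ∩ hWall n (e i)

/-- The number of tiles of `𝒯` incident to the ideal point `w`. -/
def hTilesAt (n : ℕ) (𝒯 : Set (Set ↥(hypSet n)))
    (w : EuclideanSpace ℝ (Fin (n + 1))) : ℕ :=
  {T | T ∈ 𝒯 ∧ w ∈ closure (hCone n T)}.ncard

/-- An occurrence, in the Coxeter diagram of `P`, of a subdiagram of type `M`:
a set `𝒜` of `k` facets of `P` whose unit normals have Gram matrix
`-cos (π / M i j)`. -/
def hSubOcc (n : ℕ) (P : Set ↥(hypSet n)) {k : ℕ} (M : Matrix (Fin k) (Fin k) ℕ)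
    (𝒜 : Set (Set ↥(hypSet n))) : Prop :=
  ∃ e : Fin k → EuclideanSpace ℝ (Fin (n + 1)),
    (∀ i, mink n (e i) (e i) = 1) ∧
    (∀ i j, i ≠ j → mink n (e i) (e j) = -Real.cos (Real.pi / (M i j : ℝ))) ∧
    (∀ i, hIsFacet n P (P ∩ hWall n (e i))) ∧
    𝒜 = Set.range (fun i => P ∩ hWall n (e i)) ∧ 𝒜.ncard = k

/-- The polyhedron `P ⊆ H^n` is a Coxeter simplex with Coxeter diagram (matrix) `M`. -/
def hOfType (n : ℕ) (P : Set ↥(hypSet n)) {k : ℕ} (M : Matrix (Fin k) (Fin k) ℕ) : Prop :=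
  (∀ i, M i i = 1) ∧ (∀ i j, M i j = M j i) ∧
  ∃ e : Fin k → EuclideanSpace ℝ (Fin (n + 1)),
    (∀ i, mink n (e i) (e i) = 1) ∧
    (∀ i j, i ≠ j → mink n (e i) (e j) = -Real.cos (Real.pi / (M i j : ℝ))) ∧
    P = ⋂ i, hHalf n (e i) ∧ (∀ i, hIsFacet n P (P ∩ hWall n (e i)))

/-- Equivalence of two decompositions of the same polyhedron `P`, up to an
isometry preserving `P`. -/
def hDecompEquiv (n : ℕ) (P : Set ↥(hypSet n)) (𝒯₁ 𝒯₂ : Set (Set ↥(hypSet n))) : Prop :=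
  ∃ g, hIsIsom n g ∧ g '' P = P ∧ (fun T => g '' T) '' 𝒯₁ = 𝒯₂

/-- A Coxeter decomposition of the second type of `P` with fundamental simplex `F`. -/
def hSTDecomp (n : ℕ) (P F : Set ↥(hypSet n)) (𝒯 : Set (Set ↥(hypSet n))) : Prop :=
  hIsCoxDecomp n P 𝒯 ∧ (∀ T ∈ 𝒯, hCongr n F T) ∧ hSecondType n P 𝒯

def hCoxSimplex (n : ℕ) (P : Set ↥(hypSet n)) : Prop := hIsCoxPoly n P ∧ hIsSimplex n P

/-! ## The sphere `S^n ⊂ ℝ^{n+1}`. -/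

/-- The Euclidean dot product on `ℝ^{n+1}`. -/
def sdot (n : ℕ) (x y : EuclideanSpace ℝ (Fin (n + 1))) : ℝ := ∑ i, x i * y i

/-- The unit sphere `S^n ⊂ ℝ^{n+1}`. -/
def sSet (n : ℕ) : Set (EuclideanSpace ℝ (Fin (n + 1))) := {x | sdot n x x = 1}

/-- The closed hemisphere of `S^n` with (unit) outward normal `v`. -/
def sHalf (n : ℕ) (v : EuclideanSpace ℝ (Fin (n + 1))) : Set ↥(sSet n) :=
  {x | sdot n v x.val ≤ 0}

/-- The great hypersphere of `S^n` with (unit) normal `v`. -/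
def sWall (n : ℕ) (v : EuclideanSpace ℝ (Fin (n + 1))) : Set ↥(sSet n) :=
  {x | sdot n v x.val = 0}

/-- The spherical (Riemannian) volume of `S ⊆ S^n`: `(n+1)` times the Lebesgue
measure of the cone over `S` truncated at radius `1`. -/
def sVol (n : ℕ) (S : Set ↥(sSet n)) : ℝ≥0∞ :=
  ((n : ℝ≥0∞) + 1) *
    volume {y : Fin (n + 1) → ℝ | ∃ x ∈ S, ∃ t : ℝ, 0 < t ∧ t ≤ 1 ∧
      y = fun i => t * (x : EuclideanSpace ℝ (Fin (n + 1))) i}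

/-- An isometry of `S^n`: a bijection preserving the dot product (equivalently,
the spherical distance). -/
def sIsIsom (n : ℕ) (g : ↥(sSet n) → ↥(sSet n)) : Prop :=
  Function.Bijective g ∧ ∀ x y, sdot n (g x).val (g y).val = sdot n x.val y.val

def sCongr (n : ℕ) (A B : Set ↥(sSet n)) : Prop := ∃ g, sIsIsom n g ∧ g '' A = B

/-- The ambient reflection of `ℝ^{n+1}` in the hyperplane with unit normal `v`. -/
def sReflect (n : ℕ) (v x : EuclideanSpace ℝ (Fin (n + 1))) :
    EuclideanSpace ℝ (Fin (n + 1)) :=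
  x - (2 * sdot n v x) • v

/-- `S` is a facet of the spherical polyhedron `P`. -/
def sIsFacet (n : ℕ) (P S : Set ↥(sSet n)) : Prop :=
  S.Nonempty ∧ ∃ v, sdot n v v = 1 ∧ P ⊆ sHalf n v ∧ S = P ∩ sWall n v ∧
    ∀ u, sdot n u u = 1 → S ⊆ sWall n u → sWall n u = sWall n v

/-- A convex polyhedron in `S^n`. -/
def sIsPoly (n : ℕ) (P : Set ↥(sSet n)) : Prop :=
  ∃ (k : ℕ) (v : Fin k → EuclideanSpace ℝ (Fin (n + 1))),
    (∀ i, sdot n (v i) (v i) = 1) ∧ P = ⋂ i, sHalf n (v i) ∧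
    (interior P).Nonempty ∧ sVol n P < ⊤

/-- A Coxeter polyhedron in `S^n`. -/
def sIsCoxPoly (n : ℕ) (P : Set ↥(sSet n)) : Prop :=
  ∃ (k : ℕ) (v : Fin k → EuclideanSpace ℝ (Fin (n + 1))),
    (∀ i, sdot n (v i) (v i) = 1) ∧ P = ⋂ i, sHalf n (v i) ∧
    (interior P).Nonempty ∧ sVol n P < ⊤ ∧
    ∀ i j, sWall n (v i) ≠ sWall n (v j) →
      (∃ x ∈ P, x ∈ sWall n (v i) ∩ sWall n (v j)) →
      ∃ m : ℕ, 2 ≤ m ∧ sdot n (v i) (v j) = -Real.cos (Real.pi / (m : ℝ))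

/-- A spherical simplex in `S^n`: the intersection of `S^n` with a simplicial cone,
i.e. a convex spherical polyhedron with exactly `n+1` facets. -/
def sIsSimplex (n : ℕ) (P : Set ↥(sSet n)) : Prop :=
  sIsPoly n P ∧ {S | sIsFacet n P S}.ncard = n + 1

/-- A Coxeter decomposition of `P ⊆ S^n`. -/
def sIsCoxDecomp (n : ℕ) (P : Set ↥(sSet n)) (𝒯 : Set (Set ↥(sSet n))) : Prop :=
  𝒯.Finite ∧ 𝒯.Nonempty ∧ (∀ T ∈ 𝒯, sIsCoxPoly n T) ∧ ⋃₀ 𝒯 = P ∧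
  (∀ T₁ ∈ 𝒯, ∀ T₂ ∈ 𝒯, T₁ ≠ T₂ → interior T₁ ∩ interior T₂ = ∅) ∧
  (∀ T₁ ∈ 𝒯, ∀ T₂ ∈ 𝒯, T₁ ≠ T₂ → ∀ S, sIsFacet n T₁ S → sIsFacet n T₂ S →
    ∃ v, sdot n v v = 1 ∧ S ⊆ sWall n v ∧
      T₂ = {y | ∃ x ∈ T₁, (y : EuclideanSpace ℝ (Fin (n + 1))) = sReflect n v x.val})

/-- Mirrors of a spherical Coxeter decomposition. -/
def sIsMirror (n : ℕ) (P : Set ↥(sSet n)) (𝒯 : Set (Set ↥(sSet n)))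
    (v : EuclideanSpace ℝ (Fin (n + 1))) : Prop :=
  sdot n v v = 1 ∧ (∃ T ∈ 𝒯, ∃ S, sIsFacet n T S ∧ S ⊆ sWall n v) ∧
  ¬∃ S, sIsFacet n P S ∧ S ⊆ sWall n v

/-- Second type: every dihedral angle of `P` is fundamental. -/
def sSecondType (n : ℕ) (P : Set ↥(sSet n)) (𝒯 : Set (Set ↥(sSet n))) : Prop :=
  ∀ α β, sIsFacet n P α → sIsFacet n P β → α ≠ β → (α ∩ β).Nonempty →
    ¬∃ v, sIsMirror n P 𝒯 v ∧ α ∩ β ⊆ sWall n v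

/-- `P ⊆ S^n` is a Coxeter simplex with Coxeter diagram (matrix) `M`. -/
def sOfType (n : ℕ) (P : Set ↥(sSet n)) {k : ℕ} (M : Matrix (Fin k) (Fin k) ℕ) : Prop :=
  (∀ i, M i i = 1) ∧ (∀ i j, M i j = M j i) ∧
  ∃ e : Fin k → EuclideanSpace ℝ (Fin (n + 1)),
    (∀ i, sdot n (e i) (e i) = 1) ∧
    (∀ i j, i ≠ j → sdot n (e i) (e j) = -Real.cos (Real.pi / (M i j : ℝ))) ∧
    P = ⋂ i, sHalf n (e i) ∧ (∀ i, sIsFacet n P (P ∩ sWall n (e i)))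

/-- `P ⊆ S^n` is a Coxeter simplex of the type given by the diagram `c`. -/
def sOfTypeCM (n : ℕ) (P : Set ↥(sSet n)) (c : CM) : Prop := sOfType n P c.2

/-! ## Euclidean space `E^n`. -/

/-- The dot product on `E^n`. -/
def edot (n : ℕ) (x y : EuclideanSpace ℝ (Fin n)) : ℝ := ∑ i, x i * y i

/-- The closed affine half-space `{x : ⟨v,x⟩ ≤ c}` of `E^n`. -/
def eHalf (n : ℕ) (v : EuclideanSpace ℝ (Fin n)) (c : ℝ) : Set (EuclideanSpace ℝ (Fin n)) :=
  {x | edot n v x ≤ c}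

/-- The affine hyperplane `{x : ⟨v,x⟩ = c}` of `E^n`. -/
def eWall (n : ℕ) (v : EuclideanSpace ℝ (Fin n)) (c : ℝ) : Set (EuclideanSpace ℝ (Fin n)) :=
  {x | edot n v x = c}

/-- Reflection of `E^n` in the affine hyperplane `{x : ⟨v,x⟩ = c}` (`v` a unit vector). -/
def eReflect (n : ℕ) (v : EuclideanSpace ℝ (Fin n)) (c : ℝ) (x : EuclideanSpace ℝ (Fin n)) :
    EuclideanSpace ℝ (Fin n) :=
  x - (2 * (edot n v x - c)) • v

/-- An isometry of `E^n`. -/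
def eIsIsom (n : ℕ) (g : EuclideanSpace ℝ (Fin n) → EuclideanSpace ℝ (Fin n)) : Prop :=
  Function.Bijective g ∧ ∀ x y, dist (g x) (g y) = dist x y

def eCongr (n : ℕ) (A B : Set (EuclideanSpace ℝ (Fin n))) : Prop :=
  ∃ g, eIsIsom n g ∧ g '' A = B

/-- A similarity transformation of `E^n` carries `A` onto `B`. -/
def eSimilar (n : ℕ) (A B : Set (EuclideanSpace ℝ (Fin n))) : Prop :=
  ∃ (f : EuclideanSpace ℝ (Fin n) → EuclideanSpace ℝ (Fin n)) (r : ℝ), 0 < r ∧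
    Function.Surjective f ∧ (∀ x y, dist (f x) (f y) = r * dist x y) ∧ f '' A = B

/-- `S` is a facet of the Euclidean polyhedron `P`. -/
def eIsFacet (n : ℕ) (P S : Set (EuclideanSpace ℝ (Fin n))) : Prop :=
  S.Nonempty ∧ ∃ v c, edot n v v = 1 ∧ P ⊆ eHalf n v c ∧ S = P ∩ eWall n v c ∧
    ∀ u d, edot n u u = 1 → S ⊆ eWall n u d → eWall n u d = eWall n v c

/-- A convex polyhedron in `E^n`. -/
def eIsPoly (n : ℕ) (P : Set (EuclideanSpace ℝ (Fin n))) : Prop :=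
  ∃ (k : ℕ) (v : Fin k → EuclideanSpace ℝ (Fin n)) (c : Fin k → ℝ),
    (∀ i, edot n (v i) (v i) = 1) ∧ P = ⋂ i, eHalf n (v i) (c i) ∧
    (interior P).Nonempty ∧ volume P < ⊤

/-- A Coxeter polyhedron in `E^n`. -/
def eIsCoxPoly (n : ℕ) (P : Set (EuclideanSpace ℝ (Fin n))) : Prop :=
  ∃ (k : ℕ) (v : Fin k → EuclideanSpace ℝ (Fin n)) (c : Fin k → ℝ),
    (∀ i, edot n (v i) (v i) = 1) ∧ P = ⋂ i, eHalf n (v i) (c i) ∧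
    (interior P).Nonempty ∧ volume P < ⊤ ∧
    ∀ i j, eWall n (v i) (c i) ≠ eWall n (v j) (c j) →
      (∃ x ∈ P, x ∈ eWall n (v i) (c i) ∩ eWall n (v j) (c j)) →
      ∃ m : ℕ, 2 ≤ m ∧ edot n (v i) (v j) = -Real.cos (Real.pi / (m : ℝ))

/-- A simplex in `E^n`: a convex polyhedron with exactly `n+1` facets. -/
def eIsSimplex (n : ℕ) (P : Set (EuclideanSpace ℝ (Fin n))) : Prop :=
  eIsPoly n P ∧ {S | eIsFacet n P S}.ncard = n + 1

/-- A Coxeter decomposition of `P ⊆ E^n`. -/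
def eIsCoxDecomp (n : ℕ) (P : Set (EuclideanSpace ℝ (Fin n)))
    (𝒯 : Set (Set (EuclideanSpace ℝ (Fin n)))) : Prop :=
  𝒯.Finite ∧ 𝒯.Nonempty ∧ (∀ T ∈ 𝒯, eIsCoxPoly n T) ∧ ⋃₀ 𝒯 = P ∧
  (∀ T₁ ∈ 𝒯, ∀ T₂ ∈ 𝒯, T₁ ≠ T₂ → interior T₁ ∩ interior T₂ = ∅) ∧
  (∀ T₁ ∈ 𝒯, ∀ T₂ ∈ 𝒯, T₁ ≠ T₂ → ∀ S, eIsFacet n T₁ S → eIsFacet n T₂ S →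
    ∃ v c, edot n v v = 1 ∧ S ⊆ eWall n v c ∧ T₂ = eReflect n v c '' T₁)

/-- Mirrors of a Euclidean Coxeter decomposition. -/
def eIsMirror (n : ℕ) (P : Set (EuclideanSpace ℝ (Fin n)))
    (𝒯 : Set (Set (EuclideanSpace ℝ (Fin n))))
    (v : EuclideanSpace ℝ (Fin n)) (c : ℝ) : Prop :=
  edot n v v = 1 ∧ (∃ T ∈ 𝒯, ∃ S, eIsFacet n T S ∧ S ⊆ eWall n v c) ∧
  ¬∃ S, eIsFacet n P S ∧ S ⊆ eWall n v c

/-- Second type: every dihedral angle of `P` is fundamental. -/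
def eSecondType (n : ℕ) (P : Set (EuclideanSpace ℝ (Fin n)))
    (𝒯 : Set (Set (EuclideanSpace ℝ (Fin n)))) : Prop :=
  ∀ α β, eIsFacet n P α → eIsFacet n P β → α ≠ β → (α ∩ β).Nonempty →
    ¬∃ v c, eIsMirror n P 𝒯 v c ∧ α ∩ β ⊆ eWall n v c

/-- `P ⊆ E^n` is a Coxeter simplex with Coxeter diagram (matrix) `M`. -/
def eOfType (n : ℕ) (P : Set (EuclideanSpace ℝ (Fin n))) {k : ℕ}
    (M : Matrix (Fin k) (Fin k) ℕ) : Prop :=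
  (∀ i, M i i = 1) ∧ (∀ i j, M i j = M j i) ∧
  ∃ (e : Fin k → EuclideanSpace ℝ (Fin n)) (c : Fin k → ℝ),
    (∀ i, edot n (e i) (e i) = 1) ∧
    (∀ i j, i ≠ j → edot n (e i) (e j) = -Real.cos (Real.pi / (M i j : ℝ))) ∧
    P = ⋂ i, eHalf n (e i) (c i) ∧ (∀ i, eIsFacet n P (P ∩ eWall n (e i) (c i)))

/-! ## The particular non-compact hyperbolic Coxeter simplices occurring in the
classification, identified by the structural data given in the paper
(dimension, compactness, number and types of ideal vertices, subdiagrams of the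
Coxeter diagram, and (relative) volumes). -/

/-- The Coxeter simplex `H₃⁴ ⊂ H⁴`: non-compact, with exactly one ideal vertex,
whose horospherical link is of Euclidean type `Ã₃`; volume `≈ 0.01370778`. -/
def IsH34 {n : ℕ} (P : Set ↥(hypSet n)) : Prop :=
  n = 4 ∧ hCoxSimplex n P ∧ ¬IsCompact P ∧ (hIdealVerts n P).ncard = 1 ∧
  (∀ w ∈ hIdealVerts n P, hIdealLink n P w cmA3t) ∧
  hVol n P ∈ Set.Ioo (ENNReal.ofReal 0.0137077) (ENNReal.ofReal 0.0137078)

/-- The Coxeter simplex `H₉⁴ ⊂ H⁴`: non-compact, with exactly three ideal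
vertices, each of type `Ã₃`, of volume exactly `10` times that of `H₃⁴`. -/
def IsH94 {n : ℕ} (P : Set ↥(hypSet n)) : Prop :=
  n = 4 ∧ hCoxSimplex n P ∧ ¬IsCompact P ∧ (hIdealVerts n P).ncard = 3 ∧
  (∀ w ∈ hIdealVerts n P, hIdealLink n P w cmA3t) ∧
  ∀ F : Set ↥(hypSet n), IsH34 F → hVol n P = 10 * hVol n F

/-- The Coxeter simplex `H₄⁵ ⊂ H⁵`: non-compact, of volume `≈ 0.0010956247`. -/
def IsH45 {n : ℕ} (P : Set ↥(hypSet n)) : Prop :=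
  n = 5 ∧ hCoxSimplex n P ∧ ¬IsCompact P ∧
  hVol n P ∈ Set.Ioo (ENNReal.ofReal 0.0010956) (ENNReal.ofReal 0.0010957)

/-- The Coxeter simplex `H₅⁵ ⊂ H⁵`: non-compact, of volume `≈ 0.0018260413`,
whose Coxeter diagram contains exactly one parabolic subdiagram of type `C̃₄`
and exactly one of type `F̃₄`. -/
def IsH55 {n : ℕ} (P : Set ↥(hypSet n)) : Prop :=
  n = 5 ∧ hCoxSimplex n P ∧ ¬IsCompact P ∧
  {𝒜 | hSubOcc n P cmC4t 𝒜}.ncard = 1 ∧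
  {𝒜 | hSubOcc n P cmF4t 𝒜}.ncard = 1 ∧
  hVol n P ∈ Set.Ioo (ENNReal.ofReal 0.0018260) (ENNReal.ofReal 0.0018261)

/-- The Coxeter simplex `H₇⁵ ⊂ H⁵`: non-compact, of volume `≈ 0.0036520826`,
with three ideal vertices, whose Coxeter diagram contains no parabolic
subdiagram of type `D̃₄`. -/
def IsH75 {n : ℕ} (P : Set ↥(hypSet n)) : Prop :=
  n = 5 ∧ hCoxSimplex n P ∧ ¬IsCompact P ∧ (hIdealVerts n P).ncard = 3 ∧
  (¬∃ 𝒜, hSubOcc n P cmD4t 𝒜) ∧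
  hVol n P ∈ Set.Ioo (ENNReal.ofReal 0.0036520) (ENNReal.ofReal 0.0036521)

/-- The Coxeter simplex `H₁₁⁵ ⊂ H⁵`: non-compact, with five ideal vertices, one
of which has horospherical link of Euclidean type `D̃₄`; its volume is exactly
`20` times that of `H₄⁵` (and exactly `6` times that of `H₇⁵`). -/
def IsH115 {n : ℕ} (P : Set ↥(hypSet n)) : Prop :=
  n = 5 ∧ hCoxSimplex n P ∧ ¬IsCompact P ∧ (hIdealVerts n P).ncard = 5 ∧
  (∃ w ∈ hIdealVerts n P, hIdealLink n P w cmD4t) ∧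
  (∀ F : Set ↥(hypSet n), IsH45 F → hVol n P = 20 * hVol n F) ∧
  (∀ F : Set ↥(hypSet n), IsH75 F → hVol n P = 6 * hVol n F)

/-- The Coxeter simplex `H₁₂⁵ ⊂ H⁵`: non-compact, whose Coxeter diagram contains
exactly two parabolic subdiagrams of type `C̃₄` and exactly four of type `F̃₄`;
its volume is exactly `16` times that of `H₅⁵`. -/
def IsH125 {n : ℕ} (P : Set ↥(hypSet n)) : Prop :=
  n = 5 ∧ hCoxSimplex n P ∧ ¬IsCompact P ∧
  {𝒜 | hSubOcc n P cmC4t 𝒜}.ncard = 2 ∧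
  {𝒜 | hSubOcc n P cmF4t 𝒜}.ncard = 4 ∧
  ∀ F : Set ↥(hypSet n), IsH55 F → hVol n P = 16 * hVol n F

/-- The Coxeter simplex `H₁⁸ ⊂ H⁸`: the non-compact Coxeter simplex of minimal
volume in `H⁸`, with exactly one ideal vertex. -/
def IsH18 {n : ℕ} (P : Set ↥(hypSet n)) : Prop :=
  n = 8 ∧ hCoxSimplex n P ∧ ¬IsCompact P ∧ (hIdealVerts n P).ncard = 1 ∧
  ∀ Q : Set ↥(hypSet n), hCoxSimplex n Q → ¬IsCompact Q → hVol n P ≤ hVol n Q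

/-- The Coxeter simplex `H₄⁸ ⊂ H⁸`: non-compact, with exactly two ideal
vertices, whose Coxeter diagram contains a subdiagram of type `A₈`; its volume
is exactly `272` times that of `H₁⁸`. -/
def IsH48 {n : ℕ} (P : Set ↥(hypSet n)) : Prop :=
  n = 8 ∧ hCoxSimplex n P ∧ ¬IsCompact P ∧ (hIdealVerts n P).ncard = 2 ∧
  (∃ 𝒜, hSubOcc n P (cmA 8) 𝒜) ∧
  ∀ F : Set ↥(hypSet n), IsH18 F → hVol n P = 272 * hVol n F

/-- The Coxeter simplex `H₁⁹ ⊂ H⁹`: the non-compact Coxeter simplex of minimal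
volume in `H⁹`, with exactly one ideal vertex. -/
def IsH19 {n : ℕ} (P : Set ↥(hypSet n)) : Prop :=
  n = 9 ∧ hCoxSimplex n P ∧ ¬IsCompact P ∧ (hIdealVerts n P).ncard = 1 ∧
  ∀ Q : Set ↥(hypSet n), hCoxSimplex n Q → ¬IsCompact Q → hVol n P ≤ hVol n Q

/-- The Coxeter simplex `H₃⁹ ⊂ H⁹`: non-compact, with exactly three ideal
vertices; its volume is exactly `527` times that of `H₁⁹`. -/
def IsH39 {n : ℕ} (P : Set ↥(hypSet n)) : Prop :=
  n = 9 ∧ hCoxSimplex n P ∧ ¬IsCompact P ∧ (hIdealVerts n P).ncard = 3 ∧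
  ∀ F : Set ↥(hypSet n), IsH19 F → hVol n P = 527 * hVol n F

/-! ## The Minkowski form -/

section Minkowski

variable {n : ℕ}

lemma mink_comm (x y : EuclideanSpace ℝ (Fin (n + 1))) : mink n x y = mink n y x := by
  simp only [mink, mul_comm]

lemma mink_add_left (x y z : EuclideanSpace ℝ (Fin (n + 1))) :
    mink n (x + y) z = mink n x z + mink n y z := by
  simp only [mink, PiLp.add_apply, add_mul, Finset.sum_add_distrib]
  ring

lemma mink_smul_left (c : ℝ) (x z : EuclideanSpace ℝ (Fin (n + 1))) :
    mink n (c • x) z = c * mink n x z := by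
  simp only [mink, PiLp.smul_apply, smul_eq_mul, mul_add, Finset.mul_sum, mul_neg, mul_assoc]

/-- The Minkowski form as a bilinear map. -/
def minkB (n : ℕ) : EuclideanSpace ℝ (Fin (n + 1)) →ₗ[ℝ] EuclideanSpace ℝ (Fin (n + 1)) →ₗ[ℝ] ℝ :=
  LinearMap.mk₂ ℝ (mink n) mink_add_left mink_smul_left
    (fun x y z => by rw [mink_comm, mink_add_left, mink_comm y, mink_comm z])
    (fun c x z => by rw [mink_comm, mink_smul_left, mink_comm z, smul_eq_mul])

lemma minkB_apply (x y : EuclideanSpace ℝ (Fin (n + 1))) : minkB n x y = mink n x y := rfl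

lemma mink_add_right (x y z : EuclideanSpace ℝ (Fin (n + 1))) :
    mink n z (x + y) = mink n z x + mink n z y := (minkB n z).map_add x y

lemma mink_smul_right (c : ℝ) (x z : EuclideanSpace ℝ (Fin (n + 1))) :
    mink n z (c • x) = c * mink n z x := (minkB n z).map_smul c x

lemma mink_neg_left (x z : EuclideanSpace ℝ (Fin (n + 1))) : mink n (-x) z = -mink n x z := by
  simp only [← minkB_apply, map_neg, LinearMap.neg_apply]

lemma mink_neg_right (x z : EuclideanSpace ℝ (Fin (n + 1))) : mink n z (-x) = -mink n z x := by
  simp only [← minkB_apply, map_neg]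

lemma mink_sub_left (x y z : EuclideanSpace ℝ (Fin (n + 1))) :
    mink n (x - y) z = mink n x z - mink n y z := by
  simp only [← minkB_apply, map_sub, LinearMap.sub_apply]

lemma mink_sub_right (x y z : EuclideanSpace ℝ (Fin (n + 1))) :
    mink n z (x - y) = mink n z x - mink n z y := by
  simp only [← minkB_apply, map_sub]

lemma mink_zero_left (z : EuclideanSpace ℝ (Fin (n + 1))) : mink n 0 z = 0 := by
  simp only [← minkB_apply, map_zero, LinearMap.zero_apply]

lemma mink_zero_right (z : EuclideanSpace ℝ (Fin (n + 1))) : mink n z 0 = 0 := by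
  simp only [← minkB_apply, map_zero]

lemma mink_sum_left {ι : Type*} (s : Finset ι) (f : ι → EuclideanSpace ℝ (Fin (n + 1)))
    (z : EuclideanSpace ℝ (Fin (n + 1))) :
    mink n (∑ i ∈ s, f i) z = ∑ i ∈ s, mink n (f i) z := by
  simp only [← minkB_apply, map_sum, LinearMap.sum_apply]

lemma mink_sum_right {ι : Type*} (s : Finset ι) (f : ι → EuclideanSpace ℝ (Fin (n + 1)))
    (z : EuclideanSpace ℝ (Fin (n + 1))) :
    mink n z (∑ i ∈ s, f i) = ∑ i ∈ s, mink n z (f i) := by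
  simp only [← minkB_apply, map_sum]

lemma continuous_mink (x : EuclideanSpace ℝ (Fin (n + 1))) : Continuous (mink n x) := by
  unfold mink; fun_prop

lemma continuous_mink_self : Continuous fun x : EuclideanSpace ℝ (Fin (n + 1)) => mink n x x := by
  unfold mink; fun_prop

lemma mink_single_zero (x : EuclideanSpace ℝ (Fin (n + 1))) :
    mink n x (EuclideanSpace.single 0 1) = -x 0 := by
  simp [mink]

lemma mink_single_succ (x : EuclideanSpace ℝ (Fin (n + 1))) (i : Fin n) :
    mink n x (EuclideanSpace.single i.succ 1) = x i.succ := by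
  have h : (0 : Fin (n + 1)) ≠ i.succ := (Fin.succ_ne_zero i).symm
  simp [mink, h]

lemma eq_zero_of_mink_eq_zero {x : EuclideanSpace ℝ (Fin (n + 1))} (h : ∀ y, mink n x y = 0) :
    x = 0 := by
  ext i
  refine Fin.cases ?_ (fun j => ?_) i
  · simpa [mink_single_zero] using h (EuclideanSpace.single 0 1)
  · simpa [mink_single_succ] using h (EuclideanSpace.single j.succ 1)

lemma mink_self_nonneg_of_zero {d : EuclideanSpace ℝ (Fin (n + 1))} (h0 : d 0 = 0) :
    0 ≤ mink n d d := by
  simp only [mink, h0, mul_zero, neg_zero, zero_add]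
  exact Finset.sum_nonneg fun i _ => mul_self_nonneg _

lemma eq_zero_of_mink_self_nonpos {d : EuclideanSpace ℝ (Fin (n + 1))} (h0 : d 0 = 0)
    (h : mink n d d ≤ 0) : d = 0 := by
  have h' : ∑ i : Fin n, d i.succ * d i.succ = 0 := by
    have h1 := mink_self_nonneg_of_zero h0
    have h2 := le_antisymm h h1
    simpa [mink, h0] using h2
  rw [Finset.sum_eq_zero_iff_of_nonneg fun i _ => mul_self_nonneg _] at h'
  ext i
  refine Fin.cases h0 (fun j => ?_) i
  simpa using h' j (Finset.mem_univ j)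

/-- Timelike future-directed vectors. -/
def Fut (x : EuclideanSpace ℝ (Fin (n + 1))) : Prop := mink n x x < 0 ∧ 0 < x 0

/-- Nonzero causal future-directed vectors. -/
def Caus (x : EuclideanSpace ℝ (Fin (n + 1))) : Prop := mink n x x ≤ 0 ∧ 0 < x 0

variable {x y z : EuclideanSpace ℝ (Fin (n + 1))}

lemma Fut.caus (h : Fut x) : Caus x := ⟨h.1.le, h.2⟩

lemma mink_cross (a b : EuclideanSpace ℝ (Fin (n + 1))) :
    mink n (b 0 • a - a 0 • b) (b 0 • a - a 0 • b) =
      b 0 ^ 2 * mink n a a - 2 * (a 0 * b 0) * mink n a b + a 0 ^ 2 * mink n b b := by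
  simp only [mink_sub_left, mink_sub_right, mink_smul_left, mink_smul_right, mink_comm b a]
  ring

lemma cross_zero (a b : EuclideanSpace ℝ (Fin (n + 1))) : (b 0 • a - a 0 • b) 0 = 0 := by
  simp [mul_comm]

lemma Caus.mink_nonpos (hx : Caus x) (hy : Caus y) : mink n x y ≤ 0 := by
  have h := mink_self_nonneg_of_zero (cross_zero x y)
  rw [mink_cross] at h
  have h1 := mul_nonneg (sq_nonneg (y 0)) (neg_nonneg.2 hx.1)
  have h2 := mul_nonneg (sq_nonneg (x 0)) (neg_nonneg.2 hy.1)
  by_contra hc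
  have h3 := mul_pos (mul_pos hx.2 hy.2) (not_le.1 hc)
  linarith

lemma Caus.parallel (hx : Caus x) (hy : Caus y) (h : 0 ≤ mink n x y) : y 0 • x = x 0 • y := by
  rw [← sub_eq_zero]
  refine eq_zero_of_mink_self_nonpos (cross_zero x y) ?_
  rw [mink_cross]
  have h1 := mul_nonneg (sq_nonneg (y 0)) (neg_nonneg.2 hx.1)
  have h2 := mul_nonneg (sq_nonneg (x 0)) (neg_nonneg.2 hy.1)
  have h3 := mul_nonneg (mul_pos hx.2 hy.2).le h
  linarith

lemma Fut.mink_neg (hx : Fut x) (hy : Caus y) : mink n x y < 0 := by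
  have h := mink_self_nonneg_of_zero (cross_zero x y)
  rw [mink_cross] at h
  have h1 := mul_pos (pow_pos hy.2 2) (neg_pos.2 hx.1)
  have h2 := mul_nonneg (sq_nonneg (x 0)) (neg_nonneg.2 hy.1)
  by_contra hc
  have h3 := mul_nonneg (mul_pos hx.2 hy.2).le (not_lt.1 hc)
  linarith

lemma Fut.pos_of_mink_neg (hx : Fut x) (hz : mink n z z ≤ 0) (h : mink n x z < 0) : 0 < z 0 := by
  by_contra hc
  rcases (not_lt.1 hc).lt_or_eq with h0 | h0
  · have h1 : Caus (-z) := ⟨by simpa [mink_neg_left, mink_neg_right] using hz, by simpa using h0⟩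
    have h2 := hx.mink_neg h1
    rw [mink_neg_right] at h2
    linarith
  · rw [eq_zero_of_mink_self_nonpos h0 hz, mink_zero_right] at h
    exact lt_irrefl _ h

lemma mink_add_self (x y : EuclideanSpace ℝ (Fin (n + 1))) :
    mink n (x + y) (x + y) = mink n x x + 2 * mink n x y + mink n y y := by
  simp only [mink_add_left, mink_add_right, mink_comm y x]
  ring

lemma Caus.add (hx : Caus x) (hy : Caus y) : Caus (x + y) := by
  refine ⟨?_, by simpa using add_pos hx.2 hy.2⟩
  rw [mink_add_self]
  have := hx.mink_nonpos hy
  linarith [hx.1, hy.1]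

lemma Fut.add_caus (hx : Fut x) (hy : Caus y) : Fut (x + y) := by
  refine ⟨?_, by simpa using add_pos hx.2 hy.2⟩
  rw [mink_add_self]
  have := hx.mink_neg hy
  linarith [hx.1, hy.1]

lemma Caus.smul {c : ℝ} (hc : 0 < c) (hx : Caus x) : Caus (c • x) := by
  refine ⟨?_, by simpa using mul_pos hc hx.2⟩
  rw [mink_smul_left, mink_smul_right, ← mul_assoc]
  exact mul_nonpos_of_nonneg_of_nonpos (mul_pos hc hc).le hx.1

lemma Fut.smul {c : ℝ} (hc : 0 < c) (hx : Fut x) : Fut (c • x) := by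
  refine ⟨?_, by simpa using mul_pos hc hx.2⟩
  rw [mink_smul_left, mink_smul_right, ← mul_assoc]
  exact mul_neg_of_pos_of_neg (mul_pos hc hc) hx.1

/-- Two non-proportional causal vectors have a timelike sum. -/
lemma Caus.fut_add (hx : Caus x) (hy : Caus y) (h : mink n x y ≠ 0) : Fut (x + y) := by
  refine ⟨?_, by simpa using add_pos hx.2 hy.2⟩
  rw [mink_add_self]
  have := lt_of_le_of_ne (hx.mink_nonpos hy) h
  linarith [hx.1, hy.1]

lemma isOpen_fut : IsOpen {x : EuclideanSpace ℝ (Fin (n + 1)) | Fut x} :=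
  (isOpen_lt continuous_mink_self continuous_const).inter
    (isOpen_lt continuous_const
      (by fun_prop : Continuous fun x : EuclideanSpace ℝ (Fin (n + 1)) => x 0))

lemma fut_of_mem (x : ↥(hypSet n)) : Fut x.val := ⟨by rw [x.2.1]; norm_num, x.2.2⟩

/-- The point of hyperbolic space on the ray of a timelike vector (with a junk value elsewhere). -/
def nrm (b : ↥(hypSet n)) (x : EuclideanSpace ℝ (Fin (n + 1))) : ↥(hypSet n) := by
  classical
  exact if h : Fut x then ⟨(√(-mink n x x))⁻¹ • x, by
    have h1 : 0 < √(-mink n x x) := Real.sqrt_pos.2 (neg_pos.2 h.1)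
    refine ⟨?_, by simpa using mul_pos (inv_pos.2 h1) h.2⟩
    rw [mink_smul_left, mink_smul_right, ← mul_assoc, ← mul_inv,
      Real.mul_self_sqrt (neg_pos.2 h.1).le, inv_neg, neg_mul, inv_mul_cancel₀ h.1.ne]⟩ else b

lemma exists_hyp (x : EuclideanSpace ℝ (Fin (n + 1))) (h : Fut x) :
    ∃ p : ↥(hypSet n), ∃ c : ℝ, 0 < c ∧ p.val = c • x := by
  have h1 : 0 < √(-mink n x x) := Real.sqrt_pos.2 (neg_pos.2 h.1)
  refine ⟨⟨(√(-mink n x x))⁻¹ • x, ?_, by simpa using mul_pos (inv_pos.2 h1) h.2⟩, _,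
    inv_pos.2 h1, rfl⟩
  rw [mink_smul_left, mink_smul_right, ← mul_assoc, ← mul_inv,
      Real.mul_self_sqrt (neg_pos.2 h.1).le, inv_neg, neg_mul, inv_mul_cancel₀ h.1.ne]

lemma nrm_val (b : ↥(hypSet n)) (h : Fut x) : (nrm b x).val = (√(-mink n x x))⁻¹ • x := by
  simp [nrm, h]

lemma nrm_self (b p : ↥(hypSet n)) : nrm b p.val = p := by
  apply Subtype.ext
  rw [nrm_val b (fut_of_mem p), p.2.1]
  simp

lemma continuousAt_nrm (b p : ↥(hypSet n)) : ContinuousAt (nrm b) p.val := by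
  rw [ContinuousAt, tendsto_subtype_rng]
  have h1 : (fun x => ((nrm b x : ↥(hypSet n)) : EuclideanSpace ℝ (Fin (n + 1)))) =ᶠ[nhds p.val]
      fun x : EuclideanSpace ℝ (Fin (n + 1)) => (√(-mink n x x))⁻¹ • x := by
    filter_upwards [isOpen_fut.mem_nhds (fut_of_mem p)] with x hx using nrm_val b hx
  rw [nrm_val b (fut_of_mem p)]
  refine Filter.Tendsto.congr' h1.symm ?_
  have h2 : ContinuousAt
      (fun x : EuclideanSpace ℝ (Fin (n + 1)) => (√(-mink n x x))⁻¹ • x) p.val := by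
    have h3 : ContinuousAt (fun x : EuclideanSpace ℝ (Fin (n + 1)) => (√(-mink n x x))⁻¹) p.val :=
      ContinuousAt.inv₀ (Real.continuous_sqrt.comp continuous_mink_self.neg).continuousAt
        (by simp [p.2.1])
    exact h3.smul continuousAt_id
  exact h2

end Minkowski

/-! ## Simplicial cones -/

section SimplicialCone

variable {n : ℕ} {v r : Fin (n + 1) → EuclideanSpace ℝ (Fin (n + 1))}

lemma expand_of_dual {v r : Fin (n + 1) → EuclideanSpace ℝ (Fin (n + 1))}
    (h : ∀ i j, mink n (v i) (r j) = if i = j then -1 else 0)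
    (x : EuclideanSpace ℝ (Fin (n + 1))) : x = ∑ i, (-(mink n (v i) x)) • r i := by
  have key : ∀ (c : Fin (n + 1) → ℝ) j, mink n (v j) (∑ i, c i • r i) = -c j := by
    intro c j
    rw [mink_sum_right]
    simp [mink_smul_right, h]
  have hli : LinearIndependent ℝ r := by
    rw [Fintype.linearIndependent_iff]
    intro c hc j
    have := key c j
    rw [hc, mink_zero_right] at this
    linarith
  have hspan := hli.span_eq_top_of_card_eq_finrank (by simp)
  have hx : x ∈ Submodule.span ℝ (Set.range r) := by rw [hspan]; trivial
  obtain ⟨c, rfl⟩ := (Submodule.mem_span_range_iff_exists_fun ℝ).1 hx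
  simp [key]

/-- The unit normals `v` of a simplex together with the dual generators `r` of its cone. -/
structure SimpData (v r : Fin (n + 1) → EuclideanSpace ℝ (Fin (n + 1))) : Prop where
  unit : ∀ i, mink n (v i) (v i) = 1
  dual : ∀ i j, mink n (v i) (r j) = if i = j then -1 else 0
  caus : ∀ i, Caus (r i)

namespace SimpData

variable (hd : SimpData v r)
include hd

lemma dual_self (i : Fin (n + 1)) : mink n (v i) (r i) = -1 := by simp [hd.dual]

lemma dual_ne {i j : Fin (n + 1)} (h : i ≠ j) : mink n (v i) (r j) = 0 := by simp [hd.dual, h]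

lemma expand (x : EuclideanSpace ℝ (Fin (n + 1))) : x = ∑ i, (-(mink n (v i) x)) • r i :=
  expand_of_dual hd.dual x

lemma expand_normal (u : EuclideanSpace ℝ (Fin (n + 1))) :
    u = ∑ i, (-(mink n u (r i))) • v i := by
  have := expand_of_dual (v := r) (r := v)
    (fun i j => by rw [mink_comm, hd.dual]; simp only [eq_comm]) u
  simpa only [mink_comm u] using this

lemma mink_sum_r (c : Fin (n + 1) → ℝ) (j : Fin (n + 1)) :
    mink n (v j) (∑ i, c i • r i) = -c j := by
  rw [mink_sum_right]
  simp [mink_smul_right, hd.dual]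

lemma eq_zero {x : EuclideanSpace ℝ (Fin (n + 1))} (h : ∀ i, mink n (v i) x = 0) : x = 0 := by
  rw [hd.expand x]
  simp [h]

lemma ext {x y : EuclideanSpace ℝ (Fin (n + 1))} (h : ∀ i, mink n (v i) x = mink n (v i) y) :
    x = y := by
  rw [← sub_eq_zero]
  exact hd.eq_zero fun i => by rw [mink_sub_right, h, sub_self]

lemma caus_of_mem {x : EuclideanSpace ℝ (Fin (n + 1))} (h0 : x ≠ 0)
    (h : ∀ i, mink n (v i) x ≤ 0) : Caus x := by
  have key : ∀ s : Finset (Fin (n + 1)), (∑ i ∈ s, (-(mink n (v i) x)) • r i) = 0 ∨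
      Caus (∑ i ∈ s, (-(mink n (v i) x)) • r i) := by
    intro s
    induction s using Finset.induction_on with
    | empty => simp
    | insert a s ha ih =>
      rw [Finset.sum_insert ha]
      rcases (h a).lt_or_eq with h1 | h1
      · have h2 : Caus ((-(mink n (v a) x)) • r a) := (hd.caus a).smul (neg_pos.2 h1)
        rcases ih with ih | ih
        · rw [ih, add_zero]; exact Or.inr h2
        · exact Or.inr (h2.add ih)
      · simpa [h1] using ih
  rcases key Finset.univ with h1 | h1
  · rw [← hd.expand x] at h1; exact absurd h1 h0
  · rwa [← hd.expand x] at h1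

lemma fut_of_mem {x : EuclideanSpace ℝ (Fin (n + 1))} (h : ∀ i, mink n (v i) x ≤ 0)
    {i j : Fin (n + 1)} (hij : i ≠ j) (hi : mink n (v i) x < 0) (hj : mink n (v j) x < 0) :
    Fut x := by
  set z := x - (-(mink n (v i) x)) • r i with hz
  have hzi : mink n (v i) z = 0 := by
    rw [hz, mink_sub_right, mink_smul_right, hd.dual_self]; ring
  have hzk : ∀ k, k ≠ i → mink n (v k) z = mink n (v k) x := fun k hk => by
    rw [hz, mink_sub_right, mink_smul_right, hd.dual_ne hk]; ring
  have hzc : Caus z := by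
    refine hd.caus_of_mem (fun h0 => ?_) fun k => ?_
    · rw [← hzk j hij.symm, h0, mink_zero_right] at hj
      exact lt_irrefl _ hj
    · by_cases hk : k = i
      · rw [hk, hzi]
      · rw [hzk k hk]; exact h k
  have hr : Caus ((-(mink n (v i) x)) • r i) := (hd.caus i).smul (neg_pos.2 hi)
  have hx : x = (-(mink n (v i) x)) • r i + z := by rw [hz]; abel
  rw [hx]
  refine hr.fut_add hzc fun h0 => ?_
  have hp := congrArg (mink n (v i)) (hr.parallel hzc h0.ge)
  rw [mink_smul_right, mink_smul_right, mink_smul_right, hzi, hd.dual_self, mul_zero] at hp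
  have := mul_pos hzc.2 (neg_pos.2 hi)
  linarith

/-- A nonzero non-timelike vector of the cone lies on an extremal ray. -/
lemma exists_ray {x : EuclideanSpace ℝ (Fin (n + 1))} (h0 : x ≠ 0)
    (h : ∀ i, mink n (v i) x ≤ 0) (hx : ¬Fut x) : ∃ i, ∃ c : ℝ, 0 < c ∧ x = c • r i := by
  have : ∃ i, mink n (v i) x ≠ 0 := by
    by_contra hc
    push Not at hc
    exact h0 (hd.eq_zero hc)
  obtain ⟨i, hi⟩ := this
  have hi' := lt_of_le_of_ne (h i) hi
  refine ⟨i, -(mink n (v i) x), neg_pos.2 hi', hd.ext fun j => ?_⟩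
  rw [mink_smul_right]
  by_cases hj : j = i
  · rw [hj, hd.dual_self]; ring
  · rw [hd.dual_ne hj, mul_zero]
    by_contra hc
    exact hx (hd.fut_of_mem h hj (lt_of_le_of_ne (h j) hc) hi')

/-- The sum of the generators. -/
lemma mink_center (j : Fin (n + 1)) : mink n (v j) (∑ i, r i) = -1 := by
  have := hd.mink_sum_r (fun _ => 1) j
  simpa using this

lemma mink_facet_center (i j : Fin (n + 1)) :
    mink n (v j) (∑ k ∈ Finset.univ.erase i, r k) = if j = i then 0 else -1 := by
  have h := Finset.add_sum_erase Finset.univ r (Finset.mem_univ i)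
  have h2 := hd.mink_center j
  rw [← h, mink_add_right, hd.dual] at h2
  by_cases hj : j = i
  · rw [if_pos hj] at h2 ⊢; linarith
  · rw [if_neg hj] at h2 ⊢; linarith

/-- A unit vector orthogonal to a face of codimension one is a multiple of its normal. -/
lemma eq_smul_of_facet (hn : 2 ≤ n) {u : EuclideanSpace ℝ (Fin (n + 1))} {i : Fin (n + 1)}
    (h : ∀ x, Fut x → (∀ k, mink n (v k) x ≤ 0) → mink n (v i) x = 0 → mink n u x = 0) :
    u = (-(mink n u (r i))) • v i := by
  have hq := hd.mink_facet_center i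
  set q := ∑ k ∈ Finset.univ.erase i, r k
  obtain ⟨a, b, ha, hb, hab⟩ : ∃ a b : Fin (n + 1), a ≠ i ∧ b ≠ i ∧ a ≠ b := by
    have : 1 < (Finset.univ.erase i).card := by
      rw [Finset.card_erase_of_mem (Finset.mem_univ _)]; simp; omega
    obtain ⟨a, ha, b, hb, hab⟩ := Finset.one_lt_card.1 this
    exact ⟨a, b, by simpa using ha, by simpa using hb, hab⟩
  have hqf : Fut q := hd.fut_of_mem (fun k => by rw [hq]; split_ifs <;> norm_num) hab
    (by rw [hq, if_neg ha]; norm_num) (by rw [hq, if_neg hb]; norm_num)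
  have hqu : mink n u q = 0 :=
    h q hqf (fun k => by rw [hq]; split_ifs <;> norm_num) (by rw [hq, if_pos rfl])
  have hr : ∀ j, j ≠ i → mink n u (r j) = 0 := by
    intro j hj
    have := h (q + r j) (hqf.add_caus (hd.caus j)) (fun k => by
      rw [mink_add_right, hq, hd.dual]; split_ifs <;> norm_num)
      (by rw [mink_add_right, hq, hd.dual_ne hj.symm, if_pos rfl, add_zero])
    rwa [mink_add_right, hqu, zero_add] at this
  conv_lhs => rw [hd.expand_normal u]
  rw [Finset.sum_eq_single i (fun j _ hj => by rw [hr j hj]; simp) (by simp)]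

end SimpData

/-- The polyhedron cut out by a family of half-spaces. -/
lemma mem_iInter_hHalf {ι : Type*} {v : ι → EuclideanSpace ℝ (Fin (n + 1))} {x : ↥(hypSet n)} :
    x ∈ ⋂ i, hHalf n (v i) ↔ ∀ i, mink n (v i) x.val ≤ 0 := by
  simp [hHalf]

lemma forall_mem_of_scale {ι : Type*} {v : ι → EuclideanSpace ℝ (Fin (n + 1))}
    {x : EuclideanSpace ℝ (Fin (n + 1))} (hx : Fut x) (h : ∀ i, mink n (v i) x ≤ 0) :
    ∃ p ∈ ⋂ i, hHalf n (v i), ∃ c : ℝ, 0 < c ∧ p.val = c • x := by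
  obtain ⟨p, c, hc, hp⟩ := exists_hyp x hx
  refine ⟨p, mem_iInter_hHalf.2 fun i => ?_, c, hc, hp⟩
  rw [hp, mink_smul_right]
  exact mul_nonpos_of_nonneg_of_nonpos hc.le (h i)

namespace SimpData

variable (hd : SimpData v r) {S : Set ↥(hypSet n)} (hS : S = ⋂ i, hHalf n (v i))
include hd hS

lemma eq_smul_of_inter_subset (hn : 2 ≤ n) {u : EuclideanSpace ℝ (Fin (n + 1))} {i : Fin (n + 1)}
    (h : S ∩ hWall n (v i) ⊆ hWall n u) : u = (-(mink n u (r i))) • v i := by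
  refine hd.eq_smul_of_facet hn fun x hx hk hi => ?_
  obtain ⟨p, hp, c, hc, hpx⟩ := forall_mem_of_scale hx hk
  have : mink n u p.val = 0 := h ⟨hS ▸ hp, by
    change mink n (v i) p.val = 0
    rw [hpx, mink_smul_right, hi, mul_zero]⟩
  rw [hpx, mink_smul_right] at this
  exact (mul_eq_zero.1 this).resolve_left hc.ne'

lemma eq_or_neg_of_inter_subset (hn : 2 ≤ n) {u : EuclideanSpace ℝ (Fin (n + 1))}
    (hu : mink n u u = 1) {i : Fin (n + 1)}
    (h : S ∩ hWall n (v i) ⊆ hWall n u) : u = v i ∨ u = -v i := by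
  have h1 := hd.eq_smul_of_inter_subset hS hn h
  set c := -(mink n u (r i))
  rw [h1, mink_smul_left, mink_smul_right, hd.unit, mul_one, mul_self_eq_one_iff] at hu
  rcases hu with hu | hu
  · left; rw [h1, hu, one_smul]
  · right; rw [h1, hu, neg_one_smul]

lemma isFacet (hn : 2 ≤ n) (i : Fin (n + 1)) : hIsFacet n S (S ∩ hWall n (v i)) := by
  refine ⟨?_, v i, hd.unit i, fun x hx => ?_, rfl, fun u hu h => ?_⟩
  · have hq := hd.mink_facet_center i
    set q := ∑ k ∈ Finset.univ.erase i, r k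
    obtain ⟨a, b, ha, hb, hab⟩ : ∃ a b : Fin (n + 1), a ≠ i ∧ b ≠ i ∧ a ≠ b := by
      have : 1 < (Finset.univ.erase i).card := by
        rw [Finset.card_erase_of_mem (Finset.mem_univ _)]; simp; omega
      obtain ⟨a, ha, b, hb, hab⟩ := Finset.one_lt_card.1 this
      exact ⟨a, b, by simpa using ha, by simpa using hb, hab⟩
    have hqc : ∀ k, mink n (v k) q ≤ 0 := fun k => by rw [hq]; split_ifs <;> norm_num
    have hqf : Fut q := hd.fut_of_mem hqc hab
      (by rw [hq, if_neg ha]; norm_num) (by rw [hq, if_neg hb]; norm_num)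
    obtain ⟨p, hp, c, hc, hpx⟩ := forall_mem_of_scale hqf hqc
    refine ⟨p, hS ▸ hp, ?_⟩
    change mink n (v i) p.val = 0
    rw [hpx, mink_smul_right, hq, if_pos rfl, mul_zero]
  · rw [hS] at hx; exact mem_iInter_hHalf.1 hx i
  · rcases hd.eq_or_neg_of_inter_subset hS hn hu h with rfl | rfl
    · rfl
    · ext x; simp [hWall, mink_neg_left]

/-- The normal of a supporting hyperplane is a nonnegative combination of the `v i`. -/
lemma mink_ray_nonpos (hn : 1 ≤ n) {u : EuclideanSpace ℝ (Fin (n + 1))} (h : S ⊆ hHalf n u)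
    (i : Fin (n + 1)) : mink n u (r i) ≤ 0 := by
  have hq := hd.mink_center
  set q := ∑ i, r i
  have hqf : Fut q := by
    refine hd.fut_of_mem (fun k => by rw [hq]; norm_num) (i := 0) (j := Fin.last n) ?_
      (by rw [hq]; norm_num) (by rw [hq]; norm_num)
    rw [Ne, Fin.ext_iff]; simp; omega
  have key : ∀ ε : ℝ, 0 < ε → mink n u (r i) + ε * mink n u q ≤ 0 := by
    intro ε hε
    have hf : Fut (ε • q + r i) := (hqf.smul hε).add_caus (hd.caus i)
    obtain ⟨p, hp, c, hc, hpx⟩ := forall_mem_of_scale (v := v) hf fun k => by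
      rw [mink_add_right, mink_smul_right, hq, hd.dual]; split_ifs <;> linarith
    have h1 : mink n u p.val ≤ 0 := h (hS ▸ hp)
    rw [hpx, mink_smul_right, mink_add_right, mink_smul_right] at h1
    nlinarith
  by_contra hc
  push Not at hc
  have h1 := key (mink n u (r i) / (|mink n u q| + 1) / 2) (by positivity)
  have h2 : -(|mink n u q|) ≤ mink n u q := neg_abs_le _
  have h3 : mink n u (r i) / (|mink n u q| + 1) / 2 * (|mink n u q| + 1) = mink n u (r i) / 2 := by
    field_simp
  have h4 : 0 < mink n u (r i) / (|mink n u q| + 1) / 2 := by positivity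
  nlinarith

lemma facet_eq (hn : 2 ≤ n) {S' : Set ↥(hypSet n)} (h : hIsFacet n S S') :
    ∃ i, S' = S ∩ hWall n (v i) := by
  obtain ⟨-, u, hu, hsub, hS', huniq⟩ := h
  have hc := hd.mink_ray_nonpos hS (by omega) hsub
  have hex : ∃ i, mink n u (r i) ≠ 0 := by
    by_contra hcon
    push Not at hcon
    have := hd.expand_normal u
    simp only [hcon, neg_zero, zero_smul, Finset.sum_const_zero] at this
    rw [this, mink_zero_left] at hu
    norm_num at hu
  obtain ⟨i, hi⟩ := hex
  have h1 : S' ⊆ hWall n (v i) := by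
    intro x hx
    rw [hS'] at hx
    have hxu : mink n u x.val = 0 := hx.2
    have hxS := hx.1
    rw [hS] at hxS
    have hxv := mem_iInter_hHalf.1 hxS
    rw [hd.expand_normal u, mink_sum_left] at hxu
    have h2 := (Finset.sum_eq_zero_iff_of_nonpos fun j _ => by
      rw [mink_smul_left]
      exact mul_nonpos_of_nonneg_of_nonpos (neg_nonneg.2 (hc j)) (hxv j)).1 hxu i
        (Finset.mem_univ i)
    rw [mink_smul_left] at h2
    exact (mul_eq_zero.1 h2).resolve_left (neg_ne_zero.2 hi)
  exact ⟨i, by rw [huniq (v i) (hd.unit i) h1, hS']⟩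

end SimpData

end SimplicialCone

/-! ## Ideal vertices -/

section IdealVertices

variable {n : ℕ}

lemma mink_nonpos_of_mem_closure {S : Set ↥(hypSet n)} {u w : EuclideanSpace ℝ (Fin (n + 1))}
    (h : S ⊆ hHalf n u) (hw : w ∈ closure (hCone n S)) : mink n u w ≤ 0 := by
  have : hCone n S ⊆ {y | mink n u y ≤ 0} := by
    rintro _ ⟨x, hx, t, ht, rfl⟩
    change mink n u (t • x.val) ≤ 0
    rw [mink_smul_right]
    exact mul_nonpos_of_nonneg_of_nonpos ht.le (h hx)
  exact closure_minimal this (isClosed_le (continuous_mink u) continuous_const) hw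

lemma mem_closure_hCone {ι : Type*} {v : ι → EuclideanSpace ℝ (Fin (n + 1))}
    {p : ↥(hypSet n)} (hp : ∀ i, mink n (v i) p.val ≤ 0) {w : EuclideanSpace ℝ (Fin (n + 1))}
    (hw : Caus w) (h : ∀ i, mink n (v i) w ≤ 0) :
    w ∈ closure (hCone n (⋂ i, hHalf n (v i))) := by
  have hc : Filter.Tendsto (fun ε : ℝ => ε • p.val + w) (nhdsWithin 0 (Set.Ioi 0)) (nhds w) := by
    have : ContinuousAt (fun ε : ℝ => ε • p.val + w) 0 := by fun_prop
    have h2 := this.tendsto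
    simp only [zero_smul, zero_add] at h2
    exact h2.mono_left nhdsWithin_le_nhds
  refine mem_closure_of_tendsto hc ?_
  filter_upwards [self_mem_nhdsWithin] with ε hε
  have hε' : 0 < ε := hε
  obtain ⟨q, hq, c, hc, hqx⟩ := forall_mem_of_scale (v := v)
    (((fut_of_mem p).smul hε').add_caus hw) fun i => by
      rw [mink_add_right, mink_smul_right]
      have := mul_nonpos_of_nonneg_of_nonpos hε'.le (hp i)
      linarith [h i]
  exact ⟨q, hq, c⁻¹, inv_pos.2 hc, by rw [hqx, smul_smul, inv_mul_cancel₀ hc.ne', one_smul]⟩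

lemma mem_hIdealVerts_iff {ι : Type*} {v : ι → EuclideanSpace ℝ (Fin (n + 1))}
    {S : Set ↥(hypSet n)} (hS : S = ⋂ i, hHalf n (v i)) {p : ↥(hypSet n)} (hp : p ∈ S)
    {w : EuclideanSpace ℝ (Fin (n + 1))} :
    w ∈ hIdealVerts n S ↔ mink n w w = 0 ∧ w 0 = 1 ∧ ∀ i, mink n (v i) w ≤ 0 := by
  subst hS
  refine and_congr_right fun h1 => and_congr_right fun h2 => ⟨fun h i => ?_, fun h => ?_⟩
  · exact mink_nonpos_of_mem_closure (iInter_subset _ i) h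
  · exact mem_closure_hCone (mem_iInter_hHalf.1 hp) ⟨h1.le, by rw [h2]; norm_num⟩ h

namespace SimpData

variable {v r : Fin (n + 1) → EuclideanSpace ℝ (Fin (n + 1))} (hd : SimpData v r)
  {S : Set ↥(hypSet n)} (hS : S = ⋂ i, hHalf n (v i))
include hd

lemma center_fut (hn : 1 ≤ n) : Fut (∑ i, r i) := by
  refine hd.fut_of_mem (fun k => by rw [hd.mink_center]; norm_num) (i := 0) (j := Fin.last n) ?_
    (by rw [hd.mink_center]; norm_num) (by rw [hd.mink_center]; norm_num)
  rw [Ne, Fin.ext_iff]; simp; omega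

lemma exists_strict (hn : 1 ≤ n) : ∃ p : ↥(hypSet n), ∀ i, mink n (v i) p.val < 0 := by
  obtain ⟨p, c, hc, hp⟩ := exists_hyp _ (hd.center_fut hn)
  refine ⟨p, fun i => ?_⟩
  rw [hp, mink_smul_right, hd.mink_center]
  linarith

include hS

lemma idealVerts_eq (hn : 1 ≤ n) : hIdealVerts n S =
    (fun i => (r i 0)⁻¹ • r i) '' {i | mink n (r i) (r i) = 0} := by
  obtain ⟨p, hp⟩ := hd.exists_strict hn
  have hpS : p ∈ S := by rw [hS]; exact mem_iInter_hHalf.2 fun i => (hp i).le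
  ext w
  rw [mem_hIdealVerts_iff hS hpS]
  constructor
  · rintro ⟨h1, h2, h3⟩
    obtain ⟨i, c, hc, hw⟩ := hd.exists_ray (x := w) (by rintro rfl; simp at h2) h3
      (fun hf => hf.1.ne h1)
    refine ⟨i, ?_, ?_⟩
    · rw [hw, mink_smul_left, mink_smul_right] at h1
      simpa [hc.ne'] using h1
    · have h4 : c * r i 0 = 1 := by rw [hw] at h2; simpa using h2
      change (r i 0)⁻¹ • r i = w
      rw [hw, eq_inv_of_mul_eq_one_left h4]
  · rintro ⟨i, hi, rfl⟩
    have hi' : mink n (r i) (r i) = 0 := hi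
    have hpos := (hd.caus i).2
    refine ⟨by simp [mink_smul_left, mink_smul_right, hi'], by simp [hpos.ne'], fun j => ?_⟩
    change mink n (v j) ((r i 0)⁻¹ • r i) ≤ 0
    rw [mink_smul_right, hd.dual]
    have := inv_pos.2 hpos
    split_ifs <;> linarith

lemma ncard_idealVerts (hn : 1 ≤ n) :
    (hIdealVerts n S).ncard = {i | mink n (r i) (r i) = 0}.ncard := by
  rw [hd.idealVerts_eq hS hn, Set.ncard_image_of_injective]
  intro i j hij
  by_contra hne
  have h1 := congrArg (mink n (v i)) hij
  simp only [mink_smul_right, hd.dual_self, hd.dual_ne hne] at h1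
  have := inv_pos.2 (hd.caus i).2
  linarith

end SimpData

end IdealVertices

/-! ## Polyhedra with as few facets as a simplex -/

section Polyhedra

variable {n : ℕ}

lemma mink_neg_of_mem_interior {S : Set ↥(hypSet n)} {u : EuclideanSpace ℝ (Fin (n + 1))}
    (hu : mink n u u = 1) (h : S ⊆ hHalf n u) {p : ↥(hypSet n)} (hp : p ∈ interior S) :
    mink n u p.val < 0 := by
  refine lt_of_le_of_ne (h (interior_subset hp)) fun h0 => ?_
  have hc : Filter.Tendsto (fun ε : ℝ => p.val + ε • u) (nhdsWithin 0 (Set.Ioi 0))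
      (nhds p.val) := by
    have : ContinuousAt (fun ε : ℝ => p.val + ε • u) 0 := by fun_prop
    have h2 := this.tendsto
    simp only [zero_smul, add_zero] at h2
    exact h2.mono_left nhdsWithin_le_nhds
  have hn' : Filter.Tendsto (nrm p) (nhds p.val) (nhds p) := by
    have := continuousAt_nrm p p
    rwa [ContinuousAt, nrm_self] at this
  have h1 := (hn'.comp hc).eventually (mem_interior_iff_mem_nhds.1 hp)
  have h2 := hc.eventually (isOpen_fut.mem_nhds (fut_of_mem p))
  obtain ⟨ε, hε1, hε2, hε3⟩ := (h1.and (h2.and self_mem_nhdsWithin)).exists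
  have hε2' : Fut (p.val + ε • u) := hε2
  have hε3' : 0 < ε := hε3
  have h4 : mink n u (nrm p (p.val + ε • u)).val ≤ 0 := h hε1
  have h6 : mink n u (p.val + ε • u) = ε := by
    rw [mink_add_right, mink_smul_right, h0, hu]; ring
  rw [nrm_val p hε2', mink_smul_right, h6] at h4
  have h5 := inv_pos.2 (Real.sqrt_pos.2 (neg_pos.2 hε2'.1))
  have := mul_pos h5 hε3'
  linarith

variable {ι : Type*} {v : ι → EuclideanSpace ℝ (Fin (n + 1))}

lemma false_of_past {p w x : EuclideanSpace ℝ (Fin (n + 1))} (hp : Fut p)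
    (hpC : ∀ i, mink n (v i) p ≤ 0) (hw : Caus w) (hw0 : mink n w w = 0)
    (hwC : ∀ i, mink n (v i) w ≤ 0) (hx : Caus (-x)) (hxC : ∀ i, mink n (v i) x ≤ 0)
    (hC : ∀ y, (∀ i, mink n (v i) y ≤ 0) → mink n y y ≤ 0) : False := by
  have key : ∀ q : EuclideanSpace ℝ (Fin (n + 1)), (∀ i, mink n (v i) q ≤ 0) → ∀ t : ℝ, 0 < t →
      mink n q q + 2 * t * mink n q x + t ^ 2 * mink n x x ≤ 0 := by
    intro q hq t ht
    have := hC (q + t • x) fun i => by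
      rw [mink_add_right, mink_smul_right]
      have := mul_nonpos_of_nonneg_of_nonpos ht.le (hxC i)
      linarith [hq i]
    rw [mink_add_self, mink_smul_right, mink_smul_left, mink_smul_right] at this
    linarith
  have hxx : mink n x x = mink n (-x) (-x) := by rw [mink_neg_left, mink_neg_right, neg_neg]
  rcases hx.1.lt_or_eq with h | h
  · have h1 : mink n (-x) w < 0 := Fut.mink_neg ⟨h, hx.2⟩ hw
    rw [mink_neg_left, mink_comm] at h1
    rw [← hxx] at h
    have hB : 0 < mink n w x := by linarith
    have ht : 0 < mink n w x / (-mink n x x) := div_pos hB (by linarith)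
    have h2 := key w hwC _ ht
    have h3 : mink n w x / (-mink n x x) * mink n x x = - mink n w x := by
      have : mink n x x ≠ 0 := h.ne
      field_simp
    rw [hw0, pow_two, mul_assoc _ _ (mink n x x), h3] at h2
    have := mul_pos ht hB
    linarith
  · have h1 : mink n p (-x) < 0 := hp.mink_neg hx
    rw [mink_neg_right] at h1
    rw [← hxx] at h
    have hB : 0 < mink n p x := by linarith
    have hA := hp.1
    have ht : 0 < (-mink n p p) / mink n p x := div_pos (by linarith) hB
    have h2 := key p hpC _ ht
    rw [h, mul_assoc, div_mul_cancel₀ _ hB.ne'] at h2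
    linarith

lemma exists_pos_root {A B C : ℝ} (hA : A < 0) (hC : 0 < C) :
    ∃ t : ℝ, 0 < t ∧ A + 2 * t * B + t ^ 2 * C = 0 := by
  have hD : 0 < B ^ 2 - A * C := by nlinarith [sq_nonneg B, mul_pos (neg_pos.2 hA) hC]
  have hs : |B| < √(B ^ 2 - A * C) := by
    rw [← Real.sqrt_sq_eq_abs]
    exact Real.sqrt_lt_sqrt (sq_nonneg B) (by nlinarith [mul_pos (neg_pos.2 hA) hC])
  refine ⟨(-B + √(B ^ 2 - A * C)) / C, div_pos (by linarith [le_abs_self B]) hC, ?_⟩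
  have h1 := Real.sq_sqrt hD.le
  field_simp
  linarith [h1]

lemma mink_self_nonpos_of_finite [Finite ι] (hn : 2 ≤ n) {p : ↥(hypSet n)}
    (hp : ∀ i, mink n (v i) p.val < 0)
    (hfin : (hIdealVerts n (⋂ i, hHalf n (v i))).Finite) {x : EuclideanSpace ℝ (Fin (n + 1))}
    (hxC : ∀ i, mink n (v i) x ≤ 0) : mink n x x ≤ 0 := by
  by_contra hx
  push Not at hx
  obtain ⟨d, hd0, hdp, hdx⟩ : ∃ d : EuclideanSpace ℝ (Fin (n + 1)), d ≠ 0 ∧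
      mink n p.val d = 0 ∧ mink n x d = 0 := by
    have h := LinearMap.ker_ne_bot_of_finrank_lt (f := (minkB n p.val).prod (minkB n x))
      (by simp; omega)
    obtain ⟨d, hd, hd0⟩ := Submodule.exists_mem_ne_zero_of_ne_bot h
    have hd' : (minkB n p.val d, minkB n x d) = (0, 0) := LinearMap.mem_ker.1 hd
    exact ⟨d, hd0, congrArg Prod.fst hd', congrArg Prod.snd hd'⟩
  have hdd : 0 < mink n d d := by
    by_contra hc
    push Not at hc
    have h0 : d 0 ≠ 0 := fun h0 => hd0 (eq_zero_of_mink_self_nonpos h0 hc)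
    rcases h0.lt_or_gt with h | h
    · have := (fut_of_mem p).mink_neg (y := -d)
        ⟨by rw [mink_neg_left, mink_neg_right, neg_neg]; exact hc, by simpa using h⟩
      rw [mink_neg_right, hdp] at this
      linarith
    · have := (fut_of_mem p).mink_neg (y := d) ⟨hc, h⟩
      rw [hdp] at this
      linarith
  have hev : ∀ᶠ s : ℝ in nhds 0, Fut (p.val + s • d) ∧ ∀ i, mink n (v i) (p.val + s • d) < 0 := by
    have hc : Filter.Tendsto (fun s : ℝ => p.val + s • d) (nhds 0) (nhds p.val) := by
      have : ContinuousAt (fun ε : ℝ => p.val + ε • d) 0 := by fun_prop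
      simpa using this.tendsto
    refine (hc.eventually (isOpen_fut.mem_nhds (fut_of_mem p))).and ?_
    rw [Filter.eventually_all]
    intro i
    exact hc.eventually ((isOpen_lt (continuous_mink (v i)) continuous_const).mem_nhds (hp i))
  obtain ⟨δ, hδ, hball⟩ := Metric.eventually_nhds_iff_ball.1 hev
  have hex : ∀ s : ℝ, ∃ t : ℝ, s ∈ Set.Ioo 0 δ →
      0 < t ∧ mink n (p.val + s • d + t • x) (p.val + s • d + t • x) = 0 ∧
        0 < (p.val + s • d + t • x) 0 ∧ ∀ i, mink n (v i) (p.val + s • d + t • x) ≤ 0 := by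
    intro s
    by_cases hs : s ∈ Set.Ioo 0 δ
    · obtain ⟨hf, hv⟩ := hball s (by
        rw [Metric.mem_ball, Real.dist_eq, sub_zero, abs_of_pos hs.1]; exact hs.2)
      set y := p.val + s • d
      obtain ⟨t, ht, hroot⟩ := exists_pos_root (B := mink n y x) hf.1 hx
      have hz : mink n (y + t • x) (y + t • x) = 0 := by
        rw [mink_add_self, mink_smul_right, mink_smul_left, mink_smul_right]
        linarith
      refine ⟨t, fun _ => ⟨ht, hz, hf.pos_of_mink_neg hz.le ?_, fun i => ?_⟩⟩
      · rw [mink_add_right, mink_smul_right]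
        have := mul_pos (pow_pos ht 2) hx
        linarith [hf.1]
      · rw [mink_add_right, mink_smul_right]
        have := mul_nonpos_of_nonneg_of_nonpos ht.le (hxC i)
        linarith [hv i]
    · exact ⟨0, fun h => absurd h hs⟩
  choose t ht using hex
  set z : ℝ → EuclideanSpace ℝ (Fin (n + 1)) := fun s => p.val + s • d + t s • x with hz
  refine Set.infinite_of_injOn_mapsTo (f := fun s => (z s 0)⁻¹ • z s) (s := Set.Ioo 0 δ)
    ?_ ?_ (Set.Ioo_infinite hδ) hfin
  · intro s hs s' hs' heq
    have h0 := (ht s hs).2.2.1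
    have h0' := (ht s' hs').2.2.1
    change 0 < z s 0 at h0
    change 0 < z s' 0 at h0'
    set a := (z s 0)⁻¹ with ha
    set b := (z s' 0)⁻¹ with hb
    have ha0 : 0 < a := inv_pos.2 h0
    have hb0 : 0 < b := inv_pos.2 h0'
    change a • z s = b • z s' at heq
    have h1 := congrArg (fun y => mink n y d) heq
    simp only [hz, mink_smul_left, mink_add_left, hdp, hdx, zero_add, mul_zero, add_zero] at h1
    have h2 : a * s = b * s' := by
      have : (a * s - b * s') * mink n d d = 0 := by linarith
      have := (mul_eq_zero.1 this).resolve_right hdd.ne'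
      linarith
    have h3 : (a - b) • p.val = (b * t s' - a * t s) • x := by
      have h4 : a • p.val + (a * s) • d + (a * t s) • x =
          b • p.val + (b * s') • d + (b * t s') • x := by
        simpa only [hz, smul_add, smul_smul] using heq
      rw [h2] at h4
      rw [sub_smul, sub_smul, sub_eq_sub_iff_add_eq_add]
      have h5 : a • p.val + (a * t s) • x + (b * s') • d =
          b • p.val + (b * t s') • x + (b * s') • d := by
        rw [add_right_comm, h4, add_right_comm]
      rw [add_right_cancel h5]
      exact add_comm _ _
    have h6 := congrArg (fun y => mink n y y) h3
    simp only [mink_smul_left, mink_smul_right, p.2.1] at h6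
    have h7 : (a - b) * (a - b) = 0 := by
      have := mul_nonneg (mul_self_nonneg (b * t s' - a * t s)) hx.le
      nlinarith [mul_self_nonneg (a - b)]
    have h8 : a = b := sub_eq_zero.1 (mul_self_eq_zero.1 h7)
    rw [h8] at h2
    exact mul_left_cancel₀ hb0.ne' h2
  · intro s hs
    obtain ⟨h1, h2, h3, h4⟩ := ht s hs
    rw [mem_hIdealVerts_iff rfl (mem_iInter_hHalf.2 fun i => (hp i).le)]
    change mink n (z s) (z s) = 0 at h2
    change 0 < z s 0 at h3
    refine ⟨by simp [mink_smul_left, mink_smul_right, h2], by simp [h3.ne'], fun i => ?_⟩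
    rw [mink_smul_right]
    exact mul_nonpos_of_nonneg_of_nonpos (inv_pos.2 h3).le (h4 i)

lemma simpData_of_card_le [Fintype ι] (hn : 2 ≤ n) (hunit : ∀ i, mink n (v i) (v i) = 1)
    {p : ↥(hypSet n)} (hp : ∀ i, mink n (v i) p.val < 0) (hcard : Fintype.card ι ≤ n + 1)
    (hfin : (hIdealVerts n (⋂ i, hHalf n (v i))).Finite)
    (hne : (hIdealVerts n (⋂ i, hHalf n (v i))).Nonempty) :
    ∃ (e : Fin (n + 1) ≃ ι) (r : Fin (n + 1) → EuclideanSpace ℝ (Fin (n + 1))),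
      SimpData (v ∘ e) r := by
  have hC := fun x hx => mink_self_nonpos_of_finite (x := x) hn hp hfin hx
  obtain ⟨w, hw⟩ := hne
  rw [mem_hIdealVerts_iff rfl (mem_iInter_hHalf.2 fun i => (hp i).le)] at hw
  obtain ⟨hw0, hw1, hwC⟩ := hw
  have hwc : Caus w := ⟨hw0.le, by rw [hw1]; norm_num⟩
  have hpast : ∀ x, (∀ i, mink n (v i) x ≤ 0) → ¬Caus (-x) := fun x hx hxc =>
    false_of_past (fut_of_mem p) (fun i => (hp i).le) hwc hw0 hwC hxc hx hC
  set φ : EuclideanSpace ℝ (Fin (n + 1)) →ₗ[ℝ] (ι → ℝ) := LinearMap.pi fun i => minkB n (v i)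
    with hφ
  have hφa : ∀ x i, φ x i = mink n (v i) x := fun x i => rfl
  have hinj : Function.Injective φ := by
    rw [← LinearMap.ker_eq_bot, Submodule.eq_bot_iff]
    intro x hx
    have hx' : ∀ i, mink n (v i) x = 0 := fun i => by
      rw [← hφa, LinearMap.mem_ker.1 hx]; rfl
    by_contra hx0
    have hxx := hC x fun i => (hx' i).le
    have h0 : x 0 ≠ 0 := fun h0 => hx0 (eq_zero_of_mink_self_nonpos h0 hxx)
    rcases h0.lt_or_gt with h | h
    · exact hpast x (fun i => (hx' i).le)
        ⟨by rw [mink_neg_left, mink_neg_right, neg_neg]; exact hxx, by simpa using h⟩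
    · exact hpast (-x) (fun i => by rw [mink_neg_right, hx' i, neg_zero])
        (by rw [neg_neg]; exact ⟨hxx, h⟩)
  have hge := LinearMap.finrank_le_finrank_of_injective hinj
  simp only [finrank_euclideanSpace, Fintype.card_fin, Module.finrank_fintype_fun_eq_card] at hge
  have hcardeq : Fintype.card ι = n + 1 := le_antisymm hcard hge
  have hsurj : Function.Surjective φ :=
    (LinearMap.injective_iff_surjective_of_finrank_eq_finrank (by simp [hcardeq])).1 hinj
  let e : Fin (n + 1) ≃ ι := (Fintype.equivFinOfCardEq hcardeq).symm
  classical
  choose r hr using fun i => hsurj (Pi.single (e i) (-1))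
  have hdual : ∀ i j, mink n (v i) (r j) = if i = e j then -1 else 0 := by
    intro i j
    rw [← hφa, hr, Pi.single_apply]
  refine ⟨e, r, ⟨fun i => hunit _, fun i j => by simp [hdual], fun j => ?_⟩⟩
  have hrC : ∀ i, mink n (v i) (r j) ≤ 0 := fun i => by
    rw [hdual]; split_ifs <;> norm_num
  have hrr := hC (r j) hrC
  refine ⟨hrr, ?_⟩
  by_contra hc
  rcases (not_lt.1 hc).lt_or_eq with h | h
  · exact hpast (r j) hrC
      ⟨by rw [mink_neg_left, mink_neg_right, neg_neg]; exact hrr, by simpa using h⟩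
  · have h1 := eq_zero_of_mink_self_nonpos h hrr
    have h2 := hdual (e j) j
    rw [h1, mink_zero_right] at h2
    norm_num at h2

/-- A wall cutting a polyhedron transversally to all its other walls carries a facet. -/
lemma isFacet_of_irredundant [Finite ι] (hunit : ∀ i, mink n (v i) (v i) = 1)
    {p x : ↥(hypSet n)} (hp : ∀ i, mink n (v i) p.val < 0) {i : ι}
    (hxi : 0 < mink n (v i) x.val) (hx : ∀ j, j ≠ i → mink n (v j) x.val ≤ 0) :
    ∃ q ∈ ⋂ j, hHalf n (v j), mink n (v i) q.val = 0 ∧ (∀ j, j ≠ i → mink n (v j) q.val < 0) ∧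
      hIsFacet n (⋂ j, hHalf n (v j)) ((⋂ j, hHalf n (v j)) ∩ hWall n (v i)) := by
  set q := mink n (v i) x.val • p.val + (-(mink n (v i) p.val)) • x.val with hq
  have hqf : Fut q := ((fut_of_mem p).smul hxi).add_caus
    ((fut_of_mem x).caus.smul (neg_pos.2 (hp i)))
  have hqi : mink n (v i) q = 0 := by
    rw [hq, mink_add_right, mink_smul_right, mink_smul_right]; ring
  have hqj : ∀ j, j ≠ i → mink n (v j) q < 0 := by
    intro j hj
    rw [hq, mink_add_right, mink_smul_right, mink_smul_right]
    have h1 := mul_neg_of_pos_of_neg hxi (hp j)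
    have h2 := mul_nonpos_of_nonneg_of_nonpos (neg_pos.2 (hp i)).le (hx j hj)
    linarith
  have hqC : ∀ j, mink n (v j) q ≤ 0 := fun j => by
    by_cases hj : j = i
    · rw [hj, hqi]
    · exact (hqj j hj).le
  obtain ⟨q', hq'S, c, hc, hq'⟩ := forall_mem_of_scale hqf hqC
  have hq'i : mink n (v i) q'.val = 0 := by rw [hq', mink_smul_right, hqi, mul_zero]
  refine ⟨q', hq'S, hq'i, fun j hj => ?_, ⟨q', hq'S, hq'i⟩, v i, hunit i, iInter_subset _ i, rfl,
    fun u hu hsub => ?_⟩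
  · rw [hq', mink_smul_right]
    exact mul_neg_of_pos_of_neg hc (hqj j hj)
  · have hzero : ∀ y, Fut y → (∀ j, mink n (v j) y ≤ 0) → mink n (v i) y = 0 →
        mink n u y = 0 := by
      intro y hy hyC hyi
      obtain ⟨y', hy'S, c, hc, hy'⟩ := forall_mem_of_scale hy hyC
      have := hsub ⟨hy'S, (by
        change mink n (v i) y'.val = 0
        rw [hy', mink_smul_right, hyi, mul_zero])⟩
      change mink n u y'.val = 0 at this
      rw [hy', mink_smul_right] at this
      exact (mul_eq_zero.1 this).resolve_left hc.ne'
    have hdir : ∀ d, mink n (v i) d = 0 → mink n u d = 0 := by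
      intro d hd
      have hc : Filter.Tendsto (fun s : ℝ => q + s • d) (nhdsWithin 0 (Set.Ioi 0)) (nhds q) := by
        have : ContinuousAt (fun ε : ℝ => q + ε • d) 0 := by fun_prop
        have h2 := this.tendsto
        simp only [zero_smul, add_zero] at h2
        exact h2.mono_left nhdsWithin_le_nhds
      have hev : ∀ᶠ s in nhdsWithin (0 : ℝ) (Set.Ioi 0), ∀ j, j ≠ i →
          mink n (v j) (q + s • d) < 0 := by
        rw [Filter.eventually_all]
        intro j
        by_cases hj : j = i
        · exact Filter.Eventually.of_forall fun _ h => absurd hj h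
        · filter_upwards [hc.eventually ((isOpen_lt (continuous_mink (v j))
            continuous_const).mem_nhds (hqj j hj))] with s hs _ using hs
      obtain ⟨s, hs1, hs2, hs3⟩ := ((hc.eventually (isOpen_fut.mem_nhds hqf)).and
        (hev.and self_mem_nhdsWithin)).exists
      have hs3' : 0 < s := hs3
      have hsi : mink n (v i) (q + s • d) = 0 := by
        rw [mink_add_right, mink_smul_right, hqi, hd]; ring
      have h1 := hzero (q + s • d) hs1 (fun j => by
        by_cases hj : j = i
        · rw [hj, hsi]
        · exact (hs2 j hj).le) hsi
      rw [mink_add_right, mink_smul_right, hzero q hqf hqC hqi, zero_add] at h1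
      exact (mul_eq_zero.1 h1).resolve_left hs3'.ne'
    have huv : ∀ y, mink n u y = mink n u (v i) * mink n (v i) y := by
      intro y
      have := hdir (y - mink n (v i) y • v i) (by
        rw [mink_sub_right, mink_smul_right, hunit]; ring)
      rw [mink_sub_right, mink_smul_right] at this
      linarith
    have hne : mink n u (v i) ≠ 0 := by
      intro h0
      have := huv u
      rw [hu, h0] at this
      norm_num at this
    ext y
    change mink n u y.val = 0 ↔ mink n (v i) y.val = 0
    rw [huv, mul_eq_zero]
    exact ⟨fun h => h.resolve_left hne, Or.inr⟩

/-- A polyhedron with `n + 1` facets and with an ideal vertex, but only finitely many, is a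
simplex whose cone is simplicial. -/
theorem exists_simpData (hn : 2 ≤ n) {k : ℕ} {v : Fin k → EuclideanSpace ℝ (Fin (n + 1))}
    (hunit : ∀ i, mink n (v i) (v i) = 1) {S : Set ↥(hypSet n)} (hS : S = ⋂ i, hHalf n (v i))
    (hSint : (interior S).Nonempty) (hfac : {S' | hIsFacet n S S'}.ncard = n + 1)
    (hid : (hIdealVerts n S).ncard ≠ 0) :
    ∃ (ι : Fin (n + 1) → Fin k) (r : Fin (n + 1) → EuclideanSpace ℝ (Fin (n + 1))),
      SimpData (fun i => v (ι i)) r ∧ S = ⋂ i, hHalf n (v (ι i)) := by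
  classical
  obtain ⟨p, hp⟩ := hSint
  have hpv : ∀ i, mink n (v i) p.val < 0 := fun i =>
    mink_neg_of_mem_interior (hunit i) (by rw [hS]; exact iInter_subset _ i) hp
  let good : Finset (Fin k) → Prop := fun I => ∀ x : ↥(hypSet n),
    (∀ i ∈ I, mink n (v i) x.val ≤ 0) → ∀ i, mink n (v i) x.val ≤ 0
  obtain ⟨I, hI, hmin⟩ := (Finset.univ.filter good).exists_min_image Finset.card
    ⟨Finset.univ, by simp [good]⟩
  have hIg : good I := (Finset.mem_filter.1 hI).2
  have hSI : S = ⋂ i : ↥I, hHalf n (v i) := by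
    rw [hS]
    ext x
    rw [mem_iInter_hHalf, mem_iInter_hHalf]
    exact ⟨fun h i => h i, fun h => hIg x fun i hi => h ⟨i, hi⟩⟩
  have hirr : ∀ i : ↥I, ∃ x : ↥(hypSet n), 0 < mink n (v i) x.val ∧
      ∀ j : ↥I, j ≠ i → mink n (v j) x.val ≤ 0 := by
    intro i
    have hng : ¬good (I.erase i) := by
      intro hg
      have := hmin _ (Finset.mem_filter.2 ⟨Finset.mem_univ _, hg⟩)
      have h2 := Finset.card_erase_lt_of_mem i.2
      omega
    simp only [good] at hng
    push Not at hng
    obtain ⟨x, hx, j, hj⟩ := hng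
    have hx' : ∀ j : ↥I, j ≠ i → mink n (v j) x.val ≤ 0 := fun j hji =>
      hx j (Finset.mem_erase.2 ⟨fun h => hji (Subtype.ext h), j.2⟩)
    refine ⟨x, ?_, hx'⟩
    by_contra hc
    have := hIg x (fun a ha => by
      by_cases hai : (⟨a, ha⟩ : ↥I) = i
      · have : a = i := congrArg Subtype.val hai
        rw [this]; exact not_lt.1 hc
      · exact hx' ⟨a, ha⟩ hai) j
    linarith
  choose x hx1 hx2 using hirr
  have hq := fun i : ↥I => isFacet_of_irredundant (v := fun i : ↥I => v i)
    (fun i => hunit i) (fun i => hpv i) (hx1 i) (hx2 i)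
  choose q hqS hqi hqj hqf using hq
  rw [← hSI] at hqS hqf
  have hcard : Fintype.card ↥I ≤ n + 1 := by
    have hfin : {S' | hIsFacet n S S'}.Finite := Set.finite_of_ncard_ne_zero (by rw [hfac]; simp)
    rw [← hfac, ← Nat.card_eq_fintype_card, ← Set.ncard_univ]
    refine Set.ncard_le_ncard_of_injOn (fun i : ↥I => S ∩ hWall n (v i)) (fun i _ => hqf i)
      (fun i _ j _ hij => ?_) hfin
    by_contra hne
    have h1 : q i ∈ S ∩ hWall n (v i) := ⟨hqS i, hqi i⟩
    have h2 : q i ∈ S ∩ hWall n (v j) := by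
      have := hij.le h1
      exact this
    have h3 := hqj i j (fun h => hne h.symm)
    have h4 : mink n (v j) (q i).val = 0 := h2.2
    linarith
  obtain ⟨e, r, hd⟩ := simpData_of_card_le (v := fun i : ↥I => v i) hn (fun i => hunit i)
    (fun i => hpv i) hcard (by rw [← hSI]; exact Set.finite_of_ncard_ne_zero hid)
    (by rw [← hSI]; exact Set.nonempty_of_ncard_ne_zero hid)
  refine ⟨fun i => e i, r, hd, ?_⟩
  rw [hSI]
  exact (e.iInf_comp (g := fun i : ↥I => hHalf n (v i))).symm

end Polyhedra

/-! ## Isometries are linear -/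

section Isometries

variable {n : ℕ}

/-- Linear maps preserving the Minkowski form. -/
def Lorentz (L : EuclideanSpace ℝ (Fin (n + 1)) →ₗ[ℝ] EuclideanSpace ℝ (Fin (n + 1))) : Prop :=
  ∀ x y, mink n (L x) (L y) = mink n x y

lemma Lorentz.injective {L : EuclideanSpace ℝ (Fin (n + 1)) →ₗ[ℝ] EuclideanSpace ℝ (Fin (n + 1))}
    (hL : Lorentz L) : Function.Injective L := by
  rw [← LinearMap.ker_eq_bot, Submodule.eq_bot_iff]
  intro x hx
  exact eq_zero_of_mink_eq_zero fun y => by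
    rw [← hL, LinearMap.mem_ker.1 hx, mink_zero_left]

lemma Lorentz.surjective {L : EuclideanSpace ℝ (Fin (n + 1)) →ₗ[ℝ] EuclideanSpace ℝ (Fin (n + 1))}
    (hL : Lorentz L) : Function.Surjective L :=
  LinearMap.injective_iff_surjective.1 hL.injective

lemma sum_single (x : EuclideanSpace ℝ (Fin (n + 1))) :
    x = ∑ a, x a • (EuclideanSpace.single a 1 : EuclideanSpace ℝ (Fin (n + 1))) := by
  ext b
  simp [Finset.sum_apply, Pi.single_apply]

theorem exists_lorentz {g : ↥(hypSet n) → ↥(hypSet n)} (hg : hIsIsom n g) :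
    ∃ L : EuclideanSpace ℝ (Fin (n + 1)) →ₗ[ℝ] EuclideanSpace ℝ (Fin (n + 1)),
      Lorentz L ∧ ∀ x, (g x).val = L x.val := by
  obtain ⟨X, c, hX⟩ : ∃ (X : Fin (n + 1) → ↥(hypSet n)) (c : Fin (n + 1) → ℝ),
      ∀ a, (EuclideanSpace.single a 1 : EuclideanSpace ℝ (Fin (n + 1))) =
        (X a).val - c a • (X 0).val := by
    have h0 : (EuclideanSpace.single 0 1 : EuclideanSpace ℝ (Fin (n + 1))) ∈ hypSet n := by
      refine ⟨?_, by simp⟩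
      rw [mink_single_zero]; simp
    have hs : ∀ i : Fin n, (√2 • EuclideanSpace.single 0 1 + EuclideanSpace.single i.succ 1 :
        EuclideanSpace ℝ (Fin (n + 1))) ∈ hypSet n := by
      intro i
      refine ⟨?_, by simp [(Fin.succ_ne_zero i).symm]⟩
      rw [mink_add_right, mink_smul_right, mink_single_zero, mink_single_succ]
      simp [(Fin.succ_ne_zero i).symm]
      norm_num
    refine ⟨Fin.cases ⟨_, h0⟩ fun i => ⟨_, hs i⟩, Fin.cases 0 fun _ => √2, fun a => ?_⟩
    refine Fin.cases (by simp) (fun i => by simp) a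
  set f : Fin (n + 1) → EuclideanSpace ℝ (Fin (n + 1)) :=
    fun a => (g (X a)).val - c a • (g (X 0)).val with hf
  have hff : ∀ a b, mink n (f a) (f b) =
      mink n (EuclideanSpace.single a 1) (EuclideanSpace.single b 1) := by
    intro a b
    rw [hX a, hX b]
    simp only [hf, mink_sub_left, mink_sub_right, mink_smul_left, mink_smul_right, hg.2]
  set L : EuclideanSpace ℝ (Fin (n + 1)) →ₗ[ℝ] EuclideanSpace ℝ (Fin (n + 1)) :=
    { toFun := fun x => ∑ a, x a • f a
      map_add' := fun x y => by simp [add_smul, Finset.sum_add_distrib]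
      map_smul' := fun t x => by simp [mul_smul, Finset.smul_sum] } with hLdef
  have hLx : ∀ x, L x = ∑ a, x a • f a := fun x => rfl
  have hL : Lorentz L := by
    intro x y
    conv_rhs => rw [sum_single x, sum_single y]
    rw [hLx, hLx]
    simp only [mink_sum_left, mink_sum_right, mink_smul_left, mink_smul_right, hff]
  have hLe : ∀ a, L (EuclideanSpace.single a 1) = f a := by
    intro a
    rw [hLx, Finset.sum_eq_single a] <;> simp +contextual
  refine ⟨L, hL, fun x => ?_⟩
  rw [← sub_eq_zero]
  refine eq_zero_of_mink_eq_zero fun y => ?_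
  obtain ⟨y, rfl⟩ := hL.surjective y
  rw [mink_sub_left, hL, sub_eq_zero]
  rw [hLx, mink_sum_right]
  conv_rhs => rw [sum_single y, mink_sum_right]
  refine Finset.sum_congr rfl fun a _ => ?_
  rw [mink_smul_right, mink_smul_right, hX a]
  simp only [hf, mink_sub_right, mink_smul_right, hg.2]

variable {v r : Fin (n + 1) → EuclideanSpace ℝ (Fin (n + 1))}

lemma image_iInter_hHalf {ι : Type*} {v : ι → EuclideanSpace ℝ (Fin (n + 1))}
    {g : ↥(hypSet n) → ↥(hypSet n)} (hg : hIsIsom n g)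
    {L : EuclideanSpace ℝ (Fin (n + 1)) →ₗ[ℝ] EuclideanSpace ℝ (Fin (n + 1))}
    (hL : Lorentz L) (hgL : ∀ x, (g x).val = L x.val) :
    g '' (⋂ i, hHalf n (v i)) = ⋂ i, hHalf n (L (v i)) := by
  ext y
  obtain ⟨x, rfl⟩ := hg.1.2 y
  rw [hg.1.1.mem_set_image, mem_iInter_hHalf, mem_iInter_hHalf]
  simp only [hgL, hL _ _]

lemma SimpData.map (hd : SimpData v r) (hn : 1 ≤ n) {g : ↥(hypSet n) → ↥(hypSet n)}
    {L : EuclideanSpace ℝ (Fin (n + 1)) →ₗ[ℝ] EuclideanSpace ℝ (Fin (n + 1))}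
    (hL : Lorentz L) (hgL : ∀ x, (g x).val = L x.val) :
    SimpData (fun i => L (v i)) (fun i => L (r i)) := by
  refine ⟨fun i => by rw [hL, hd.unit], fun i j => by rw [hL, hd.dual], fun i => ?_⟩
  obtain ⟨p, hp⟩ := hd.exists_strict hn
  have h1 : mink n (L (r i)) (L (r i)) ≤ 0 := by rw [hL]; exact (hd.caus i).1
  refine ⟨h1, (CD.fut_of_mem (g p)).pos_of_mink_neg h1 ?_⟩
  rw [hgL, hL]
  exact (CD.fut_of_mem p).mink_neg (hd.caus i)

end Isometries

/-! ### Volume of cones -/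

section Volume

variable {n : ℕ}

lemma lintegral_pow_Ioc {a : ℝ} (ha : 0 ≤ a) (n : ℕ) :
    ∫⁻ s in Ioc 0 a, ENNReal.ofReal (s ^ n) = ENNReal.ofReal (a ^ (n + 1) / (n + 1)) := by
  rw [← ofReal_integral_eq_lintegral_ofReal, ← intervalIntegral.integral_of_le ha, integral_pow]
  · simp
  · exact (continuous_pow n).integrableOn_Ioc
  · filter_upwards [ae_restrict_mem measurableSet_Ioc] with s hs
    exact pow_nonneg hs.1.le n

open scoped Pointwise in
lemma volume_cone_prod {D : Set (Fin n → ℝ)} (hD : MeasurableSet D)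
    (hD1 : ∀ y ∈ D, ∑ i, y i ^ 2 < 1) :
    volume {p : ℝ × (Fin n → ℝ) | 0 < p.1 ∧ p.1⁻¹ • p.2 ∈ D ∧
      p.1 ^ 2 * (1 - ∑ i, (p.1⁻¹ • p.2) i ^ 2) ≤ 1} =
    ∫⁻ y in D, ENNReal.ofReal
      ((1 - ∑ i, y i ^ 2) ^ (-((n : ℝ) + 1) / 2) / (n + 1)) := by
  set A : ℝ → Set (Fin n → ℝ) := fun s => D ∩ {y | s ^ 2 * (1 - ∑ i, y i ^ 2) ≤ 1} with hA
  have hAm : MeasurableSet {p : ℝ × (Fin n → ℝ) | 0 < p.1 ∧ p.2 ∈ A p.1} := by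
    refine MeasurableSet.inter (measurableSet_lt measurable_const measurable_fst) ?_
    refine MeasurableSet.inter (measurable_snd hD) ?_
    exact measurableSet_le (by fun_prop) measurable_const
  have hm : MeasurableSet {p : ℝ × (Fin n → ℝ) | 0 < p.1 ∧ p.1⁻¹ • p.2 ∈ D ∧
      p.1 ^ 2 * (1 - ∑ i, (p.1⁻¹ • p.2) i ^ 2) ≤ 1} := by
    have : Measurable fun p : ℝ × (Fin n → ℝ) => (p.1, p.1⁻¹ • p.2) := by fun_prop
    exact this hAm
  rw [Measure.volume_eq_prod, Measure.prod_apply hm]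
  have h1 : ∀ s : ℝ, volume (Prod.mk s ⁻¹' {p : ℝ × (Fin n → ℝ) | 0 < p.1 ∧ p.1⁻¹ • p.2 ∈ D ∧
      p.1 ^ 2 * (1 - ∑ i, (p.1⁻¹ • p.2) i ^ 2) ≤ 1}) =
      ∫⁻ y, {p : ℝ × (Fin n → ℝ) | 0 < p.1 ∧ p.2 ∈ A p.1}.indicator
        (fun p => ENNReal.ofReal (p.1 ^ n)) (s, y) := by
    intro s
    rcases le_or_gt s 0 with hs | hs
    · have e1 : Prod.mk s ⁻¹' {p : ℝ × (Fin n → ℝ) | 0 < p.1 ∧ p.1⁻¹ • p.2 ∈ D ∧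
          p.1 ^ 2 * (1 - ∑ i, (p.1⁻¹ • p.2) i ^ 2) ≤ 1} = ∅ := by
        ext z
        simp [not_lt.2 hs]
      rw [e1]
      simp [indicator, not_lt.2 hs]
    · have e1 : Prod.mk s ⁻¹' {p : ℝ × (Fin n → ℝ) | 0 < p.1 ∧ p.1⁻¹ • p.2 ∈ D ∧
          p.1 ^ 2 * (1 - ∑ i, (p.1⁻¹ • p.2) i ^ 2) ≤ 1} = s • A s := by
        ext z
        rw [mem_smul_set_iff_inv_smul_mem₀ hs.ne']
        simp [hs, hA]
      have e2 : (fun y => {p : ℝ × (Fin n → ℝ) | 0 < p.1 ∧ p.2 ∈ A p.1}.indicator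
          (fun p => ENNReal.ofReal (p.1 ^ n)) (s, y)) =
          (A s).indicator fun _ => ENNReal.ofReal (s ^ n) := by
        ext y
        by_cases hy : y ∈ A s <;> simp [indicator, hs, hy]
      have hAs : MeasurableSet (A s) :=
        hD.inter (measurableSet_le (by fun_prop) measurable_const)
      rw [e1, e2, lintegral_indicator hAs, setLIntegral_const, Measure.addHaar_smul]
      simp [abs_of_pos hs]
  simp_rw [h1]
  rw [lintegral_lintegral_swap, ← lintegral_indicator hD]
  swap
  · exact ((Measurable.indicator (by fun_prop) hAm)).aemeasurable
  congr 1
  ext y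
  by_cases hy : y ∈ D
  · have hq : 0 < 1 - ∑ i, y i ^ 2 := by linarith [hD1 y hy]
    set q := 1 - ∑ i, y i ^ 2 with hqd
    have e3 : (fun s : ℝ => {p : ℝ × (Fin n → ℝ) | 0 < p.1 ∧ p.2 ∈ A p.1}.indicator
          (fun p => ENNReal.ofReal (p.1 ^ n)) (s, y)) =
          (Ioc 0 (√q)⁻¹).indicator fun s => ENNReal.ofReal (s ^ n) := by
      ext s
      have : (0 < s ∧ s ^ 2 * q ≤ 1) ↔ (0 < s ∧ s ≤ (√q)⁻¹) := by
        refine and_congr_right fun hs => ?_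
        rw [← one_div, le_div_iff₀ (Real.sqrt_pos.2 hq), ← abs_of_pos (mul_pos hs
          (Real.sqrt_pos.2 hq)), ← sq_le_one_iff_abs_le_one, mul_pow, Real.sq_sqrt hq.le]
      simp only [indicator, mem_ofPred_eq, hA, mem_inter_iff, hy, true_and, mem_Ioc, ← hqd, this]
    rw [e3, lintegral_indicator measurableSet_Ioc, lintegral_pow_Ioc (by positivity),
      indicator_of_mem hy]
    congr 2
    rw [← Real.rpow_natCast, ← Real.rpow_neg_one, Real.sqrt_eq_rpow, ← Real.rpow_mul hq.le,
      ← Real.rpow_mul hq.le]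
    congr 1
    push_cast
    ring
  · rw [indicator_of_notMem hy]
    have : (fun s : ℝ => {p : ℝ × (Fin n → ℝ) | 0 < p.1 ∧ p.2 ∈ A p.1}.indicator
          (fun p => ENNReal.ofReal (p.1 ^ n)) (s, y)) = fun _ => 0 := by
      ext s
      simp [indicator, hA, hy]
    rw [this]
    simp

/-- The part of the polyhedral cone with outward normals `v` lying under the hyperboloid. -/
def truncCone {ι : Type*} (v : ι → EuclideanSpace ℝ (Fin (n + 1))) :
    Set (EuclideanSpace ℝ (Fin (n + 1))) :=
  {x | 0 < x 0 ∧ (∀ i, mink n (v i) x ≤ 0) ∧ mink n x x < 0 ∧ -1 ≤ mink n x x}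

lemma measurableSet_truncCone {ι : Type*} [Countable ι]
    (v : ι → EuclideanSpace ℝ (Fin (n + 1))) : MeasurableSet (truncCone v) := by
  have h0 : Measurable fun x : EuclideanSpace ℝ (Fin (n + 1)) => x 0 := by fun_prop
  have hs : Measurable fun x => mink n x x := continuous_mink_self.measurable
  have hv : MeasurableSet (⋂ i, {x | mink n (v i) x ≤ 0}) := MeasurableSet.iInter fun i =>
    measurableSet_le (continuous_mink (v i)).measurable measurable_const
  have e : truncCone v = {x | 0 < x 0} ∩ ((⋂ i, {x | mink n (v i) x ≤ 0}) ∩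
      ({x | mink n x x < 0} ∩ {x | -1 ≤ mink n x x})) := by
    ext x
    simp [truncCone]
  rw [e]
  exact (measurableSet_lt measurable_const h0).inter (hv.inter
    ((measurableSet_lt hs measurable_const).inter (measurableSet_le measurable_const hs)))

lemma volume_truncCone {ι : Type*} [Countable ι] {v : ι → EuclideanSpace ℝ (Fin (n + 1))}
    {S : Set ↥(hypSet n)} (hS : S = ⋂ i, hHalf n (v i)) :
    hVol n S = (n + 1) * volume (truncCone v) := by
  set D : Set (Fin n → ℝ) := {y | (∑ i, y i ^ 2 < 1) ∧
    ∀ j, -(v j 0) + ∑ i, v j (Fin.succ i) * y i ≤ 0} with hDdef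
  have hD : MeasurableSet D := by
    have h1 : Measurable fun y : Fin n → ℝ => ∑ i, y i ^ 2 := by fun_prop
    have h2 : ∀ j, Measurable fun y : Fin n → ℝ =>
        -(v j 0) + ∑ i, v j (Fin.succ i) * y i := fun j => by fun_prop
    have h3 : MeasurableSet
        (⋂ j, {y : Fin n → ℝ | -(v j 0) + ∑ i, v j (Fin.succ i) * y i ≤ 0}) :=
      MeasurableSet.iInter fun j => measurableSet_le (h2 j) measurable_const
    have e : D = {y | ∑ i, y i ^ 2 < 1} ∩
        ⋂ j, {y : Fin n → ℝ | -(v j 0) + ∑ i, v j (Fin.succ i) * y i ≤ 0} := by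
      ext y
      simp [hDdef]
    rw [e]
    exact (measurableSet_lt h1 measurable_const).inter h3
  have hmap : MeasurePreserving (fun x : EuclideanSpace ℝ (Fin (n + 1)) =>
      MeasurableEquiv.piFinSuccAbove (fun _ => ℝ) 0 (WithLp.ofLp x)) volume volume :=
    (volume_preserving_piFinSuccAbove (fun _ => ℝ) 0).comp (PiLp.volume_preserving_ofLp _)
  set B := {p : ℝ × (Fin n → ℝ) | 0 < p.1 ∧ p.1⁻¹ • p.2 ∈ D ∧
      p.1 ^ 2 * (1 - ∑ i, (p.1⁻¹ • p.2) i ^ 2) ≤ 1} with hB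
  have hBm : MeasurableSet B := by
    have h2 : Measurable fun p : ℝ × (Fin n → ℝ) => p.1⁻¹ • p.2 := by fun_prop
    have h3 : Measurable fun p : ℝ × (Fin n → ℝ) =>
      p.1 ^ 2 * (1 - ∑ i, (p.1⁻¹ • p.2) i ^ 2) := by fun_prop
    exact (measurableSet_lt measurable_const measurable_fst).inter
      ((h2 hD).inter (measurableSet_le h3 measurable_const))
  have hpre : truncCone v = (fun x : EuclideanSpace ℝ (Fin (n + 1)) =>
      MeasurableEquiv.piFinSuccAbove (fun _ => ℝ) 0 (WithLp.ofLp x)) ⁻¹' B := by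
    ext x
    have hx1 : MeasurableEquiv.piFinSuccAbove (fun _ => ℝ) 0 (WithLp.ofLp x) =
      ((x 0, fun i => x (Fin.succ i)) : ℝ × (Fin n → ℝ)) := rfl
    simp only [truncCone, mem_preimage, hx1, hB, mem_ofPred_eq, hDdef]
    refine and_congr_right fun hx0 => ?_
    have e1 : ∑ i : Fin n, ((x 0)⁻¹ • fun i : Fin n => x (Fin.succ i)) i ^ 2 =
        (x 0)⁻¹ ^ 2 * ∑ i : Fin n, x i.succ * x i.succ := by
      rw [Finset.mul_sum]
      exact Finset.sum_congr rfl fun i _ => by simp; ring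
    have e2 : ∀ j, -(v j 0) + ∑ i, v j (Fin.succ i) *
        ((x 0)⁻¹ • fun i : Fin n => x (Fin.succ i)) i = (x 0)⁻¹ * mink n (v j) x := by
      intro j
      rw [mink, mul_add, Finset.mul_sum]
      congr 1
      · field_simp
      · exact Finset.sum_congr rfl fun i _ => by simp; ring
    have e3 : mink n x x = (x 0) ^ 2 * ((x 0)⁻¹ ^ 2 * (∑ i : Fin n, x i.succ * x i.succ) - 1) := by
      rw [mink]; field_simp; ring
    simp only [e1, e2]
    have hinv : 0 < (x 0)⁻¹ := inv_pos.2 hx0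
    have a1 : (∀ j, (x 0)⁻¹ * mink n (v j) x ≤ 0) ↔ ∀ j, mink n (v j) x ≤ 0 :=
      forall_congr' fun j => by
        exact ⟨fun h => by by_contra hc; push Not at hc; nlinarith [mul_pos hinv hc],
          fun h => mul_nonpos_of_nonneg_of_nonpos hinv.le h⟩
    rw [a1, e3]
    have hx2 : 0 < (x 0) ^ 2 := by positivity
    constructor
    · rintro ⟨h1, h2, h3⟩
      refine ⟨⟨?_, h1⟩, by linarith⟩
      by_contra hc
      push Not at hc
      nlinarith
    · rintro ⟨⟨h2, h1⟩, h3⟩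
      exact ⟨h1, mul_neg_of_pos_of_neg hx2 (by linarith), by linarith⟩
  have hkl : klein n '' S = D := by
    subst hS
    ext y
    constructor
    · rintro ⟨x, hx, rfl⟩
      have hx0 : 0 < x.val 0 := x.2.2
      rw [mem_iInter_hHalf] at hx
      refine ⟨?_, fun j => ?_⟩
      · have h1 := x.2.1
        rw [mink] at h1
        have : ∑ i, klein n x i ^ 2 = (∑ i : Fin n, x.val i.succ * x.val i.succ) / x.val 0 ^ 2 := by
          rw [Finset.sum_div]
          exact Finset.sum_congr rfl fun i _ => by simp only [klein]; ring
        rw [this, div_lt_one (by positivity)]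
        nlinarith
      · have h1 := hx j
        have : -(v j 0) + ∑ i, v j (Fin.succ i) * klein n x i =
            (x.val 0)⁻¹ * mink n (v j) x.val := by
          rw [mink, mul_add, Finset.mul_sum]
          congr 1
          · field_simp
          · exact Finset.sum_congr rfl fun i _ => by simp only [klein]; ring
        rw [this]
        exact mul_nonpos_of_nonneg_of_nonpos (inv_pos.2 hx0).le h1
    · rintro ⟨h1, h2⟩
      set x : EuclideanSpace ℝ (Fin (n + 1)) := WithLp.toLp 2 (Fin.cons 1 y) with hx
      have hx0 : x 0 = 1 := rfl
      have hxs : ∀ i : Fin n, x i.succ = y i := fun i => rfl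
      have hf : Fut x := by
        refine ⟨?_, by rw [hx0]; norm_num⟩
        rw [mink, hx0]
        simp only [hxs, ← sq]
        linarith
      obtain ⟨p, hp, c, hc, hpc⟩ := forall_mem_of_scale (v := v) hf (fun j => by
        rw [mink, hx0]
        simp only [hxs]
        linarith [h2 j])
      refine ⟨p, hp, ?_⟩
      ext i
      simp only [klein, hpc, PiLp.smul_apply, hx0, hxs, smul_eq_mul]
      field_simp
  rw [hVol, hkl, hpre, hmap.measure_preimage hBm.nullMeasurableSet, hB,
    volume_cone_prod hD fun y hy => hy.1, ← lintegral_const_mul' _ _ (by finiteness)]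
  congr 1
  ext y
  rw [show ((n : ℝ≥0∞) + 1) = ENNReal.ofReal (n + 1) by
    rw [ENNReal.ofReal_add (by positivity) (by norm_num)]; simp,
    ← ENNReal.ofReal_mul (by positivity)]
  congr 1
  field_simp

end Volume

section Volume

variable {n : ℕ}

lemma Lorentz.abs_det {L : EuclideanSpace ℝ (Fin (n + 1)) →ₗ[ℝ] EuclideanSpace ℝ (Fin (n + 1))}
    (hL : Lorentz L) : |LinearMap.det L| = 1 := by
  have hsep : (minkB n).SeparatingLeft := fun x hx => eq_zero_of_mink_eq_zero fun y => hx y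
  let b := Module.finBasis ℝ (EuclideanSpace ℝ (Fin (n + 1)))
  have hdet := (LinearMap.separatingLeft_iff_det_ne_zero b).1 hsep
  have hc : (minkB n).compl₁₂ L L = minkB n := by
    ext x y
    exact hL x y
  have h := congrArg Matrix.det (LinearMap.toMatrix₂_compl₁₂ b b b b (minkB n) L L)
  rw [hc, Matrix.det_mul, Matrix.det_mul, Matrix.det_transpose, LinearMap.det_toMatrix] at h
  have h2 : LinearMap.det L ^ 2 = 1 := by
    refine mul_right_cancel₀ hdet ?_
    linear_combination -h
  have h3 := sq_abs (LinearMap.det L)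
  rw [h2] at h3
  have h4 : (|LinearMap.det L| - 1) * (|LinearMap.det L| + 1) = 0 := by linear_combination h3
  rcases mul_eq_zero.1 h4 with h5 | h5
  · linarith
  · linarith [abs_nonneg (LinearMap.det L)]

lemma mem_truncCone {ι : Type*} {v : ι → EuclideanSpace ℝ (Fin (n + 1))}
    {x : EuclideanSpace ℝ (Fin (n + 1))} :
    x ∈ truncCone v ↔ Fut x ∧ (∀ i, mink n (v i) x ≤ 0) ∧ -1 ≤ mink n x x :=
  ⟨fun h => ⟨⟨h.2.2.1, h.1⟩, h.2.1, h.2.2.2⟩, fun h => ⟨h.1.2, h.2.1, h.1.1, h.2.2⟩⟩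

lemma hVol_image {ι : Type*} [Countable ι] {v : ι → EuclideanSpace ℝ (Fin (n + 1))}
    {S : Set ↥(hypSet n)} (hS : S = ⋂ i, hHalf n (v i)) {g : ↥(hypSet n) → ↥(hypSet n)}
    (hg : hIsIsom n g) : hVol n (g '' S) = hVol n S := by
  obtain ⟨L, hL, hgL⟩ := exists_lorentz hg
  have hgS : g '' S = ⋂ i, hHalf n (L (v i)) := by rw [hS, image_iInter_hHalf hg hL hgL]
  have hcone : truncCone (fun i => L (v i)) = L '' truncCone v := by
    ext y
    constructor
    · intro hy
      rw [mem_truncCone] at hy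
      obtain ⟨p, c, hc, hp⟩ := exists_hyp y hy.1
      obtain ⟨q, rfl⟩ := hg.1.2 p
      have hyq : y = L (c⁻¹ • q.val) := by
        rw [map_smul, ← hgL, hp, smul_smul, inv_mul_cancel₀ hc.ne', one_smul]
      refine ⟨c⁻¹ • q.val, mem_truncCone.2 ⟨(fut_of_mem q).smul (inv_pos.2 hc), fun i => ?_, ?_⟩,
        hyq.symm⟩
      · rw [← hL, ← hyq]; exact hy.2.1 i
      · rw [← hL, ← hyq]; exact hy.2.2
    · rintro ⟨x, hx, rfl⟩
      rw [mem_truncCone] at hx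
      obtain ⟨p, c, hc, hp⟩ := exists_hyp x hx.1
      have hyq : L x = c⁻¹ • (g p).val := by
        rw [hgL, hp, map_smul, smul_smul, inv_mul_cancel₀ hc.ne', one_smul]
      refine mem_truncCone.2 ⟨?_, fun i => ?_, ?_⟩
      · rw [hyq]; exact (fut_of_mem (g p)).smul (inv_pos.2 hc)
      · rw [hL]; exact hx.2.1 i
      · rw [hL]; exact hx.2.2
  rw [volume_truncCone hgS, volume_truncCone hS, hcone, Measure.addHaar_image_linearMap,
    hL.abs_det]
  simp

lemma volume_mink_eq_zero {u : EuclideanSpace ℝ (Fin (n + 1))} (hu : mink n u u = 1) :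
    volume {x | mink n u x = 0} = 0 := by
  refine Measure.addHaar_submodule volume (LinearMap.ker (minkB n u)) fun h => ?_
  have : u ∈ LinearMap.ker (minkB n u) := by rw [h]; trivial
  rw [LinearMap.mem_ker, minkB_apply, hu] at this
  exact one_ne_zero this

lemma exists_strict_truncCone {k : ℕ} {v : Fin k → EuclideanSpace ℝ (Fin (n + 1))}
    (hu : ∀ i, mink n (v i) (v i) = 1) {T : Set ↥(hypSet n)} (hT : T = ⋂ i, hHalf n (v i)) :
    ∃ U : Set (EuclideanSpace ℝ (Fin (n + 1))), MeasurableSet U ∧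
      hVol n T = (n + 1) * volume U ∧
      ∀ x ∈ U, Fut x ∧ -1 ≤ mink n x x ∧
        ∃ p ∈ interior T, ∃ c : ℝ, 0 < c ∧ p.val = c • x := by
  have hm : MeasurableSet (⋂ i, {x | mink n (v i) x < 0}) := MeasurableSet.iInter fun i =>
    measurableSet_lt (continuous_mink (v i)).measurable measurable_const
  refine ⟨truncCone v ∩ ⋂ i, {x | mink n (v i) x < 0}, (measurableSet_truncCone v).inter hm,
    ?_, fun x hx => ?_⟩
  · rw [volume_truncCone hT]
    congr 1
    refine le_antisymm ?_ (measure_mono inter_subset_left)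
    have hz : volume (⋃ i, {x | mink n (v i) x = 0}) = 0 :=
      measure_iUnion_null fun i => volume_mink_eq_zero (hu i)
    refine (measure_mono (t := (truncCone v ∩ ⋂ i, {x | mink n (v i) x < 0}) ∪
      ⋃ i, {x | mink n (v i) x = 0}) fun x hx => ?_).trans
      ((measure_union_le _ _).trans (by rw [hz, add_zero]))
    by_cases h : ∃ i, mink n (v i) x = 0
    · exact Or.inr (mem_iUnion.2 h)
    · push Not at h
      exact Or.inl ⟨hx, mem_iInter.2 fun i => lt_of_le_of_ne ((mem_truncCone.1 hx).2.1 i) (h i)⟩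
  · obtain ⟨hx1, hx2⟩ := hx
    rw [mem_truncCone] at hx1
    rw [mem_iInter] at hx2
    refine ⟨hx1.1, hx1.2.2, ?_⟩
    obtain ⟨p, c, hc, hp⟩ := exists_hyp x hx1.1
    refine ⟨p, ?_, c, hc, hp⟩
    have hop : IsOpen (⋂ i, {q : ↥(hypSet n) | mink n (v i) q.val < 0}) :=
      isOpen_iInter_of_finite fun i =>
        isOpen_lt ((continuous_mink (v i)).comp continuous_subtype_val) continuous_const
    refine interior_maximal (t := ⋂ i, {q : ↥(hypSet n) | mink n (v i) q.val < 0}) ?_ hop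
      (mem_iInter.2 fun i => ?_)
    · rw [hT]
      exact iInter_mono fun i q (hq : mink n (v i) q.val < 0) =>
        (show mink n (v i) q.val ≤ 0 from hq.le)
    · change mink n (v i) p.val < 0
      rw [hp, mink_smul_right]
      exact mul_neg_of_pos_of_neg hc (hx2 i)

lemma eq_of_smul_eq {p q : ↥(hypSet n)} {x : EuclideanSpace ℝ (Fin (n + 1))} {c d : ℝ}
    (hc : 0 < c) (hd : 0 < d) (hp : p.val = c • x) (hq : q.val = d • x) : p = q := by
  have h1 := p.2.1
  have h2 := q.2.1
  rw [hp, mink_smul_left, mink_smul_right] at h1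
  rw [hq, mink_smul_left, mink_smul_right] at h2
  have h3 : (c - d) * (c + d) * mink n x x = 0 := by linear_combination h1 - h2
  have h4 : mink n x x ≠ 0 := by rintro h; rw [h] at h1; norm_num at h1
  have h5 : c + d ≠ 0 := by positivity
  have h6 : c = d := by
    have := (mul_eq_zero.1 ((mul_eq_zero.1 h3).resolve_right h4)).resolve_right h5
    linarith
  exact Subtype.ext (by rw [hp, hq, h6])

theorem ncard_mul_hVol_le {κ : Type*} [Countable κ] {u : κ → EuclideanSpace ℝ (Fin (n + 1))}
    {P : Set ↥(hypSet n)} (hP : P = ⋂ i, hHalf n (u i)) {𝒯 : Set (Set ↥(hypSet n))}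
    (hfin : 𝒯.Finite) {c : ℝ≥0∞} {k : ℕ}
    (hT : ∀ T ∈ 𝒯, ∃ v : Fin k → EuclideanSpace ℝ (Fin (n + 1)),
      (∀ i, mink n (v i) (v i) = 1) ∧ T = ⋂ i, hHalf n (v i))
    (hc : ∀ T ∈ 𝒯, hVol n T = c) (hsub : ∀ T ∈ 𝒯, T ⊆ P)
    (hdisj : ∀ T₁ ∈ 𝒯, ∀ T₂ ∈ 𝒯, T₁ ≠ T₂ → interior T₁ ∩ interior T₂ = ∅) :
    𝒯.ncard * c ≤ hVol n P := by
  have key : ∀ T ∈ 𝒯, ∃ U : Set (EuclideanSpace ℝ (Fin (n + 1))), MeasurableSet U ∧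
      hVol n T = (n + 1) * volume U ∧
      ∀ x ∈ U, Fut x ∧ -1 ≤ mink n x x ∧
        ∃ p ∈ interior T, ∃ c : ℝ, 0 < c ∧ p.val = c • x := fun T h => by
    obtain ⟨v, hv, hTv⟩ := hT T h
    exact exists_strict_truncCone hv hTv
  choose! U hUm hUv hU using key
  have hmem : ∀ T, T ∈ hfin.toFinset → T ∈ 𝒯 := fun T h => hfin.mem_toFinset.1 h
  have hd : (hfin.toFinset : Set (Set ↥(hypSet n))).PairwiseDisjoint U := by
    intro T₁ h₁ T₂ h₂ hne
    rw [Function.onFun, Set.disjoint_left]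
    intro x hx₁ hx₂
    obtain ⟨-, -, p, hp, a, ha, hpa⟩ := hU T₁ (hmem _ h₁) x hx₁
    obtain ⟨-, -, q, hq, b, hb, hqb⟩ := hU T₂ (hmem _ h₂) x hx₂
    have := eq_of_smul_eq ha hb hpa hqb
    subst this
    have h := hdisj T₁ (hmem _ h₁) T₂ (hmem _ h₂) hne
    exact (h ▸ (⟨hp, hq⟩ : p ∈ interior T₁ ∩ interior T₂) : p ∈ (∅ : Set ↥(hypSet n)))
  have hle : ∑ T ∈ hfin.toFinset, volume (U T) ≤ volume (truncCone u) := by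
    rw [← measure_biUnion_finset hd fun T h => hUm T (hmem T h)]
    refine measure_mono (iUnion₂_subset fun T h x hx => ?_)
    obtain ⟨hf, hx1, p, hp, a, ha, hpa⟩ := hU T (hmem T h) x hx
    have hpP := hsub T (hmem T h) (interior_subset hp)
    rw [hP, mem_iInter_hHalf] at hpP
    refine mem_truncCone.2 ⟨hf, fun i => ?_, hx1⟩
    have := hpP i
    rw [hpa, mink_smul_right] at this
    by_contra hcon
    push Not at hcon
    nlinarith [mul_pos ha hcon]
  calc (𝒯.ncard : ℝ≥0∞) * c = ∑ T ∈ hfin.toFinset, hVol n T := by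
        rw [Finset.sum_congr rfl fun T h => hc T (hmem T h), Finset.sum_const,
          ncard_eq_toFinset_card _ hfin, nsmul_eq_mul]
    _ = (n + 1) * ∑ T ∈ hfin.toFinset, volume (U T) := by
        rw [Finset.mul_sum]
        exact Finset.sum_congr rfl fun T h => hUv T (hmem T h)
    _ ≤ (n + 1) * volume (truncCone u) := by gcongr
    _ = hVol n P := (volume_truncCone hP).symm

end Volume

/-! ### Simplicial cones tiling an orthant -/

section Orthant

open Filter Topology

lemma eventually_pow_sum_ne_zero {m : ℕ} (k : ℝ) (w : Fin m → ℝ) {c₀ : Fin m} (hw : w c₀ ≠ 0) :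
    ∀ᶠ s in 𝓝[>] (0 : ℝ), k + ∑ c, w c * s ^ ((c : ℕ) + 1) ≠ 0 := by
  set p : Polynomial ℝ := Polynomial.C k + ∑ c, Polynomial.C (w c) * Polynomial.X ^ ((c : ℕ) + 1)
    with hp
  have hp0 : p ≠ 0 := by
    intro h
    have h1 : p.coeff ((c₀ : ℕ) + 1) = w c₀ := by
      rw [hp, Polynomial.coeff_add, Polynomial.finsetSum_coeff, Polynomial.coeff_C,
        if_neg (Nat.succ_ne_zero _), zero_add, Finset.sum_eq_single c₀]
      · simp
      · intro b _ hb
        have : (c₀ : ℕ) ≠ b := fun h => hb (Fin.ext h.symm)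
        simp [Polynomial.coeff_X_pow, this]
      · simp
    rw [h, Polynomial.coeff_zero] at h1
    exact hw h1.symm
  have hcl : IsOpen ((p.rootSet ℝ \ {0})ᶜ) :=
    ((Polynomial.rootSet_finite p ℝ).subset sdiff_subset).isClosed.isOpen_compl
  have h0 : (p.rootSet ℝ \ {0})ᶜ ∈ 𝓝 (0 : ℝ) := hcl.mem_nhds (by simp)
  filter_upwards [mem_nhdsWithin_of_mem_nhds h0, self_mem_nhdsWithin] with s hs hs0 hz
  refine hs ⟨?_, (ne_of_gt hs0 : s ≠ 0)⟩
  rw [Polynomial.mem_rootSet_of_ne hp0]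
  simpa [hp, Polynomial.eval_finsetSum] using hz

variable {m : ℕ} {A : Matrix (Fin m) (Fin m) ℝ}

/-- The row space of `A` has a row proportional to the coordinate function of index `a`. -/
def HasCoord (A : Matrix (Fin m) (Fin m) ℝ) (a : Fin m) : Prop :=
  ∃ j, A j a ≠ 0 ∧ ∀ c, c ≠ a → A j c = 0

/-- A curve leaving `y` into the generic part of the coordinate subspace `y a = y b = 0`. -/
def genCurve (y : Fin m → ℝ) (a b : Fin m) (s : ℝ) : Fin m → ℝ :=
  fun c => y c + if c = a ∨ c = b then 0 else s ^ ((c : ℕ) + 1)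

lemma mulVec_genCurve (y : Fin m → ℝ) (a b : Fin m) (s : ℝ) (j : Fin m) :
    A.mulVec (genCurve y a b s) j =
      A.mulVec y j + ∑ c, (if c = a ∨ c = b then 0 else A j c) * s ^ ((c : ℕ) + 1) := by
  simp only [Matrix.mulVec, dotProduct, genCurve, mul_add, Finset.sum_add_distrib]
  congr 1
  refine Finset.sum_congr rfl fun c _ => ?_
  split_ifs <;> simp

lemma genCurve_comm (y : Fin m → ℝ) (a b : Fin m) (s : ℝ) :
    genCurve y a b s = genCurve y b a s := by
  ext c
  simp only [genCurve, or_comm]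

lemma mulVec_sub_single (y : Fin m → ℝ) (a : Fin m) (e : ℝ) (j : Fin m) :
    A.mulVec (y - Pi.single a e) j = A.mulVec y j - A j a * e := by
  rw [Matrix.mulVec_sub, Pi.sub_apply]
  simp [Matrix.mulVec_single]

lemma hasCoord_of_frequently (hpos : ∀ y, (∀ j, 0 ≤ A.mulVec y j) → ∀ a, 0 ≤ y a)
    (htwo : ∀ j a b, a ≠ b → A j a ≠ 0 → A j b ≠ 0 → ∃ c, c ≠ a ∧ c ≠ b ∧ A j c ≠ 0)
    {y : Fin m → ℝ} {a b : Fin m} (hya : y a = 0)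
    (hf : ∃ᶠ s in 𝓝[>] (0 : ℝ), ∀ j, 0 ≤ A.mulVec (genCurve y a b s) j) : HasCoord A a := by
  by_contra hno
  have hev : ∀ᶠ s in 𝓝[>] (0 : ℝ), ∀ j, (∃ c, c ≠ a ∧ c ≠ b ∧ A j c ≠ 0) →
      A.mulVec (genCurve y a b s) j ≠ 0 := by
    rw [eventually_all]
    intro j
    by_cases h : ∃ c, c ≠ a ∧ c ≠ b ∧ A j c ≠ 0
    · obtain ⟨c, hca, hcb, hc⟩ := h
      have := eventually_pow_sum_ne_zero (A.mulVec y j)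
        (fun c => if c = a ∨ c = b then 0 else A j c) (c₀ := c) (by simpa [hca, hcb] using hc)
      filter_upwards [this] with s hs _
      rwa [mulVec_genCurve]
    · exact Eventually.of_forall fun s h1 => absurd h1 h
  obtain ⟨s, hs, hne⟩ := (hf.and_eventually hev).exists
  set x := genCurve y a b s with hx
  have hxa : x a = 0 := by simp [hx, genCurve, hya]
  have hcase : ∀ j, 0 < A.mulVec x j ∨ A j a = 0 := by
    intro j
    by_cases hja : A j a = 0
    · exact Or.inr hja
    refine Or.inl (lt_of_le_of_ne (hs j) (Ne.symm (hne j ?_)))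
    by_contra hcon
    push Not at hcon
    by_cases hab : a = b
    · refine hno ⟨j, hja, fun c hc => hcon c hc (hab ▸ hc)⟩
    by_cases hjb : A j b = 0
    · refine hno ⟨j, hja, fun c hc => ?_⟩
      by_cases hcb : c = b
      · rw [hcb, hjb]
      · exact hcon c hc hcb
    · obtain ⟨c, h1, h2, h3⟩ := htwo j a b hab hja hjb
      exact h3 (hcon c h1 h2)
  have hsmall : ∀ᶠ e in 𝓝[>] (0 : ℝ), ∀ j, 0 ≤ A.mulVec (x - Pi.single a e) j := by
    rw [eventually_all]
    intro j
    simp only [mulVec_sub_single]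
    rcases hcase j with h | h
    · have ht : Tendsto (fun e : ℝ => A.mulVec x j - A j a * e) (𝓝 0) (𝓝 (A.mulVec x j)) := by
        have : Continuous fun e : ℝ => A.mulVec x j - A j a * e := by fun_prop
        simpa using this.tendsto 0
      filter_upwards [mem_nhdsWithin_of_mem_nhds (ht.eventually (lt_mem_nhds h))] with e he
      exact he.le
    · refine Eventually.of_forall fun e => ?_
      rw [h]
      simpa using hs j
  obtain ⟨e, he, he0⟩ := (hsmall.and self_mem_nhdsWithin).exists
  have := hpos _ he a
  rw [Pi.sub_apply, hxa, Pi.single_eq_same] at this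
  linarith [show (0 : ℝ) < e from he0]

lemma tendsto_mulVec_genCurve (y : Fin m → ℝ) (a b j : Fin m) :
    Tendsto (fun s => A.mulVec (genCurve y a b s) j) (𝓝[>] 0) (𝓝 (A.mulVec y j)) := by
  have hc : Continuous fun s : ℝ => A.mulVec y j +
      ∑ c, (if c = a ∨ c = b then 0 else A j c) * s ^ ((c : ℕ) + 1) := by fun_prop
  have h := (hc.tendsto 0).mono_left (nhdsWithin_le_nhds (s := Ioi 0))
  simp only [mulVec_genCurve]
  simpa using h

lemma genCurve_nonneg {y : Fin m → ℝ} (hy : ∀ c, 0 ≤ y c) (a b : Fin m) {s : ℝ} (hs : 0 < s)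
    (c : Fin m) : 0 ≤ genCurve y a b s c := by
  unfold genCurve
  have := hy c
  split_ifs <;> positivity

/-- The cones `A t *ᵥ y ≥ 0` tile the closed orthant, and no facet of a cone spans a hyperplane
through a codimension two face of the orthant other than a coordinate hyperplane. -/
structure OrthantTiling (A : Fin 3 → Matrix (Fin m) (Fin m) ℝ) : Prop where
  cover : ∀ y : Fin m → ℝ, (∀ a, 0 ≤ y a) → ∃ t, ∀ j, 0 ≤ (A t).mulVec y j
  pos : ∀ t y, (∀ j, 0 ≤ (A t).mulVec y j) → ∀ a, 0 ≤ y a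
  disj : ∀ t t' y, (∀ j, 0 < (A t).mulVec y j) → (∀ j, 0 < (A t').mulVec y j) → A t = A t'
  two : ∀ t j a b, a ≠ b → A t j a ≠ 0 → A t j b ≠ 0 → ∃ c, c ≠ a ∧ c ≠ b ∧ A t j c ≠ 0
  inter : ∀ t, ∃ y, ∀ j, 0 < (A t).mulVec y j

namespace OrthantTiling

variable {A : Fin 3 → Matrix (Fin m) (Fin m) ℝ} (hA : OrthantTiling A)
include hA

lemma row_pos {t : Fin 3} {j a : Fin m} (h : ∀ c, c ≠ a → A t j c = 0) :
    0 < A t j a := by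
  obtain ⟨y, hy⟩ := hA.inter t
  have h1 := hy j
  have h2 := hA.pos t y (fun j => (hy j).le) a
  have h3 : (A t).mulVec y j = A t j a * y a := by
    rw [Matrix.mulVec, dotProduct, Finset.sum_eq_single a]
    · intro c _ hc; rw [h c hc, zero_mul]
    · simp
  rw [h3] at h1
  by_contra hc
  nlinarith

lemma exists_hasCoord {y : Fin m → ℝ} (hy : ∀ c, 0 ≤ y c) {a b : Fin m} (ha : y a = 0)
    (hb : y b = 0) :
    ∃ t, (∀ j, 0 ≤ (A t).mulVec y j) ∧ HasCoord (A t) a ∧ HasCoord (A t) b := by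
  have hfr : ∃ t, ∃ᶠ s in 𝓝[>] (0 : ℝ), ∀ j, 0 ≤ (A t).mulVec (genCurve y a b s) j := by
    by_contra hcon
    rw [not_exists] at hcon
    have hcon' : ∀ᶠ s in 𝓝[>] (0 : ℝ), ∀ t, ¬ ∀ j, 0 ≤ (A t).mulVec (genCurve y a b s) j :=
      eventually_all.2 fun t => not_frequently.1 (hcon t)
    obtain ⟨s, hs, hs0⟩ := (hcon'.and self_mem_nhdsWithin).exists
    obtain ⟨t, ht⟩ := hA.cover _ (genCurve_nonneg hy a b hs0)
    exact hs t ht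
  obtain ⟨t, ht⟩ := hfr
  refine ⟨t, fun j => ?_, hasCoord_of_frequently (hA.pos t) (hA.two t) ha ht,
    hasCoord_of_frequently (hA.pos t) (hA.two t) hb
      (by simpa only [genCurve_comm y a b] using ht)⟩
  exact isClosed_Ici.mem_of_frequently_of_tendsto (ht.mono fun s h => h j)
    (tendsto_mulVec_genCurve y a b j)

lemma hasCoord_of_face {t : Fin 3} {a b : Fin m}
    (h : ∀ y : Fin m → ℝ, (∀ c, 0 ≤ y c) → y a = 0 → y b = 0 → ∀ j, 0 ≤ (A t).mulVec y j) :
    HasCoord (A t) a := by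
  refine hasCoord_of_frequently (y := 0) (b := b) (hA.pos t) (hA.two t) rfl
    (Eventually.frequently ?_)
  filter_upwards [self_mem_nhdsWithin] with s hs
  exact h _ (genCurve_nonneg (fun _ => le_rfl) a b hs) (by simp [genCurve]) (by simp [genCurve])

lemma miss_injective {μ : Fin 3 → Fin m} (hμ : ∀ t, ¬HasCoord (A t) (μ t)) :
    Function.Injective μ := by
  intro i j hij
  by_contra hne
  obtain ⟨l, hl⟩ : ∃ l : Fin 3, ∀ t, t = i ∨ t = j ∨ t = l :=
    (by decide : ∀ i j : Fin 3, i ≠ j → ∃ l : Fin 3, ∀ t, t = i ∨ t = j ∨ t = l) i j hne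
  obtain ⟨t, -, h1, h2⟩ := hA.exists_hasCoord (y := 0) (fun _ => le_rfl) (a := μ i) (b := μ l)
    rfl rfl
  rcases hl t with rfl | rfl | rfl
  · exact hμ _ h1
  · exact hμ _ (hij ▸ h1)
  · exact hμ _ h2

lemma face_subset {μ : Fin 3 → Fin m} (hμ : ∀ t, ¬HasCoord (A t) (μ t)) {i j l : Fin 3}
    (hl : ∀ t, t = i ∨ t = j ∨ t = l) {y : Fin m → ℝ} (hy : ∀ c, 0 ≤ y c) (hi : y (μ i) = 0)
    (hj : y (μ j) = 0) : ∀ k, 0 ≤ (A l).mulVec y k := by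
  obtain ⟨t, ht, h1, h2⟩ := hA.exists_hasCoord hy hi hj
  rcases hl t with rfl | rfl | rfl
  · exact absurd h1 (hμ _)
  · exact absurd h2 (hμ _)
  · exact ht

lemma miss_unique {μ : Fin 3 → Fin m} (hμ : ∀ t, ¬HasCoord (A t) (μ t)) (l : Fin 3) {ν : Fin m}
    (hν : ν ≠ μ l) : HasCoord (A l) ν := by
  by_contra hno
  obtain ⟨i, j, hij, hil, hjl, h⟩ : ∃ i j : Fin 3, i ≠ j ∧ i ≠ l ∧ j ≠ l ∧
      ∀ t, t = i ∨ t = j ∨ t = l :=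
    (by decide : ∀ l : Fin 3, ∃ i j : Fin 3, i ≠ j ∧ i ≠ l ∧ j ≠ l ∧
      ∀ t, t = i ∨ t = j ∨ t = l) l
  have hμ' : ∀ t, ¬HasCoord (A t) (Function.update μ l ν t) := by
    intro t
    by_cases ht : t = l
    · subst ht; simpa using hno
    · rw [Function.update_of_ne ht]; exact hμ t
  have hνi : ν ≠ μ i := by
    rintro rfl
    have := hA.miss_injective hμ' (a₁ := l) (a₂ := i)
      (by rw [Function.update_self, Function.update_of_ne hil])
    exact hil this.symm
  have hp : ∀ t, t = i ∨ t = l ∨ t = j := fun t => by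
    rcases h t with h | h | h <;> simp [h]
  refine hμ j (hA.hasCoord_of_face (b := μ i) fun y hy hyj hyi k => ?_)
  have hdec : y = Function.update y ν 0 + Pi.single ν (y ν) := by
    ext c
    by_cases hc : c = ν
    · subst hc; simp
    · simp [hc]
  rw [hdec, Matrix.mulVec_add, Pi.add_apply]
  refine add_nonneg (hA.face_subset hμ' hp (fun c => ?_) ?_ ?_ k)
    (hA.face_subset hμ hp (fun c => ?_) ?_ ?_ k)
  · by_cases hc : c = ν
    · subst hc; simp
    · simpa [hc] using hy c
  · rw [Function.update_of_ne hil, Function.update_of_ne hνi.symm, hyi]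
  · rw [Function.update_self, Function.update_self]
  · by_cases hc : c = ν
    · subst hc; simpa using hy c
    · simp [hc]
  · simp [hνi.symm]
  · simp [hν.symm]

lemma exists_row {μ : Fin 3 → Fin m} (hμ : ∀ t, ¬HasCoord (A t) (μ t)) (l : Fin 3) :
    ∃ j₀, ∀ j, j = j₀ ∨ ∃ a, a ≠ μ l ∧ 0 < A l j a ∧ ∀ c, c ≠ a → A l j c = 0 := by
  have hex : ∀ a : Fin m, ∃ j, a ≠ μ l → A l j a ≠ 0 ∧ ∀ c, c ≠ a → A l j c = 0 := fun a => by
    by_cases h : a = μ l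
    · exact ⟨a, fun h1 => absurd h h1⟩
    · obtain ⟨j, hj⟩ := hA.miss_unique hμ l h
      exact ⟨j, fun _ => hj⟩
  choose f hf using hex
  have hinj : Set.InjOn f (Finset.univ.erase (μ l) : Finset (Fin m)) := by
    intro a ha b hb hab
    by_contra hne
    have ha' := hf a (by simpa using ha)
    have hb' := hf b (by simpa using hb)
    exact ha'.1 (by rw [hab]; exact hb'.2 a hne)
  have hcard := Finset.card_image_of_injOn hinj
  rw [Finset.card_erase_of_mem (Finset.mem_univ _), Finset.card_univ, Fintype.card_fin] at hcard
  have hc1 : (((Finset.univ.erase (μ l)).image f)ᶜ).card = 1 := by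
    rw [Finset.card_compl, hcard, Fintype.card_fin]
    have := (μ l).isLt
    omega
  obtain ⟨j₀, hj₀⟩ := Finset.card_eq_one.1 hc1
  refine ⟨j₀, fun j => ?_⟩
  by_cases hj : j ∈ (Finset.univ.erase (μ l)).image f
  · obtain ⟨a, ha, rfl⟩ := Finset.mem_image.1 hj
    have ha' : a ≠ μ l := by simpa using ha
    exact Or.inr ⟨a, ha', hA.row_pos (hf a ha').2, (hf a ha').2⟩
  · left
    have := hj₀ ▸ Finset.mem_compl.2 hj
    simpa using this

lemma exists_ineq {μ : Fin 3 → Fin m} (hμ : ∀ t, ¬HasCoord (A t) (μ t)) {i j l : Fin 3}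
    (hij : i ≠ j) (hil : i ≠ l) (hjl : j ≠ l) :
    ∃ p q : ℝ, 0 < p ∧ 0 < q ∧
      (∀ y, (∀ k, 0 ≤ (A l).mulVec y k) → p * y (μ i) + q * y (μ j) ≤ y (μ l)) ∧
      ∀ y, (∀ a, 0 < y a) → p * y (μ i) + q * y (μ j) < y (μ l) →
        ∀ k, 0 < (A l).mulVec y k := by
  have hall : ∀ t, t = i ∨ t = j ∨ t = l := by revert i j l; decide
  have hinj := hA.miss_injective hμ
  obtain ⟨j₀, hj₀⟩ := hA.exists_row hμ l
  have hval : ∀ {k a} (y : Fin m → ℝ), (∀ c, c ≠ a → A l k c = 0) →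
      (A l).mulVec y k = A l k a * y a := fun {k a} y h => by
    rw [Matrix.mulVec, dotProduct, Finset.sum_eq_single a]
    · intro c _ hc; rw [h c hc, zero_mul]
    · simp
  have hmem : ∀ y : Fin m → ℝ, (∀ a, a ≠ μ l → 0 ≤ y a) → 0 ≤ (A l).mulVec y j₀ →
      ∀ k, 0 ≤ (A l).mulVec y k := by
    intro y hy h0 k
    rcases hj₀ k with rfl | ⟨a, ha, hpos, hz⟩
    · exact h0
    · rw [hval y hz]; exact mul_nonneg hpos.le (hy a ha)
  have hsingle : ∀ (a : Fin m) (e : ℝ), (A l).mulVec (Pi.single a e) j₀ = A l j₀ a * e :=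
    fun a e => by simp [Matrix.mulVec_single]
  have hμpos : 0 < A l j₀ (μ l) := by
    by_contra hc
    push Not at hc
    have := hA.pos l (Pi.single (μ l) (-1)) (hmem _ (fun a ha => by simp [ha])
      (by rw [hsingle]; linarith)) (μ l)
    rw [Pi.single_eq_same] at this
    norm_num at this
  have hle : ∀ a, a ≠ μ l → A l j₀ a ≤ 0 := by
    intro a ha
    by_contra hc
    push Not at hc
    have := hA.pos l (Pi.single a (A l j₀ (μ l)) + Pi.single (μ l) (-(A l j₀ a)))
      (hmem _ (fun b hb => by
        by_cases hba : b = a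
        · subst hba; simp [hb, hμpos.le]
        · simp [hb, hba])
        (by rw [Matrix.mulVec_add, Pi.add_apply, hsingle, hsingle]; linarith)) (μ l)
    rw [Pi.add_apply, Pi.single_eq_same, Pi.single_eq_of_ne (Ne.symm ha)] at this
    linarith
  have hzero : ∀ a, a ≠ μ l → a ≠ μ i → a ≠ μ j → A l j₀ a = 0 := by
    intro a h1 h2 h3
    refine le_antisymm (hle a h1) ?_
    have := hA.face_subset hμ hall (y := Pi.single a 1) (fun c => by
      by_cases hc : c = a
      · subst hc; simp
      · simp [hc]) (by simp [h2.symm]) (by simp [h3.symm]) j₀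
    rw [hsingle] at this
    linarith
  have hli : μ i ≠ μ l := fun h => hil (hinj h)
  have hlj : μ j ≠ μ l := fun h => hjl (hinj h)
  have hnij : μ i ≠ μ j := fun h => hij (hinj h)
  have hi0 : A l j₀ (μ i) ≠ 0 := by
    intro h
    by_cases hj : A l j₀ (μ j) = 0
    · refine hμ l ⟨j₀, hμpos.ne', fun c hc => ?_⟩
      by_cases hci : c = μ i
      · rw [hci, h]
      by_cases hcj : c = μ j
      · rw [hcj, hj]
      exact hzero c hc hci hcj
    · obtain ⟨c, h1, h2, h3⟩ := hA.two l j₀ (μ l) (μ j) hlj.symm hμpos.ne' hj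
      exact h3 (hzero c h1 (fun hci => h3 (by rw [hci, h])) h2)
  have hj0 : A l j₀ (μ j) ≠ 0 := by
    intro h
    obtain ⟨c, h1, h2, h3⟩ := hA.two l j₀ (μ l) (μ i) hli.symm hμpos.ne' hi0
    exact h3 (hzero c h1 h2 fun hcj => h3 (by rw [hcj, h]))
  have hin := lt_of_le_of_ne (hle _ hli) hi0
  have hjn := lt_of_le_of_ne (hle _ hlj) hj0
  have hrow : ∀ y : Fin m → ℝ, (A l).mulVec y j₀ =
      A l j₀ (μ l) * y (μ l) + A l j₀ (μ i) * y (μ i) + A l j₀ (μ j) * y (μ j) := by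
    intro y
    have hsub : ({μ l, μ i, μ j} : Finset (Fin m)) ⊆ Finset.univ := Finset.subset_univ _
    rw [Matrix.mulVec, dotProduct, ← Finset.sum_subset hsub]
    · rw [Finset.sum_insert (by simp [hli.symm, hlj.symm]), Finset.sum_insert (by simp [hnij]),
        Finset.sum_singleton]
      ring
    · intro c _ hc
      simp only [Finset.mem_insert, Finset.mem_singleton, not_or] at hc
      rw [hzero c hc.1 hc.2.1 hc.2.2, zero_mul]
  have hfac : ∀ y : Fin m → ℝ, (A l).mulVec y j₀ = A l j₀ (μ l) * (y (μ l) -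
      (-(A l j₀ (μ i)) / A l j₀ (μ l) * y (μ i) + -(A l j₀ (μ j)) / A l j₀ (μ l) * y (μ j))) := by
    intro y
    rw [hrow]
    field_simp
    ring
  refine ⟨-(A l j₀ (μ i)) / A l j₀ (μ l), -(A l j₀ (μ j)) / A l j₀ (μ l),
    div_pos (neg_pos.2 hin) hμpos, div_pos (neg_pos.2 hjn) hμpos, fun y hy => ?_,
    fun y hy h k => ?_⟩
  · have h1 := hy j₀
    rw [hfac] at h1
    have := nonneg_of_mul_nonneg_right h1 hμpos
    linarith
  · rcases hj₀ k with rfl | ⟨a, ha, hpos, hz⟩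
    · rw [hfac]
      exact mul_pos hμpos (by linarith)
    · rw [hval y hz]
      exact mul_pos hpos (hy a)

theorem exists_forall_hasCoord : ∃ t, ∀ a, HasCoord (A t) a := by
  by_contra hcon
  push Not at hcon
  choose μ hμ using hcon
  have hinj := hA.miss_injective hμ
  obtain ⟨d₁, d₂, hd₁, hd₂, hd, hd'⟩ := hA.exists_ineq hμ (i := 1) (j := 2) (l := 0)
    (by decide) (by decide) (by decide)
  obtain ⟨g₀, g₂, hg₀, hg₂, hg, hg'⟩ := hA.exists_ineq hμ (i := 0) (j := 2) (l := 1)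
    (by decide) (by decide) (by decide)
  obtain ⟨f₀, f₁, hf₀, hf₁, hf, -⟩ := hA.exists_ineq hμ (i := 0) (j := 1) (l := 2)
    (by decide) (by decide) (by decide)
  have h01 : μ 0 ≠ μ 1 := fun h => absurd (hinj h) (by decide)
  have h02 : μ 0 ≠ μ 2 := fun h => absurd (hinj h) (by decide)
  have h12 : μ 1 ≠ μ 2 := fun h => absurd (hinj h) (by decide)
  have hpt : ∀ x₀ x₁ x₂ : ℝ, 0 < x₀ → 0 < x₁ → 0 < x₂ → ∃ y : Fin m → ℝ, (∀ a, 0 < y a) ∧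
      y (μ 0) = x₀ ∧ y (μ 1) = x₁ ∧ y (μ 2) = x₂ := by
    intro x₀ x₁ x₂ h0 h1 h2
    refine ⟨fun a => if a = μ 0 then x₀ else if a = μ 1 then x₁ else if a = μ 2 then x₂ else 1,
      fun a => ?_, by simp, by simp [h01.symm], by simp [h02.symm, h12.symm]⟩
    dsimp only
    split_ifs <;> first | assumption | norm_num
  rcases lt_or_ge (d₁ * g₀) 1 with hlt | hge
  · have hx : d₁ < g₀⁻¹ := by rwa [← one_div, lt_div_iff₀ hg₀]
    obtain ⟨x₀, hx1, hx2⟩ := exists_between hx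
    have hx3 : g₀ * x₀ < 1 := by
      rw [← one_div, lt_div_iff₀ hg₀] at hx2; linarith
    obtain ⟨e, he0, he⟩ : ∃ e : ℝ, 0 < e ∧ e < min ((x₀ - d₁) / d₂) ((1 - g₀ * x₀) / g₂) :=
      exists_between (lt_min (div_pos (by linarith) hd₂) (div_pos (by linarith) hg₂))
    rw [lt_min_iff, lt_div_iff₀ hd₂, lt_div_iff₀ hg₂] at he
    obtain ⟨y, hy, y0, y1, y2⟩ := hpt x₀ 1 e (by linarith) one_pos he0
    have heq := hA.disj 0 1 y (hd' y hy (by rw [y0, y1, y2]; linarith))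
      (hg' y hy (by rw [y0, y1, y2]; linarith))
    exact hμ 1 (heq ▸ hA.miss_unique hμ 0 h01.symm)
  · obtain ⟨y, hy, y0, y1, y2⟩ := hpt d₁ 1 (f₁ / 2) hd₁ one_pos (by positivity)
    obtain ⟨t, ht⟩ := hA.cover y fun a => (hy a).le
    have h1 : t = 0 ∨ t = 1 ∨ t = 2 :=
      (by decide : ∀ t : Fin 3, t = 0 ∨ t = 1 ∨ t = 2) t
    rcases h1 with rfl | rfl | rfl
    · have := hd y ht
      rw [y0, y1, y2] at this
      nlinarith
    · have := hg y ht
      rw [y0, y1, y2] at this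
      nlinarith
    · have := hf y ht
      rw [y0, y1, y2] at this
      nlinarith

end OrthantTiling

end Orthant

/-! ### The simplex with a diagram of type `L̄₅` -/

section Star

lemma cos_pi_div_eq_zero_or_half_le {m : ℕ} (hm : 2 ≤ m) :
    Real.cos (Real.pi / m) = 0 ∨ 1 / 2 ≤ Real.cos (Real.pi / m) := by
  rcases hm.eq_or_lt with rfl | h3
  · left
    simp
  · right
    rw [← Real.cos_pi_div_three]
    have hm3 : (3 : ℝ) ≤ m := by exact_mod_cast h3
    have hpi := Real.pi_pos
    refine Real.cos_le_cos_of_nonneg_of_le_pi (by positivity) (by linarith) ?_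
    gcongr

lemma star_leaf_eq {a₁ a₂ a₃ a₄ b p₀ p₂ p₃ p₄ p₅ : ℝ}
    (h0 : p₀ - (p₂ + p₃ + p₄) / 2 - b * p₅ = 0) (h1 : -(p₀ / 2) - a₁ * p₅ = -1)
    (h2 : p₂ - p₀ / 2 - a₂ * p₅ = 0) (h3 : p₃ - p₀ / 2 - a₃ * p₅ = 0)
    (h4 : p₄ - p₀ / 2 - a₄ * p₅ = 0)
    (h5 : p₅ - b * p₀ - a₂ * p₂ - a₃ * p₃ - a₄ * p₄ = 0) :
    a₂ ^ 2 + a₃ ^ 2 + a₄ ^ 2 + (2 * b + a₂ + a₃ + a₄) ^ 2 = 1 := by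
  have e2 : p₂ = p₀ / 2 + a₂ * p₅ := by linarith
  have e3 : p₃ = p₀ / 2 + a₃ * p₅ := by linarith
  have e4 : p₄ = p₀ / 2 + a₄ * p₅ := by linarith
  subst e2 e3 e4
  have e0 : p₀ = (2 * (a₂ + a₃ + a₄) + 4 * b) * p₅ := by linarith
  subst e0
  have h : p₅ * (a₂ ^ 2 + a₃ ^ 2 + a₄ ^ 2 + (2 * b + a₂ + a₃ + a₄) ^ 2 - 1) = 0 := by
    linear_combination -h5
  rcases mul_eq_zero.1 h with h | h
  · subst h; norm_num at h1
  · linarith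

lemma star_center_eq {a₁ a₂ a₃ a₄ b p₁ p₂ p₃ p₄ p₅ : ℝ}
    (h0 : -(p₁ + p₂ + p₃ + p₄) / 2 - b * p₅ = -1) (h1 : p₁ - a₁ * p₅ = 0)
    (h2 : p₂ - a₂ * p₅ = 0) (h3 : p₃ - a₃ * p₅ = 0) (h4 : p₄ - a₄ * p₅ = 0)
    (h5 : p₅ - a₁ * p₁ - a₂ * p₂ - a₃ * p₃ - a₄ * p₄ = 0) :
    a₁ ^ 2 + a₂ ^ 2 + a₃ ^ 2 + a₄ ^ 2 = 1 := by
  have e1 : p₁ = a₁ * p₅ := by linarith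
  have e2 : p₂ = a₂ * p₅ := by linarith
  have e3 : p₃ = a₃ * p₅ := by linarith
  have e4 : p₄ = a₄ * p₅ := by linarith
  subst e1 e2 e3 e4
  have h : p₅ * (a₁ ^ 2 + a₂ ^ 2 + a₃ ^ 2 + a₄ ^ 2 - 1) = 0 := by linear_combination -h5
  rcases mul_eq_zero.1 h with h | h
  · subst h; norm_num at h0
  · linarith

lemma star_solve {x₁ x₂ x₃ y b : ℝ} (hx₁ : x₁ = 0 ∨ 1 / 2 ≤ x₁) (hx₂ : 0 ≤ x₂) (hx₃ : 0 ≤ x₃)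
    (hy : 0 ≤ y) (hb : 0 ≤ b)
    (e1 : x₂ ^ 2 + x₃ ^ 2 + y ^ 2 + (2 * b + x₂ + x₃ + y) ^ 2 = 1)
    (e2 : x₁ ^ 2 + x₃ ^ 2 + y ^ 2 + (2 * b + x₁ + x₃ + y) ^ 2 = 1)
    (e3 : x₁ ^ 2 + x₂ ^ 2 + y ^ 2 + (2 * b + x₁ + x₂ + y) ^ 2 = 1) :
    x₁ = 0 ∧ x₂ = 0 ∧ x₃ = 0 ∧ y ^ 2 + (2 * b + y) ^ 2 = 1 := by
  have hx₁' : 0 ≤ x₁ := by rcases hx₁ with h | h <;> linarith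
  have key : 0 < 4 * b + 2 * (x₁ + x₂ + x₃ + y) := by
    by_contra hc
    have h1 : b = 0 := by linarith
    have h2 : x₁ = 0 := by linarith
    have h3 : x₂ = 0 := by linarith
    have h4 : x₃ = 0 := by linarith
    have h5 : y = 0 := by linarith
    subst h1 h2 h3 h4 h5
    norm_num at e1
  have h12 : x₂ = x₁ := by
    have : (x₂ - x₁) * (4 * b + 2 * (x₁ + x₂ + x₃ + y)) = 0 := by linear_combination e1 - e2
    linarith [(mul_eq_zero.1 this).resolve_right key.ne']
  have h13 : x₃ = x₁ := by
    have : (x₃ - x₁) * (4 * b + 2 * (x₁ + x₂ + x₃ + y)) = 0 := by linear_combination e1 - e3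
    linarith [(mul_eq_zero.1 this).resolve_right key.ne']
  subst h12 h13
  rcases hx₁ with h | h
  · subst h
    exact ⟨rfl, rfl, rfl, by linear_combination e1⟩
  · nlinarith [sq_nonneg y]

/-- The Gram matrix of a star: the node `0` is joined by simple edges to all other nodes. -/
def StarGram (v : Fin 6 → EuclideanSpace ℝ (Fin 6)) : Prop :=
  (∀ i, i ≠ 0 → mink 5 (v 0) (v i) = -(1 / 2)) ∧
    ∀ i j, i ≠ 0 → j ≠ 0 → i ≠ j → mink 5 (v i) (v j) = 0

variable {v r : Fin 6 → EuclideanSpace ℝ (Fin 6)}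

lemma SimpData.gram_row (hd : SimpData v r) (k j : Fin 6) :
    ∑ i, (-mink 5 (r j) (r i)) * mink 5 (v k) (v i) = if k = j then -1 else 0 := by
  rw [← hd.dual k j]
  conv_rhs => rw [hd.expand_normal (r j)]
  rw [mink_sum_right]
  simp only [mink_smul_right]

lemma SimpData.starGram (hd : SimpData v r)
    (hnull : ∀ i j, mink 5 (r i) (r i) ≠ 0 → mink 5 (r j) (r j) ≠ 0 → i = j)
    (hcox : ∀ i j, i ≠ j → mink 5 (v i) (v j) = 0 ∨ mink 5 (v i) (v j) ≤ -(1 / 2))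
    (hc : ∀ i : Fin 6, i ≠ 0 → i ≠ 5 → mink 5 (v 0) (v i) = -(1 / 2))
    (hl : ∀ i j : Fin 6, i ≠ 0 → i ≠ 5 → j ≠ 0 → j ≠ 5 → i ≠ j → mink 5 (v i) (v j) = 0) :
    StarGram v ∧ mink 5 (r 0) (r 0) ≠ 0 := by
  have hne : ∀ i j, i ≠ j → 0 ≤ -mink 5 (v i) (v j) := fun i j h => by
    rcases hcox i j h with h | h <;> linarith
  have hq : ∀ i, i ≠ 5 → -mink 5 (v i) (v 5) = 0 ∨ 1 / 2 ≤ -mink 5 (v i) (v 5) := fun i hi => by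
    rcases hcox i 5 hi with h | h
    · left; linarith
    · right; linarith
  have hrow := fun k j => hd.gram_row k j
  simp only [Fin.sum_univ_six] at hrow
  obtain ⟨b, hb⟩ : ∃ b, mink 5 (v 0) (v 5) = -b := ⟨_, (neg_neg _).symm⟩
  obtain ⟨a₁, h1⟩ : ∃ b, mink 5 (v 1) (v 5) = -b := ⟨_, (neg_neg _).symm⟩
  obtain ⟨a₂, h2⟩ : ∃ b, mink 5 (v 2) (v 5) = -b := ⟨_, (neg_neg _).symm⟩
  obtain ⟨a₃, h3⟩ : ∃ b, mink 5 (v 3) (v 5) = -b := ⟨_, (neg_neg _).symm⟩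
  obtain ⟨a₄, h4⟩ : ∃ b, mink 5 (v 4) (v 5) = -b := ⟨_, (neg_neg _).symm⟩
  have q1 := hq 1 (by decide)
  have q2 := hq 2 (by decide)
  have q3 := hq 3 (by decide)
  have q4 := hq 4 (by decide)
  have n0 := hne 0 5 (by decide)
  have n1 := hne 1 5 (by decide)
  have n2 := hne 2 5 (by decide)
  have n3 := hne 3 5 (by decide)
  have n4 := hne 4 5 (by decide)
  rw [h1, neg_neg] at q1 n1
  rw [h2, neg_neg] at q2 n2
  rw [h3, neg_neg] at q3 n3
  rw [h4, neg_neg] at q4 n4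
  rw [hb, neg_neg] at n0
  have g01 := hc 1 (by decide) (by decide)
  have g02 := hc 2 (by decide) (by decide)
  have g03 := hc 3 (by decide) (by decide)
  have g04 := hc 4 (by decide) (by decide)
  have g12 := hl 1 2 (by decide) (by decide) (by decide) (by decide) (by decide)
  have g13 := hl 1 3 (by decide) (by decide) (by decide) (by decide) (by decide)
  have g14 := hl 1 4 (by decide) (by decide) (by decide) (by decide) (by decide)
  have g23 := hl 2 3 (by decide) (by decide) (by decide) (by decide) (by decide)
  have g24 := hl 2 4 (by decide) (by decide) (by decide) (by decide) (by decide)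
  have g34 := hl 3 4 (by decide) (by decide) (by decide) (by decide) (by decide)
  have hG : ∀ j, mink 5 (r j) (r j) = 0 → ∃ p : Fin 6 → ℝ, p j = 0 ∧
      p 0 - (p 1 + p 2 + p 3 + p 4) / 2 - b * p 5 = (if 0 = j then -1 else 0) ∧
      p 1 - p 0 / 2 - a₁ * p 5 = (if 1 = j then -1 else 0) ∧
      p 2 - p 0 / 2 - a₂ * p 5 = (if 2 = j then -1 else 0) ∧
      p 3 - p 0 / 2 - a₃ * p 5 = (if 3 = j then -1 else 0) ∧
      p 4 - p 0 / 2 - a₄ * p 5 = (if 4 = j then -1 else 0) ∧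
      p 5 - b * p 0 - a₁ * p 1 - a₂ * p 2 - a₃ * p 3 - a₄ * p 4 = (if 5 = j then -1 else 0) := by
    intro j hj
    refine ⟨fun i => -mink 5 (r j) (r i), by simp [hj], ?_, ?_, ?_, ?_, ?_, ?_⟩
    · rw [← hrow 0 j, hd.unit, g01, g02, g03, g04, hb]; ring
    · rw [← hrow 1 j, hd.unit, mink_comm (v 1) (v 0), g01, g12, g13, g14, h1]; ring
    · rw [← hrow 2 j, hd.unit, mink_comm (v 2) (v 0), mink_comm (v 2) (v 1), g02, g12, g23, g24,
        h2]; ring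
    · rw [← hrow 3 j, hd.unit, mink_comm (v 3) (v 0), mink_comm (v 3) (v 1),
        mink_comm (v 3) (v 2), g03, g13, g23, g34, h3]; ring
    · rw [← hrow 4 j, hd.unit, mink_comm (v 4) (v 0), mink_comm (v 4) (v 1),
        mink_comm (v 4) (v 2), mink_comm (v 4) (v 3), g04, g14, g24, g34, h4]; ring
    · rw [← hrow 5 j, hd.unit, mink_comm (v 5) (v 0), mink_comm (v 5) (v 1),
        mink_comm (v 5) (v 2), mink_comm (v 5) (v 3), mink_comm (v 5) (v 4), hb, h1, h2, h3, h4]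
      ring
  have E0 : mink 5 (r 0) (r 0) = 0 → a₁ ^ 2 + a₂ ^ 2 + a₃ ^ 2 + a₄ ^ 2 = 1 := fun h => by
    obtain ⟨p, hp, k0, k1, k2, k3, k4, k5⟩ := hG 0 h
    norm_num [hp, Fin.ext_iff] at k0 k1 k2 k3 k4 k5
    exact star_center_eq (b := b) (by linarith) k1 k2 k3 k4 k5
  have E1 : mink 5 (r 1) (r 1) = 0 →
      a₂ ^ 2 + a₃ ^ 2 + a₄ ^ 2 + (2 * b + a₂ + a₃ + a₄) ^ 2 = 1 := fun h => by
    obtain ⟨p, hp, k0, k1, k2, k3, k4, k5⟩ := hG 1 h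
    norm_num [hp, Fin.ext_iff] at k0 k1 k2 k3 k4 k5
    exact star_leaf_eq k0 k1 k2 k3 k4 k5
  have E2 : mink 5 (r 2) (r 2) = 0 →
      a₁ ^ 2 + a₃ ^ 2 + a₄ ^ 2 + (2 * b + a₁ + a₃ + a₄) ^ 2 = 1 := fun h => by
    obtain ⟨p, hp, k0, k1, k2, k3, k4, k5⟩ := hG 2 h
    norm_num [hp, Fin.ext_iff] at k0 k1 k2 k3 k4 k5
    exact star_leaf_eq k0 k2 k1 k3 k4 k5
  have E3 : mink 5 (r 3) (r 3) = 0 →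
      a₁ ^ 2 + a₂ ^ 2 + a₄ ^ 2 + (2 * b + a₁ + a₂ + a₄) ^ 2 = 1 := fun h => by
    obtain ⟨p, hp, k0, k1, k2, k3, k4, k5⟩ := hG 3 h
    norm_num [hp, Fin.ext_iff] at k0 k1 k2 k3 k4 k5
    exact star_leaf_eq k0 k3 k1 k2 k4 k5
  have E4 : mink 5 (r 4) (r 4) = 0 →
      a₁ ^ 2 + a₂ ^ 2 + a₃ ^ 2 + (2 * b + a₁ + a₂ + a₃) ^ 2 = 1 := fun h => by
    obtain ⟨p, hp, k0, k1, k2, k3, k4, k5⟩ := hG 4 h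
    norm_num [hp, Fin.ext_iff] at k0 k1 k2 k3 k4 k5
    exact star_leaf_eq k0 k4 k1 k2 k3 k5
  have hfin : ∀ {y : ℝ}, 0 ≤ y → y ^ 2 = 1 → y ^ 2 + (2 * b + y) ^ 2 = 1 → False := by
    intro y hy e1 e2
    have e3 : (2 * b + y) ^ 2 = 0 := by linarith
    have e4 : 2 * b + y = 0 := pow_eq_zero_iff two_ne_zero |>.1 e3
    have e5 : y = 0 := by linarith
    rw [e5] at e1; norm_num at e1
  have hall : ∀ i, mink 5 (r i) (r i) ≠ 0 → ∀ j, j ≠ i → mink 5 (r j) (r j) = 0 :=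
    fun i hi j hj => by
      by_contra hc
      exact hj (hnull j i hc hi)
  have hsol : a₁ = 0 ∧ a₂ = 0 ∧ a₃ = 0 ∧ a₄ = 0 ∧ b = 1 / 2 := by
    by_cases z1 : mink 5 (r 1) (r 1) = 0
    · by_cases z2 : mink 5 (r 2) (r 2) = 0
      · by_cases z3 : mink 5 (r 3) (r 3) = 0
        · obtain ⟨s1, s2, s3, s4⟩ := star_solve q1 n2 n3 n4 n0
            (E1 z1) (E2 z2) (E3 z3)
          by_cases z4 : mink 5 (r 4) (r 4) = 0
          · have e := E4 z4
            subst s1 s2 s3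
            have hb2 : b = 1 / 2 := by nlinarith
            subst hb2
            exact ⟨rfl, rfl, rfl, by nlinarith, rfl⟩
          · have e := E0 (hall 4 z4 0 (by decide))
            subst s1 s2 s3
            exact (hfin n4 (by linarith) s4).elim
        · have e := E0 (hall 3 z3 0 (by decide))
          obtain ⟨s1, s2, s3, s4⟩ := star_solve q1 n2 n4 n3 n0
            (by linarith [E1 z1]) (by linarith [E2 z2]) (by
              have := E4 (hall 3 z3 4 (by decide)); linarith)
          subst s1 s2 s3
          exact (hfin n3 (by linarith) s4).elim
      · have e := E0 (hall 2 z2 0 (by decide))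
        obtain ⟨s1, s2, s3, s4⟩ := star_solve q1 n3 n4 n2 n0
          (by linarith [E1 z1]) (by linarith [E3 (hall 2 z2 3 (by decide))])
          (by linarith [E4 (hall 2 z2 4 (by decide))])
        subst s1 s2 s3
        exact (hfin n2 (by linarith) s4).elim
    · have e := E0 (hall 1 z1 0 (by decide))
      obtain ⟨s1, s2, s3, s4⟩ := star_solve q2 n3 n4 n1 n0
        (by linarith [E2 (hall 1 z1 2 (by decide))]) (by linarith [E3 (hall 1 z1 3 (by decide))])
        (by linarith [E4 (hall 1 z1 4 (by decide))])
      subst s1 s2 s3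
      exact (hfin n1 (by linarith) s4).elim
  obtain ⟨rfl, rfl, rfl, rfl, rfl⟩ := hsol
  have h5 : ∀ i : Fin 6, i ≠ 0 → i ≠ 5 → mink 5 (v i) (v 5) = 0 := by
    intro i hi0 hi5
    have : i = 1 ∨ i = 2 ∨ i = 3 ∨ i = 4 := by omega
    rcases this with rfl | rfl | rfl | rfl
    · simpa using h1
    · simpa using h2
    · simpa using h3
    · simpa using h4
  refine ⟨⟨fun i hi => ?_, fun i j hi hj hij => ?_⟩, fun h => by simpa using E0 h⟩
  · by_cases h : i = 5
    · subst h; simpa using hb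
    · exact hc i hi h
  · by_cases hi5 : i = 5
    · subst hi5
      rw [mink_comm]
      exact h5 j hj hij.symm
    · by_cases hj5 : j = 5
      · subst hj5; exact h5 i hi hi5
      · exact hl i j hi hi5 hj hj5 hij

end Star

/-! ## The simplex with a cusp of type `D̃₄` -/

section Classification

variable {n : ℕ} {v r : Fin (n + 1) → EuclideanSpace ℝ (Fin (n + 1))}

lemma SimpData.wall_ne (hd : SimpData v r) {S : Set ↥(hypSet n)} (hS : S = ⋂ i, hHalf n (v i))
    (hn : 2 ≤ n) {i j : Fin (n + 1)} (hij : i ≠ j) : hWall n (v i) ≠ hWall n (v j) := by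
  intro h
  have h1 := hd.eq_or_neg_of_inter_subset hS hn (hd.unit j) (i := i)
    (by rw [h]; exact inter_subset_right)
  have h2 := hd.dual_self j
  have h3 := hd.dual_ne hij
  rcases h1 with h1 | h1 <;> rw [h1] at h2
  · linarith
  · rw [mink_neg_left] at h2; linarith

lemma SimpData.facet_injective (hd : SimpData v r) {S : Set ↥(hypSet n)}
    (hS : S = ⋂ i, hHalf n (v i)) (hn : 2 ≤ n) :
    Function.Injective fun i => S ∩ hWall n (v i) := by
  intro i j h
  by_contra hij
  have h1 := hd.eq_or_neg_of_inter_subset hS hn (hd.unit j) (i := i)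
    (by change (fun i => S ∩ hWall n (v i)) i ⊆ _; rw [h]; exact inter_subset_right)
  have h2 := hd.dual_self j
  have h3 := hd.dual_ne hij
  rcases h1 with h1 | h1 <;> rw [h1] at h2
  · linarith
  · rw [mink_neg_left] at h2; linarith

lemma SimpData.exists_mem_walls (hd : SimpData v r) {S : Set ↥(hypSet n)}
    (hS : S = ⋂ i, hHalf n (v i)) (hn : 3 ≤ n) (i j : Fin (n + 1)) :
    ∃ x ∈ S, x ∈ hWall n (v i) ∩ hWall n (v j) := by
  obtain ⟨a, ha, b, hb, hab⟩ : ∃ a ∈ (Finset.univ \ {i, j} : Finset (Fin (n + 1))),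
      ∃ b ∈ (Finset.univ \ {i, j} : Finset (Fin (n + 1))), a ≠ b := by
    refine Finset.one_lt_card.1 ?_
    have := Finset.le_card_sdiff {i, j} (Finset.univ : Finset (Fin (n + 1)))
    have h2 := Finset.card_le_two (a := i) (b := j)
    simp only [Finset.card_univ, Fintype.card_fin] at this
    omega
  simp only [Finset.mem_sdiff, Finset.mem_univ, Finset.mem_insert, Finset.mem_singleton,
    true_and] at ha hb
  have hx := hd.mink_sum_r fun k => if k = i ∨ k = j then 0 else 1
  set x := ∑ k, (if k = i ∨ k = j then (0 : ℝ) else 1) • r k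
  have hle : ∀ k, mink n (v k) x ≤ 0 := fun k => by rw [hx]; split_ifs <;> norm_num
  obtain ⟨p, hp, c, hc, hpx⟩ := forall_mem_of_scale
    (hd.fut_of_mem hle hab (by rw [hx, if_neg ha]; norm_num) (by rw [hx, if_neg hb]; norm_num)) hle
  refine ⟨p, hS ▸ hp, ?_, ?_⟩
  · change mink n (v i) p.val = 0
    rw [hpx, mink_smul_right, hx]; simp
  · change mink n (v j) p.val = 0
    rw [hpx, mink_smul_right, hx]; simp

lemma SimpData.reindex (hd : SimpData v r) (σ : Equiv.Perm (Fin (n + 1))) :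
    SimpData (fun i => v (σ i)) (fun i => r (σ i)) :=
  ⟨fun i => hd.unit _, fun i j => by rw [hd.dual]; simp, fun i => hd.caus _⟩

/-- A Coxeter simplex with ideal vertices is given by simplicial data satisfying the Coxeter
condition. -/
lemma exists_coxeter_simpData (hn : 3 ≤ n) {S : Set ↥(hypSet n)} (h : hCoxSimplex n S)
    (hid : (hIdealVerts n S).ncard ≠ 0) :
    ∃ v r : Fin (n + 1) → EuclideanSpace ℝ (Fin (n + 1)), SimpData v r ∧
      S = ⋂ i, hHalf n (v i) ∧
      ∀ i j, i ≠ j → mink n (v i) (v j) = 0 ∨ mink n (v i) (v j) ≤ -(1 / 2) := by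
  obtain ⟨⟨k, v, hunit, hS, hSint, -, hcox⟩, -, hfac⟩ := h
  obtain ⟨ι, r, hd, hS'⟩ := exists_simpData (by omega) hunit hS hSint hfac hid
  refine ⟨_, r, hd, hS', fun i j hij => ?_⟩
  obtain ⟨m, hm, h⟩ := hcox (ι i) (ι j) (hd.wall_ne hS' (by omega) hij)
    (hd.exists_mem_walls hS' hn i j)
  rcases cos_pi_div_eq_zero_or_half_le hm with h1 | h1
  · left; rw [h, h1, neg_zero]
  · right; rw [h]; linarith

lemma cos_cmD4t_leaf {i : Fin 5} (hi : i ≠ 0) : Real.cos (Real.pi / (cmD4t 0 i : ℝ)) = 1 / 2 := by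
  have : cmD4t 0 i = 3 := (by decide : ∀ i : Fin 5, i ≠ 0 → cmD4t 0 i = 3) i hi
  rw [this]; simp

lemma cos_cmD4t_of_ne {i j : Fin 5} (hi : i ≠ 0) (hj : j ≠ 0) (hij : i ≠ j) :
    Real.cos (Real.pi / (cmD4t i j : ℝ)) = 0 := by
  have : cmD4t i j = 2 := by
    fin_cases i <;> fin_cases j <;> first | rfl | contradiction
  rw [this]; simp

lemma exists_perm_extending {σ : Fin 5 → Fin 6} (hσ : Function.Injective σ) :
    ∃ τ : Equiv.Perm (Fin 6), ∀ i, τ i.castSucc = σ i := by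
  obtain ⟨m, hm⟩ : ∃ m, ∀ i, σ i ≠ m := by
    by_contra h
    push Not at h
    have := Fintype.card_le_of_surjective σ h
    simp at this
  have hinj : Function.Injective (Fin.snoc σ m : Fin 6 → Fin 6) := by
    rw [Fin.snoc_injective_iff]
    exact ⟨hσ, fun ⟨i, hi⟩ => hm i hi⟩
  refine ⟨Equiv.ofBijective _ (Finite.injective_iff_bijective.1 hinj), fun i => ?_⟩
  simp

theorem IsH115.exists_starGram {P : Set ↥(hypSet 5)} (hP : IsH115 P) :
    ∃ v r : Fin 6 → EuclideanSpace ℝ (Fin 6), SimpData v r ∧ P = ⋂ i, hHalf 5 (v i) ∧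
      StarGram v ∧ mink 5 (r 0) (r 0) ≠ 0 := by
  obtain ⟨-, hcs, -, hid, ⟨w, -, e, hunit, -, hang, hwne, hfac⟩, -⟩ := hP
  obtain ⟨v, r, hd, hPv, hcox⟩ := exists_coxeter_simpData (by norm_num) hcs (by rw [hid]; norm_num)
  have hnull : ∀ i j, mink 5 (r i) (r i) ≠ 0 → mink 5 (r j) (r j) ≠ 0 → i = j := by
    rw [hd.ncard_idealVerts hPv (by norm_num)] at hid
    have h1 := Set.ncard_add_ncard_compl {i | mink 5 (r i) (r i) = 0}
    rw [hid, Nat.card_eq_fintype_card, Fintype.card_fin] at h1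
    have h2 := (Set.ncard_le_one (Set.toFinite _)).1
      (by omega : {i | mink 5 (r i) (r i) = 0}ᶜ.ncard ≤ 1)
    exact fun i j hi hj => h2 i hi j hj
  have hex : ∀ i, ∃ j, e i = v j ∨ e i = -v j := fun i => by
    have h1 : P ∩ hWall 5 (e i) ∈ {S | hIsFacet 5 P S ∧ w ∈ closure (hCone 5 S)} := by
      rw [hfac]; exact ⟨i, rfl⟩
    obtain ⟨j, hj⟩ := hd.facet_eq hPv (by norm_num) h1.1
    exact ⟨j, hd.eq_or_neg_of_inter_subset hPv (by norm_num) (hunit i)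
      (hj ▸ inter_subset_right)⟩
  choose σ hσ using hex
  have hwall : ∀ i, hWall 5 (e i) = hWall 5 (v (σ i)) := fun i => by
    rcases hσ i with h | h <;> rw [h]
    ext x; simp [hWall, mink_neg_left]
  have hinj : Function.Injective σ := fun i j hij => by
    by_contra h
    exact hwne i j h (by rw [hwall, hwall, hij])
  have habs : ∀ i j, mink 5 (e i) (e j) = mink 5 (v (σ i)) (v (σ j)) ∨
      mink 5 (e i) (e j) = -mink 5 (v (σ i)) (v (σ j)) := fun i j => by
    rcases hσ i with h | h <;> rcases hσ j with h' | h' <;> rw [h, h'] <;>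
      simp [mink_neg_left, mink_neg_right]
  obtain ⟨τ, hτ⟩ := exists_perm_extending hinj
  have hlift : ∀ i : Fin 6, i ≠ 5 → ∃ k : Fin 5, i = k.castSucc :=
    fun i hi => ⟨i.castPred hi, by simp⟩
  refine ⟨_, _, hd.reindex τ, ?_, (hd.reindex τ).starGram ?_ ?_ ?_ ?_⟩
  · rw [hPv]
    exact (τ.surjective.iInter_comp fun i => hHalf 5 (v i)).symm
  · exact fun i j hi hj => τ.injective (hnull _ _ hi hj)
  · exact fun i j hij => hcox _ _ (τ.injective.ne hij)
  · intro i hi0 hi5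
    obtain ⟨k, rfl⟩ := hlift i hi5
    have hk : k ≠ 0 := by rintro rfl; exact hi0 rfl
    have h1 := habs 0 k
    rw [hang 0 k hk.symm, cos_cmD4t_leaf hk] at h1
    have h0 : τ 0 = σ 0 := hτ 0
    rw [h0, hτ]
    rcases h1 with h1 | h1
    · exact h1.symm
    · rcases hcox (σ 0) (σ k) (hinj.ne hk.symm) with h | h <;> linarith
  · intro i j hi0 hi5 hj0 hj5 hij
    obtain ⟨k, rfl⟩ := hlift i hi5
    obtain ⟨l, rfl⟩ := hlift j hj5
    have hk : k ≠ 0 := by rintro rfl; exact hi0 rfl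
    have hl : l ≠ 0 := by rintro rfl; exact hj0 rfl
    have hkl : k ≠ l := by rintro rfl; exact hij rfl
    have h1 := habs k l
    rw [hang k l hkl, cos_cmD4t_of_ne hk hl hkl] at h1
    rw [hτ, hτ]
    rcases h1 with h1 | h1 <;> linarith

end Classification

/-! ## Tilings near an ideal vertex -/

section Cusp

variable {n : ℕ} {v r : Fin (n + 1) → EuclideanSpace ℝ (Fin (n + 1))}

/-- Coordinates, with respect to the rays `r` other than `r a`, of the normals `u` other than
`u b`. -/
def cuspMatrix (u r : Fin (n + 1) → EuclideanSpace ℝ (Fin (n + 1))) (b a : Fin (n + 1)) :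
    Matrix (Fin n) (Fin n) ℝ :=
  Matrix.of fun j i => -mink n (u (b.succAbove j)) (r (a.succAbove i))

/-- The combination of the rays `r` other than `r a` with coefficients `y`. -/
def cuspVec (r : Fin (n + 1) → EuclideanSpace ℝ (Fin (n + 1))) (a : Fin (n + 1)) (y : Fin n → ℝ) :
    EuclideanSpace ℝ (Fin (n + 1)) := ∑ i, y i • r (a.succAbove i)

lemma cuspMatrix_mulVec (u r : Fin (n + 1) → EuclideanSpace ℝ (Fin (n + 1))) (b a : Fin (n + 1))
    (y : Fin n → ℝ) (j : Fin n) :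
    (cuspMatrix u r b a).mulVec y j = -mink n (u (b.succAbove j)) (cuspVec r a y) := by
  simp only [cuspMatrix, cuspVec, Matrix.mulVec, dotProduct, Matrix.of_apply, mink_sum_right,
    mink_smul_right, ← Finset.sum_neg_distrib]
  exact Finset.sum_congr rfl fun i _ => by ring

lemma SimpData.mink_cuspVec (hd : SimpData v r) (a : Fin (n + 1)) (y : Fin n → ℝ) (i : Fin n) :
    mink n (v (a.succAbove i)) (cuspVec r a y) = -y i := by
  simp [cuspVec, mink_sum_right, mink_smul_right, hd.dual]

lemma SimpData.mink_cuspVec_self (hd : SimpData v r) (a : Fin (n + 1)) (y : Fin n → ℝ) :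
    mink n (v a) (cuspVec r a y) = 0 := by
  simp [cuspVec, mink_sum_right, mink_smul_right, hd.dual, Fin.ne_succAbove]

lemma SimpData.cuspVec_expand (hd : SimpData v r) (a : Fin (n + 1))
    (x : EuclideanSpace ℝ (Fin (n + 1))) :
    x = (-mink n (v a) x) • r a + cuspVec r a fun i => -mink n (v (a.succAbove i)) x := by
  conv_lhs => rw [hd.expand x, Fin.sum_univ_succAbove _ a]
  rfl

lemma mem_interior_iInter_hHalf {ι : Type*} [Finite ι] {v : ι → EuclideanSpace ℝ (Fin (n + 1))}
    {p : ↥(hypSet n)} (hp : ∀ i, mink n (v i) p.val < 0) : p ∈ interior (⋂ i, hHalf n (v i)) := by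
  refine mem_interior.2 ⟨⋂ i, {x | mink n (v i) x.val < 0}, ?_, ?_, ?_⟩
  · exact iInter_mono fun i x (hx : mink n (v i) x.val < 0) => hx.le
  · exact isOpen_iInter_of_finite fun i =>
      isOpen_lt ((continuous_mink _).comp continuous_subtype_val) continuous_const
  · exact mem_iInter.2 hp

/-- A tiling of the simplex with normals `v` by finitely many simplices with normals `V T`. -/
structure SimpTiling (v r : Fin (n + 1) → EuclideanSpace ℝ (Fin (n + 1))) (P : Set ↥(hypSet n))
    (𝒯 : Set (Set ↥(hypSet n)))
    (V R : Set ↥(hypSet n) → Fin (n + 1) → EuclideanSpace ℝ (Fin (n + 1))) : Prop where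
  base : SimpData v r
  base_eq : P = ⋂ i, hHalf n (v i)
  finite : 𝒯.Finite
  sUnion : ⋃₀ 𝒯 = P
  tile : ∀ T ∈ 𝒯, SimpData (V T) (R T)
  tile_eq : ∀ T ∈ 𝒯, T = ⋂ i, hHalf n (V T i)
  disj : ∀ T₁ ∈ 𝒯, ∀ T₂ ∈ 𝒯, T₁ ≠ T₂ → interior T₁ ∩ interior T₂ = ∅

namespace SimpTiling

variable {P : Set ↥(hypSet n)} {𝒯 : Set (Set ↥(hypSet n))}
  {V R : Set ↥(hypSet n) → Fin (n + 1) → EuclideanSpace ℝ (Fin (n + 1))}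
  (h : SimpTiling v r P 𝒯 V R)
include h

lemma mink_ray_nonpos (hn : 1 ≤ n) {T : Set ↥(hypSet n)} (hT : T ∈ 𝒯) (i k : Fin (n + 1)) :
    mink n (v i) (R T k) ≤ 0 := by
  refine (h.tile T hT).mink_ray_nonpos (h.tile_eq T hT) hn (fun x hx => ?_) k
  have hx' : x ∈ P := h.sUnion ▸ mem_sUnion_of_mem hx hT
  rw [h.base_eq] at hx'
  exact mem_iInter.1 hx' i

/-- Some tile of a cone over a half-line ending in a null ray of `P` has that ray. -/
lemma exists_tile {a : Fin (n + 1)} (ha : mink n (r a) (r a) = 0) {y : Fin n → ℝ}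
    (hy : ∀ i, 0 ≤ y i) (hy0 : ∃ i, y i ≠ 0) :
    ∃ T ∈ 𝒯, ∃ b, ∃ c : ℝ, 0 < c ∧ r a = c • R T b ∧
      ∀ j, mink n (V T (b.succAbove j)) (cuspVec r a y) ≤ 0 := by
  obtain ⟨i₀, hi₀⟩ := hy0
  have hd := h.base
  have hx : ∀ s : ℕ, ∃ T ∈ 𝒯, ∀ k,
      mink n (V T k) (cuspVec r a y) + (s + 1) * mink n (V T k) (r a) ≤ 0 := by
    intro s
    have hs : (0 : ℝ) < s + 1 := by positivity
    have hva : mink n (v a) (cuspVec r a y + ((s : ℝ) + 1) • r a) < 0 := by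
      rw [mink_add_right, hd.mink_cuspVec_self, mink_smul_right, hd.dual_self]; linarith
    have hvi : ∀ i, mink n (v (a.succAbove i)) (cuspVec r a y + ((s : ℝ) + 1) • r a) = -y i :=
      fun i => by
        rw [mink_add_right, hd.mink_cuspVec, mink_smul_right, hd.dual_ne (Fin.succAbove_ne a i)]
        ring
    have hle : ∀ k, mink n (v k) (cuspVec r a y + ((s : ℝ) + 1) • r a) ≤ 0 := fun k => by
      rcases Fin.eq_self_or_eq_succAbove a k with rfl | ⟨i, rfl⟩
      · exact hva.le
      · rw [hvi]; linarith [hy i]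
    have hfut := hd.fut_of_mem hle (Fin.succAbove_ne a i₀).symm hva (by
      rw [hvi]; linarith [lt_of_le_of_ne (hy i₀) hi₀.symm])
    obtain ⟨p, hp, c, hc, hpx⟩ := forall_mem_of_scale hfut hle
    rw [← h.base_eq, ← h.sUnion] at hp
    obtain ⟨T, hT, hpT⟩ := hp
    refine ⟨T, hT, fun k => ?_⟩
    rw [h.tile_eq T hT] at hpT
    have h1 := mem_iInter_hHalf.1 hpT k
    rw [hpx, mink_smul_right, mink_add_right, mink_smul_right] at h1
    exact nonpos_of_mul_nonpos_right h1 hc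
  choose T hT hTk using hx
  have := h.finite.to_subtype
  obtain ⟨⟨T', hT'⟩, hinf⟩ := Finite.exists_infinite_fiber fun s => (⟨T s, hT s⟩ : 𝒯)
  have hfreq : ∀ N : ℕ, ∃ s > N, T s = T' := fun N => by
    obtain ⟨s, hs, hN⟩ := (Set.infinite_coe_iff.1 hinf).exists_gt N
    exact ⟨s, hN, congrArg Subtype.val hs⟩
  have hcone : ∀ k, mink n (V T' k) (r a) ≤ 0 := by
    intro k
    by_contra hc
    push Not at hc
    obtain ⟨N, hN⟩ := exists_nat_gt (-mink n (V T' k) (cuspVec r a y) / mink n (V T' k) (r a))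
    obtain ⟨s, hs, hsT⟩ := hfreq N
    have h1 := hTk s k
    rw [hsT] at h1
    rw [div_lt_iff₀ hc] at hN
    have h2 : (N : ℝ) < s := by exact_mod_cast hs
    nlinarith
  have hdT := h.tile T' hT'
  obtain ⟨b, c, hc, hr⟩ := hdT.exists_ray (x := r a)
    (fun h0 => by have := (hd.caus a).2; rw [h0] at this; simp at this) hcone
    (fun hf => hf.1.ne ha)
  refine ⟨T', hT', b, c, hc, hr, fun j => ?_⟩
  obtain ⟨s, -, hsT⟩ := hfreq 0
  have h1 := hTk s (b.succAbove j)
  rw [hsT, hr, mink_smul_right, hdT.dual_ne (Fin.succAbove_ne b j)] at h1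
  linarith

lemma cusp_pos (hn : 1 ≤ n) {T : Set ↥(hypSet n)} (hT : T ∈ 𝒯) {a b : Fin (n + 1)} {c : ℝ}
    (hc : 0 < c) (hr : r a = c • R T b) {y : Fin n → ℝ}
    (hy : ∀ j, mink n (V T (b.succAbove j)) (cuspVec r a y) ≤ 0) (i : Fin n) : 0 ≤ y i := by
  have h1 := h.base.mink_cuspVec a y i
  have h0 : mink n (v (a.succAbove i)) (R T b) = 0 := by
    have := h.base.dual_ne (Fin.succAbove_ne a i)
    rw [hr, mink_smul_right] at this
    exact (mul_eq_zero.1 this).resolve_left hc.ne'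
  rw [(h.tile T hT).expand (cuspVec r a y), Fin.sum_univ_succAbove _ b, mink_add_right,
    mink_smul_right, h0, mink_sum_right] at h1
  have h2 : ∑ j, mink n (v (a.succAbove i))
      ((-mink n (V T (b.succAbove j)) (cuspVec r a y)) • R T (b.succAbove j)) ≤ 0 :=
    Finset.sum_nonpos fun j _ => by
      rw [mink_smul_right]
      exact mul_nonpos_of_nonneg_of_nonpos (by linarith [hy j]) (h.mink_ray_nonpos hn hT _ _)
  linarith

lemma cusp_eq (hn : 2 ≤ n) {T₁ T₂ : Set ↥(hypSet n)} (hT₁ : T₁ ∈ 𝒯) (hT₂ : T₂ ∈ 𝒯)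
    {a b₁ b₂ : Fin (n + 1)} {c₁ c₂ : ℝ} (hc₁ : 0 < c₁) (hr₁ : r a = c₁ • R T₁ b₁)
    (hc₂ : 0 < c₂) (hr₂ : r a = c₂ • R T₂ b₂) {y : Fin n → ℝ}
    (hy₁ : ∀ j, mink n (V T₁ (b₁.succAbove j)) (cuspVec r a y) < 0)
    (hy₂ : ∀ j, mink n (V T₂ (b₂.succAbove j)) (cuspVec r a y) < 0) : T₁ = T₂ := by
  by_contra hne
  have key : ∀ T ∈ 𝒯, ∀ b, ∀ c : ℝ, 0 < c → r a = c • R T b →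
      (∀ j, mink n (V T (b.succAbove j)) (cuspVec r a y) < 0) →
      ∃ s₀ : ℝ, ∀ s > s₀, ∀ k, mink n (V T k) (cuspVec r a y + s • r a) < 0 := by
    intro T hT b c hc hr hy
    refine ⟨mink n (V T b) (cuspVec r a y) / c, fun s hs k => ?_⟩
    rw [gt_iff_lt, div_lt_iff₀ hc] at hs
    rcases Fin.eq_self_or_eq_succAbove b k with rfl | ⟨j, rfl⟩
    · rw [mink_add_right, mink_smul_right, hr, mink_smul_right, (h.tile T hT).dual_self]
      linarith
    · rw [mink_add_right, mink_smul_right, hr, mink_smul_right,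
        (h.tile T hT).dual_ne (Fin.succAbove_ne b j)]
      linarith [hy j]
  obtain ⟨s₁, h₁⟩ := key T₁ hT₁ b₁ c₁ hc₁ hr₁ hy₁
  obtain ⟨s₂, h₂⟩ := key T₂ hT₂ b₂ c₂ hc₂ hr₂ hy₂
  have h₁ := h₁ (max s₁ s₂ + 1) (by linarith [le_max_left s₁ s₂])
  have h₂ := h₂ (max s₁ s₂ + 1) (by linarith [le_max_right s₁ s₂])
  set x := cuspVec r a y + (max s₁ s₂ + 1) • r a
  have hfut : Fut x := (h.tile T₁ hT₁).fut_of_mem (fun k => (h₁ k).le) (i := 0) (j := Fin.last n)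
    (by rw [Ne, Fin.ext_iff]; simp; omega) (h₁ _) (h₁ _)
  obtain ⟨p, c, hc, hp⟩ := exists_hyp x hfut
  have hmem : ∀ T ∈ 𝒯, (∀ k, mink n (V T k) x < 0) → p ∈ interior T := fun T hT hx => by
    rw [h.tile_eq T hT]
    exact mem_interior_iInter_hHalf fun k => by
      rw [hp, mink_smul_right]; exact mul_neg_of_pos_of_neg hc (hx k)
  have := h.disj T₁ hT₁ T₂ hT₂ hne
  exact this.subset ⟨hmem T₁ hT₁ h₁, hmem T₂ hT₂ h₂⟩

lemma cusp_inter {T : Set ↥(hypSet n)} (hT : T ∈ 𝒯) {a b : Fin (n + 1)} {c : ℝ}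
    (hr : r a = c • R T b) :
    ∃ y, ∀ j, mink n (V T (b.succAbove j)) (cuspVec r a y) < 0 := by
  have hdT := h.tile T hT
  refine ⟨fun i => -mink n (v (a.succAbove i)) (∑ k, R T k), fun j => ?_⟩
  have h1 := hdT.mink_center (b.succAbove j)
  rw [h.base.cuspVec_expand a (∑ k, R T k), mink_add_right, mink_smul_right, hr, mink_smul_right,
    hdT.dual_ne (Fin.succAbove_ne b j)] at h1
  linarith

lemma cusp_two (hn : 3 ≤ n) (h2 : hSecondType n P 𝒯) {T : Set ↥(hypSet n)} (hT : T ∈ 𝒯)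
    {k p q : Fin (n + 1)} (hpq : p ≠ q) (hp : mink n (V T k) (r p) ≠ 0)
    (hq : mink n (V T k) (r q) ≠ 0) :
    ∃ i, i ≠ p ∧ i ≠ q ∧ mink n (V T k) (r i) ≠ 0 := by
  by_contra hcon
  push Not at hcon
  have hd := h.base
  have hdT := h.tile T hT
  refine h2 _ _ (hd.isFacet h.base_eq (by omega) p) (hd.isFacet h.base_eq (by omega) q)
    (fun hc => hpq (hd.facet_injective h.base_eq (by omega) hc)) ?_
    ⟨V T k, ⟨hdT.unit k, ⟨T, hT, _, hdT.isFacet (h.tile_eq T hT) (by omega) k,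
      inter_subset_right⟩, ?_⟩, ?_⟩
  · obtain ⟨x, hx, hxp, hxq⟩ := hd.exists_mem_walls h.base_eq hn p q
    exact ⟨x, ⟨hx, hxp⟩, hx, hxq⟩
  · rintro ⟨S, hS, hsub⟩
    obtain ⟨i, rfl⟩ := hd.facet_eq h.base_eq (by omega) hS
    have h1 := hd.eq_smul_of_inter_subset h.base_eq (by omega) hsub
    have h3 : ∀ j, mink n (V T k) (r j) ≠ 0 → i = j := fun j hj => by
      by_contra hij
      rw [h1, mink_smul_left, hd.dual_ne hij, mul_zero] at hj
      exact hj rfl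
    exact hpq ((h3 p hp).symm.trans (h3 q hq))
  · rintro x ⟨⟨-, hxp⟩, -, hxq⟩
    change mink n (V T k) x.val = 0
    rw [hd.expand_normal (V T k), mink_sum_left]
    refine Finset.sum_eq_zero fun i _ => ?_
    rw [mink_smul_left]
    by_cases hip : i = p
    · subst hip; rw [show mink n (v i) x.val = 0 from hxp, mul_zero]
    · by_cases hiq : i = q
      · subst hiq; rw [show mink n (v i) x.val = 0 from hxq, mul_zero]
      · rw [hcon i hip hiq, neg_zero, zero_mul]

/-- In a decomposition of the second type, if at most three tiles share the ideal vertex of the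
ray `r a`, then one of them shares all the walls of the simplex through that vertex. -/
theorem exists_tile_normals (hn : 3 ≤ n) (h2 : hSecondType n P 𝒯) {a : Fin (n + 1)}
    (ha : mink n (r a) (r a) = 0)
    (hle : {T | T ∈ 𝒯 ∧ (r a 0)⁻¹ • r a ∈ hIdealVerts n T}.ncard ≤ 3) :
    ∃ T ∈ 𝒯, ∀ i, i ≠ a → ∃ k, V T k = v i := by
  have hd := h.base
  set B : Set (Set ↥(hypSet n)) := {T | T ∈ 𝒯 ∧ ∃ b, ∃ c : ℝ, 0 < c ∧ r a = c • R T b}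
  have hBfin : B.Finite := h.finite.subset fun T hT => hT.1
  have hBcard : B.ncard ≤ 3 := by
    refine (Set.ncard_le_ncard ?_ (h.finite.subset fun T hT => hT.1)).trans hle
    rintro T ⟨hT, b, c, hc, hr⟩
    refine ⟨hT, ?_⟩
    rw [(h.tile T hT).idealVerts_eq (h.tile_eq T hT) (by omega)]
    refine ⟨b, ?_, ?_⟩
    · rw [hr, mink_smul_left, mink_smul_right] at ha
      simpa [hc.ne'] using ha
    · have hpos := ((h.tile T hT).caus b).2
      change (R T b 0)⁻¹ • R T b = _
      rw [hr, smul_smul]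
      congr 1
      simp only [PiLp.smul_apply, smul_eq_mul]
      field_simp
  obtain ⟨T₀, hT₀⟩ : B.Nonempty := by
    obtain ⟨T, hT, b, c, hc, hr, -⟩ := h.exists_tile ha (y := fun _ => 1) (fun _ => zero_le_one)
      ⟨⟨0, by omega⟩, one_ne_zero⟩
    exact ⟨T, hT, b, c, hc, hr⟩
  obtain ⟨f, hf⟩ : ∃ f : Fin 3 → B, Function.Surjective f := by
    have := hBfin.fintype
    have : Nonempty B := ⟨⟨T₀, hT₀⟩⟩
    obtain ⟨g⟩ := Function.Embedding.nonempty_of_card_le (α := B) (β := Fin 3) (by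
      rwa [Fintype.card_fin, ← Nat.card_eq_fintype_card, Nat.card_coe_set_eq])
    exact ⟨_, Function.invFun_surjective g.injective⟩
  choose β γ hγ hr using fun T : B => T.2.2
  let A : Fin 3 → Matrix (Fin n) (Fin n) ℝ := fun t => cuspMatrix (V (f t)) r (β (f t)) a
  have hA : OrthantTiling A := by
    refine ⟨fun y hy => ?_, fun t y hy i => ?_, fun t t' y hy hy' => ?_,
      fun t j p q hpq hp hq => ?_, fun t => ?_⟩
    · by_cases hy0 : ∃ i, y i ≠ 0
      · obtain ⟨T, hT, b, c, hc, hrT, hle⟩ := h.exists_tile ha hy hy0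
        obtain ⟨t, ht⟩ := hf ⟨T, hT, b, c, hc, hrT⟩
        refine ⟨t, fun j => ?_⟩
        have hb : β (f t) = b := by
          by_contra hb
          have h1 := (h.tile T hT).dual_self b
          have h3 : mink n (V T b) (r a) = 0 := by
            have := hr (f t)
            rw [ht] at this hb
            rw [this, mink_smul_right, (h.tile T hT).dual_ne (Ne.symm hb), mul_zero]
          rw [hrT, mink_smul_right, h1] at h3
          linarith
        rw [cuspMatrix_mulVec, hb, ht]
        linarith [hle j]
      · push Not at hy0
        refine ⟨0, fun j => ?_⟩
        rw [show y = 0 from funext hy0, Matrix.mulVec_zero]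
        exact le_rfl
    · simp only [A, cuspMatrix_mulVec] at hy
      exact h.cusp_pos (by omega) (f t).2.1 (hγ _) (hr _) (fun j => by linarith [hy j]) i
    · simp only [A, cuspMatrix_mulVec] at hy hy'
      have : f t = f t' := Subtype.ext (h.cusp_eq (by omega) (f t).2.1 (f t').2.1 (hγ _) (hr _)
        (hγ _) (hr _) (fun j => by linarith [hy j]) (fun j => by linarith [hy' j]))
      simp only [A, this]
    · have hp' : mink n (V (f t) ((β (f t)).succAbove j)) (r (a.succAbove p)) ≠ 0 :=
        neg_ne_zero.1 hp
      have hq' : mink n (V (f t) ((β (f t)).succAbove j)) (r (a.succAbove q)) ≠ 0 :=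
        neg_ne_zero.1 hq
      obtain ⟨i, hip, hiq, hi⟩ := h.cusp_two hn h2 (f t).2.1
        (Fin.succAbove_right_injective.ne hpq) hp' hq'
      rcases Fin.eq_self_or_eq_succAbove a i with rfl | ⟨c, rfl⟩
      · rw [hr (f t), mink_smul_right, (h.tile _ (f t).2.1).dual_ne (Fin.succAbove_ne _ j),
          mul_zero] at hi
        exact (hi rfl).elim
      · exact ⟨c, fun hc => hip (by rw [hc]), fun hc => hiq (by rw [hc]), neg_ne_zero.2 hi⟩
    · obtain ⟨y, hy⟩ := h.cusp_inter (f t).2.1 (hr (f t))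
      refine ⟨y, fun j => ?_⟩
      rw [cuspMatrix_mulVec]
      linarith [hy j]
  obtain ⟨t, ht⟩ := hA.exists_forall_hasCoord
  have hdT := h.tile _ (f t).2.1
  refine ⟨f t, (f t).2.1, fun i hi => ?_⟩
  rcases Fin.eq_self_or_eq_succAbove a i with rfl | ⟨i, rfl⟩
  · exact (hi rfl).elim
  obtain ⟨j, -, hj⟩ := ht i
  have hpos : 0 < A t j i := hA.row_pos hj
  set u := V (f t) ((β (f t)).succAbove j) with hu
  have hua : mink n u (r a) = 0 := by
    rw [hr (f t), mink_smul_right, hdT.dual_ne (Fin.succAbove_ne _ j), mul_zero]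
  have hui : u = A t j i • v (a.succAbove i) := by
    refine (hd.expand_normal u).trans ?_
    rw [Fin.sum_univ_succAbove _ a, hua, neg_zero, zero_smul, zero_add,
      Finset.sum_eq_single i _ (by simp)]
    · rfl
    · intro c _ hc
      have h1 : -mink n u (r (a.succAbove c)) = 0 := hj c hc
      rw [h1, zero_smul]
  refine ⟨_, hu.symm.trans ?_⟩
  have h1 := hdT.unit ((β (f t)).succAbove j)
  rw [← hu, hui, mink_smul_left, mink_smul_right, hd.unit] at h1
  have h3 : A t j i = 1 := by nlinarith
  rw [hui, h3, one_smul]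

end SimpTiling

end Cusp

/-! ## Counting tiles -/

section Counting

/-- If all tiles have three ideal vertices and there are at most six tiles, then one of five given
points is an ideal vertex of at most three tiles. -/
lemma exists_ncard_le_three {n : ℕ} {𝒯 : Set (Set ↥(hypSet n))} (hfin : 𝒯.Finite)
    (hcard : 𝒯.ncard ≤ 6) (hT : ∀ T ∈ 𝒯, (hIdealVerts n T).ncard = 3)
    {W : Set (EuclideanSpace ℝ (Fin (n + 1)))} (hW : W.ncard = 5) :
    ∃ w ∈ W, {T | T ∈ 𝒯 ∧ w ∈ hIdealVerts n T}.ncard ≤ 3 := by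
  classical
  by_contra hcon
  push Not at hcon
  have hWfin : W.Finite := Set.finite_of_ncard_ne_zero (by omega)
  have key := Finset.card_mul_le_card_mul (s := hWfin.toFinset) (t := hfin.toFinset)
    (fun w T => w ∈ hIdealVerts n T) (m := 4) (n := 3) (fun w hw => ?_) (fun T hTm => ?_)
  · rw [← Set.ncard_eq_toFinset_card W hWfin, ← Set.ncard_eq_toFinset_card 𝒯 hfin] at key
    omega
  · have h1 := hcon w (hWfin.mem_toFinset.1 hw)
    rw [← Set.ncard_coe_finset]
    refine Nat.succ_le_of_lt (h1.trans_eq (congrArg _ ?_))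
    ext T
    simp [Finset.bipartiteAbove]
  · have h1 := hT T (hfin.mem_toFinset.1 hTm)
    rw [← h1, ← Set.ncard_coe_finset]
    refine Set.ncard_le_ncard (fun w hw => ?_) (Set.finite_of_ncard_ne_zero (by omega))
    exact (Finset.mem_filter.1 (Finset.mem_coe.1 hw)).2

lemma ncard_le_six {n : ℕ} {v r : Fin (n + 1) → EuclideanSpace ℝ (Fin (n + 1))}
    {P : Set ↥(hypSet n)} {𝒯 : Set (Set ↥(hypSet n))}
    {V R : Set ↥(hypSet n) → Fin (n + 1) → EuclideanSpace ℝ (Fin (n + 1))}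
    (h : SimpTiling v r P 𝒯 V R) {c : ℝ≥0∞} (hc : ∀ T ∈ 𝒯, hVol n T = c) (h0 : c ≠ 0)
    (htop : c ≠ ⊤) (hP : hVol n P = 6 * c) : 𝒯.ncard ≤ 6 := by
  have key := ncard_mul_hVol_le h.base_eq h.finite
    (fun T hT => ⟨V T, (h.tile T hT).unit, h.tile_eq T hT⟩) hc
    (fun T hT => h.sUnion ▸ subset_sUnion_of_mem hT) h.disj
  rw [hP, ENNReal.mul_le_mul_iff_left h0 htop] at key
  exact_mod_cast key

lemma cos_cmD4t {v : Fin 6 → EuclideanSpace ℝ (Fin 6)} (hv : StarGram v) {a : Fin 6} (ha : a ≠ 0)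
    {i j : Fin 5} (hij : i ≠ j) :
    mink 5 (v (a.succAbove i)) (v (a.succAbove j)) = -Real.cos (Real.pi / (cmD4t i j : ℝ)) := by
  have h0 : a.succAbove 0 = 0 := Fin.succAbove_ne_zero_zero ha
  have hne : ∀ k : Fin 5, k ≠ 0 → a.succAbove k ≠ 0 := fun k hk => Fin.succAbove_ne_zero ha hk
  by_cases hi : i = 0
  · subst hi
    rw [h0, hv.1 _ (hne j hij.symm), cos_cmD4t_leaf hij.symm]
  · by_cases hj : j = 0
    · subst hj
      have : cmD4t i 0 = cmD4t 0 i := (by decide : ∀ i : Fin 5, cmD4t i 0 = cmD4t 0 i) i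
      rw [h0, mink_comm, hv.1 _ (hne i hi), this, cos_cmD4t_leaf hi]
    · rw [hv.2 _ _ (hne i hi) (hne j hj) (Fin.succAbove_right_injective.ne hij),
        cos_cmD4t_of_ne hi hj hij, neg_zero]

end Counting

/-- **(Section 3.2.3 of the paper.)** There is no Coxeter decomposition of the
second type of the hyperbolic simplex `H₁₁⁵` with fundamental simplex `H₇⁵`. -/
theorem statement15 (P F : Set ↥(hypSet 5)) (hF : IsH75 F) (hP : IsH115 P) :
    ¬∃ 𝒯, hSTDecomp 5 P F 𝒯 := by
  rintro ⟨𝒯, ⟨hfin, -, -, hunion, hdisj, -⟩, hcongr, h2⟩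
  have hvol := hP.2.2.2.2.2.2 F hF
  have hPid := hP.2.2.2.1
  obtain ⟨-, hFcs, -, hFid, hFsub, hFlo, hFhi⟩ := hF
  obtain ⟨vF, rF, hdF, hFeq, -⟩ :=
    exists_coxeter_simpData (by norm_num) hFcs (by rw [hFid]; norm_num)
  obtain ⟨v, r, hd, hPeq, hstar, hr0⟩ := hP.exists_starGram
  have hex : ∀ T ∈ 𝒯, ∃ V R : Fin 6 → EuclideanSpace ℝ (Fin 6), SimpData V R ∧
      T = ⋂ i, hHalf 5 (V i) ∧ (∀ i j, mink 5 (V i) (V j) = mink 5 (vF i) (vF j)) ∧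
      (∀ i j, mink 5 (R i) (R j) = mink 5 (rF i) (rF j)) ∧ hVol 5 T = hVol 5 F := by
    intro T hT
    obtain ⟨g, hg, rfl⟩ := hcongr T hT
    obtain ⟨L, hL, hgL⟩ := exists_lorentz hg
    exact ⟨_, _, hdF.map (by norm_num) hL hgL, by rw [hFeq, image_iInter_hHalf hg hL hgL],
      fun i j => hL _ _, fun i j => hL _ _, hVol_image hFeq hg⟩
  choose! V R hVR hTeq hVgram hRgram hTvol using hex
  have htil : SimpTiling v r P 𝒯 V R := ⟨hd, hPeq, hfin, hunion, hVR, hTeq, hdisj⟩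
  have hcard := ncard_le_six htil hTvol (ne_bot_of_gt hFlo) (ne_top_of_lt hFhi) hvol
  have hTid : ∀ T ∈ 𝒯, (hIdealVerts 5 T).ncard = 3 := fun T hT => by
    rw [(hVR T hT).ncard_idealVerts (hTeq T hT) (by norm_num), ← hFid,
      hdF.ncard_idealVerts hFeq (by norm_num)]
    simp only [hRgram T hT]
  obtain ⟨w, hw, hle⟩ := exists_ncard_le_three hfin hcard hTid hPid
  rw [hd.idealVerts_eq hPeq (by norm_num)] at hw
  obtain ⟨a, ha, rfl⟩ := hw
  have ha0 : a ≠ 0 := by rintro rfl; exact hr0 ha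
  obtain ⟨T, hT, hk⟩ := htil.exists_tile_normals (by norm_num) h2 ha hle
  choose κ hκ using fun j : Fin 5 => hk (a.succAbove j) (Fin.succAbove_ne a j)
  have hinj : Function.Injective κ := fun i j hij => by
    by_contra h
    have h1 : v (a.succAbove i) = v (a.succAbove j) := by rw [← hκ, ← hκ, hij]
    exact hd.wall_ne hPeq (by norm_num) (Fin.succAbove_right_injective.ne h) (by rw [h1])
  refine hFsub ⟨_, fun i => vF (κ i), fun i => hdF.unit _, fun i j hij => ?_,
    fun i => hdF.isFacet hFeq (by norm_num) _, rfl, ?_⟩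
  · rw [← hVgram T hT, hκ, hκ, cos_cmD4t hstar ha0 hij]
  · rw [← Set.image_univ]
    exact (Set.ncard_image_of_injective _
      ((hdF.facet_injective hFeq (by norm_num)).comp hinj)).trans (by simp)

end CD
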